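/- Let A be a Dedekind domain containing a field of characteristic 0 and let ∂ be a triangular A-derivation of B = A[y,z,u], i.e. ∂y ∈ A, ∂z ∈ A[y] and ∂u ∈ A[y,z]. Assume that the G_a-action generated by ∂ is proper, i.e. the A-algebra homomorphism Φ*: B ⊗_A B → B[t], f ⊗ g ↦ f · Σ_{j≥0} (t^j/j!)·∂^j(g), is surjective. Then the action is a translation: there exists s ∈ B with ∂s = 1, the kernel ker ∂ is A-isomorphic to a polynomial ring in two variables over A, and the A-algebra homomorphism (ker ∂)[S] → B sending S to s and restricting to the inclusion on ker ∂ is an isomorphism. -/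

import Mathlib

/- STATEMENT 1: A proper triangular G_a-action on A^3 over a Dedekind domain A
containing a field of characteristic 0 is a translation. -/

open MvPolynomial

/-- The kernel of a derivation, as a subalgebra. -/
def kerDer {R B : Type*} [CommRing R] [CommRing B] [Algebra R B]
    (D : Derivation R B B) : Subalgebra R B where
  carrier := {b | D b = 0}
  add_mem' := by
    intro a b ha hb
    simp only [Set.mem_setOf_eq] at ha hb ⊢
    rw [map_add, ha, hb, add_zero]
  mul_mem' := by
    intro a b ha hb
    simp only [Set.mem_setOf_eq] at ha hb ⊢
    rw [D.leibniz, ha, hb, smul_zero, smul_zero, add_zero]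
  algebraMap_mem' := by
    intro r
    show D (algebraMap R B r) = 0
    simp

/-- The truncated exponential `∑_{j<N} (t^j/j!)·D^j(g)` of a derivation, an element of `B[t]`.
If `D^[N] g = 0` this is the full exponential `Σ_{j≥0} (t^j/j!)·D^j(g)`. -/
noncomputable def expPoly {B : Type*} [CommRing B] [Algebra ℚ B]
    (D : B → B) (N : ℕ) (g : B) : Polynomial B :=
  ∑ j ∈ Finset.range N, Polynomial.C ((j.factorial : ℚ)⁻¹ • D^[j] g) * Polynomial.X ^ j

/-- Properness of the `G_a`-action generated by a locally nilpotent derivation `D` of `B`,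
expressed as surjectivity of the homomorphism `Φ* : B ⊗ B → B[t]`,
`f ⊗ g ↦ f · Σ_{j≥0} (t^j/j!)·D^j(g)`: every `h ∈ B[t]` is a finite sum
`Σ_i C (f i) · exp(D)(g i)`. -/
def IsProperGaAction {R B : Type*} [CommRing R] [CommRing B] [Algebra R B] [Algebra ℚ B]
    (D : Derivation R B B) : Prop :=
  ∀ h : Polynomial B, ∃ (m : ℕ) (f g : Fin m → B) (N : ℕ),
    (∀ i, (⇑D)^[N] (g i) = 0) ∧
    h = ∑ i, Polynomial.C (f i) * expPoly (⇑D) N (g i)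

set_option linter.unusedSectionVars false

namespace Polynomial.AMVal

variable {L Γ : Type*} [Field L] [LinearOrderedCommGroupWithZero Γ] (v : Valuation L Γ)

/-- The residue field of a valuation. -/
abbrev Res := IsLocalRing.ResidueField v.valuationSubring

/-- `F` has integral coefficients and reduction `f`. -/
def IsRed (F : Polynomial L) (f : Polynomial (Res v)) : Prop :=
  ∃ G : Polynomial v.valuationSubring, G.map (algebraMap _ L) = F ∧ G.map (IsLocalRing.residue _) = f

open Classical in
/-- Residue map extended by zero. -/
noncomputable def rs (x : L) : Res v :=
  if h : v x ≤ 1 then IsLocalRing.residue v.valuationSubring ⟨x, h⟩ else 0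

variable {v}

lemma rs_of_le {x : L} (h : v x ≤ 1) :
    rs v x = IsLocalRing.residue v.valuationSubring ⟨x, h⟩ := by simp [rs, h]

lemma rs_eq_zero_iff {x : L} (h : v x ≤ 1) : rs v x = 0 ↔ v x < 1 := by
  rw [rs_of_le h, IsLocalRing.residue_eq_zero_iff, Valuation.mem_maximalIdeal_iff]

lemma rs_eq_iff {x y : L} (hx : v x ≤ 1) (hy : v y ≤ 1) : rs v x = rs v y ↔ v (x - y) < 1 := by
  rw [rs_of_le hx, rs_of_le hy, ← sub_eq_zero, ← map_sub, IsLocalRing.residue_eq_zero_iff,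
    Valuation.mem_maximalIdeal_iff]
  rfl

namespace IsRed

variable {F G : Polynomial L} {f g : Polynomial (Res v)}

lemma mul (hF : IsRed v F f) (hG : IsRed v G g) : IsRed v (F * G) (f * g) := by
  obtain ⟨a, rfl, rfl⟩ := hF
  obtain ⟨b, rfl, rfl⟩ := hG
  exact ⟨a * b, by simp, by simp⟩

lemma sub (hF : IsRed v F f) (hG : IsRed v G g) : IsRed v (F - G) (f - g) := by
  obtain ⟨a, rfl, rfl⟩ := hF
  obtain ⟨b, rfl, rfl⟩ := hG
  exact ⟨a - b, by simp, by simp⟩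

lemma pow (hF : IsRed v F f) (n : ℕ) : IsRed v (F ^ n) (f ^ n) := by
  obtain ⟨a, rfl, rfl⟩ := hF
  exact ⟨a ^ n, by simp, by simp⟩

lemma one : IsRed v 1 1 := ⟨1, by simp, by simp⟩

lemma const {x : L} (h : v x ≤ 1) : IsRed v (C x) (C (rs v x)) :=
  ⟨C ⟨x, h⟩, by simp, by simp [rs_of_le h]⟩

lemma var : IsRed v X X := ⟨X, by simp, by simp⟩

lemma coeff_le (hF : IsRed v F f) (j : ℕ) : v (F.coeff j) ≤ 1 := by
  obtain ⟨a, rfl, rfl⟩ := hF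
  rw [coeff_map]
  exact (a.coeff j).2

lemma coeff_eq (hF : IsRed v F f) (j : ℕ) : f.coeff j = rs v (F.coeff j) := by
  have h := hF.coeff_le j
  obtain ⟨a, rfl, rfl⟩ := hF
  rw [rs_of_le h, coeff_map]
  congr 1
  ext
  simp

lemma coeff_ne_zero_iff (hF : IsRed v F f) (j : ℕ) : f.coeff j ≠ 0 ↔ v (F.coeff j) = 1 := by
  rw [hF.coeff_eq, Ne, rs_eq_zero_iff (hF.coeff_le j), not_lt]
  exact ⟨fun h => le_antisymm (hF.coeff_le j) h, fun h => h.ge⟩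

end IsRed

/-- The support of the reduction depends only on the valuations of the coefficients. -/
lemma support_eq {F F' : Polynomial L} {f f' : Polynomial (Res v)} {a a' : L} (ha : a ≠ 0) (ha' : a' ≠ 0)
    (hf : f ≠ 0) (hf' : f' ≠ 0) (h : IsRed v (C a⁻¹ * F) f) (h' : IsRed v (C a'⁻¹ * F') f')
    (hv : ∀ j, v (F.coeff j) = v (F'.coeff j)) : f.support = f'.support ∧ v a = v a' := by
  have key : ∀ {F F' : Polynomial L} {f f' : Polynomial (Res v)} {a a' : L} (_ : a ≠ 0) (_ : a' ≠ 0)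
      (_ : f ≠ 0) (_ : IsRed v (C a⁻¹ * F) f) (_ : IsRed v (C a'⁻¹ * F') f')
      (_ : ∀ j, v (F.coeff j) = v (F'.coeff j)), v a ≤ v a' := by
    intro F F' f f' a a' ha ha' hf h h' hv
    obtain ⟨j, hj⟩ : ∃ j, f.coeff j ≠ 0 := by
      by_contra! hc
      exact hf (Polynomial.ext (by simpa using hc))
    have h1 := (h.coeff_ne_zero_iff j).1 hj
    have h2 := h'.coeff_le j
    rw [coeff_C_mul, map_mul, map_inv₀] at h1 h2
    have e1 : v (F.coeff j) = v a := by
      have := (v.ne_zero_iff).2 ha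
      field_simp at h1
      exact h1
    rw [← hv, e1] at h2
    have := (v.ne_zero_iff).2 ha'
    rwa [inv_mul_le_one₀ (zero_lt_iff.2 this)] at h2
  have hva : v a = v a' :=
    le_antisymm (key ha ha' hf h h' hv) (key ha' ha hf' h' h fun j => (hv j).symm)
  refine ⟨?_, hva⟩
  ext j
  rw [mem_support_iff, mem_support_iff, h.coeff_ne_zero_iff, h'.coeff_ne_zero_iff, coeff_C_mul,
    coeff_C_mul, map_mul, map_mul, map_inv₀, map_inv₀, hva, hv]

lemma natDegree_eq_of_support {R S : Type*} [Semiring R] [Semiring S] {f : Polynomial R} {g : Polynomial S}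
    (h : f.support = g.support) : f.natDegree = g.natDegree := by
  rw [natDegree, natDegree, degree, degree, Finset.max, Finset.max, h]

open Classical in
/-- The normalizing constant of `∏ (X - η)`. -/
noncomputable def lam (v : Valuation L Γ) (s : Multiset L) : L :=
  (s.map fun η => if v η ≤ 1 then 1 else -η).prod

open Classical in
/-- The reduction of the normalized polynomial `∏ (X - η)`. -/
noncomputable def redp (v : Valuation L Γ) (s : Multiset L) : Polynomial (Res v) :=
  ((s.filter fun η => v η ≤ 1).map fun η => X - C (rs v η)).prod

lemma lam_ne_zero (s : Multiset L) : lam v s ≠ 0 := by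
  classical
  rw [lam, Ne, Multiset.prod_eq_zero_iff]
  simp only [Multiset.mem_map, not_exists, not_and]
  intro x _ h
  split_ifs at h with h1
  · exact one_ne_zero h
  · apply h1; rw [neg_eq_zero] at h; simp [h]

lemma v_lam (s : Multiset L) : v (lam v s) = (s.map fun η => max 1 (v η)).prod := by
  classical
  rw [lam, map_multiset_prod, Multiset.map_map]
  congr 1
  refine Multiset.map_congr rfl fun x _ => ?_
  simp only [Function.comp]
  split_ifs with h
  · simp [h]
  · rw [max_eq_right (le_of_not_ge h), Valuation.map_neg]

lemma isRed_redp (s : Multiset L) :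
    IsRed v (C (lam v s)⁻¹ * (s.map fun η => X - C η).prod) (redp v s) := by
  classical
  induction s using Multiset.induction_on with
  | empty => simpa [lam, redp] using IsRed.one
  | cons a s ih =>
    by_cases h : v a ≤ 1
    · have := (IsRed.var.sub (IsRed.const h)).mul ih
      simp only [lam, redp, Multiset.map_cons, Multiset.prod_cons, h, if_true, one_mul,
        Multiset.filter_cons_of_pos] at this ⊢
      convert this using 1
      ring
    · have ha : a ≠ 0 := by rintro rfl; simp at h
      have h1 : v (-a⁻¹) < 1 := by
        rw [Valuation.map_neg, map_inv₀]
        exact inv_lt_one_of_one_lt₀ (not_le.1 h)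
      have h2 : IsRed v (C (-a⁻¹) * (X - C a)) 1 := by
        have h3 := IsRed.one.sub ((IsRed.const (v := v) (x := a⁻¹)
          (by simpa using h1.le)).mul IsRed.var)
        have h4 : rs v a⁻¹ = 0 := (rs_eq_zero_iff (by simpa using h1.le)).2 (by simpa using h1)
        rw [h4] at h3
        convert h3 using 1
        · have : C a⁻¹ * C a = (1 : Polynomial L) := by rw [← C_mul, inv_mul_cancel₀ ha, C_1]
          rw [C_neg]
          linear_combination this
        · simp
      have := h2.mul ih
      simp only [lam, redp, Multiset.map_cons, Multiset.prod_cons, h, if_false, one_mul,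
        Multiset.filter_cons_of_neg, not_false_eq_true] at this ⊢
      convert this using 1
      rw [mul_inv, ← neg_inv]
      simp only [C_mul]
      ring

lemma redp_monic (s : Multiset L) : (redp v s).Monic :=
  monic_multiset_prod_of_monic _ _ fun _ _ => monic_X_sub_C _

open Classical in
lemma redp_natDegree (s : Multiset L) :
    (redp v s).natDegree = s.countP (fun η => v η ≤ 1) := by
  rw [redp, natDegree_multiset_prod_of_monic _ (by
    intro f hf
    obtain ⟨x, -, rfl⟩ := Multiset.mem_map.1 hf
    exact monic_X_sub_C _), Multiset.map_map]
  simp [Multiset.countP_eq_card_filter]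

open Classical in
lemma redp_roots (s : Multiset L) :
    (redp v s).roots = (s.filter fun η => v η ≤ 1).map (rs v) := by
  have : ((s.filter fun η => v η ≤ 1).map fun η => X - C (rs v η)) =
      ((s.filter fun η => v η ≤ 1).map (rs v)).map fun a => X - C a := by
    rw [Multiset.map_map]; rfl
  rw [redp, this]
  exact roots_multiset_prod_X_sub_C _

open Classical in
lemma redp_rootMultiplicity (s : Multiset L) {x : L} (hx : v x ≤ 1) :
    (redp v s).rootMultiplicity (rs v x) = s.countP (fun η => v (η - x) < 1) := by
  rw [← count_roots, redp_roots, Multiset.count_map, Multiset.countP_eq_card_filter,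
    Multiset.filter_filter]
  congr 1
  refine Multiset.filter_congr fun y _ => ?_
  constructor
  · rintro ⟨h1, h2⟩
    rw [rs_eq_iff hx h2] at h1
    rwa [Valuation.map_sub_swap]
  · intro h
    have : v y ≤ 1 := by
      have := v.map_add_le h.le hx
      simpa using this
    rw [rs_eq_iff hx this, Valuation.map_sub_swap]
    exact ⟨h, this⟩

open Classical in
lemma redp_natTrailingDegree (s : Multiset L) :
    (redp v s).natTrailingDegree = s.countP (fun η => v η < 1) := by
  have := redp_rootMultiplicity (v := v) s (x := 0) (by simp)
  rw [show rs v 0 = 0 from (rs_eq_zero_iff (by simp)).2 (by simp)] at this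
  rw [← rootMultiplicity_eq_natTrailingDegree', this]
  simp

variable {L Γ : Type*} [Field L] [LinearOrderedCommGroupWithZero Γ] (v : Valuation L Γ)

/-- The roots of `A` in the coordinate `t`, `Y = γ + b t`. -/
noncomputable def shiftRoots (A : Polynomial L) (γ b : L) : Multiset L :=
  A.roots.map fun η => (η - γ) / b

/-- The normalizing constant of `A(γ + b t)`. -/
noncomputable def Lam (A : Polynomial L) (γ b : L) : L :=
  A.leadingCoeff * b ^ A.natDegree * lam v (shiftRoots A γ b)

/-- The normalized reduction of `A(γ + b t)`. -/
noncomputable def red (A : Polynomial L) (γ b : L) : Polynomial (Res v) :=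
  redp v (shiftRoots A γ b)

open Classical in
/-- The number of roots of `A` in a closed ball. -/
noncomputable def nc (A : Polynomial L) (γ b : L) : ℕ :=
  A.roots.countP fun η => v (η - γ) ≤ v b

open Classical in
/-- The number of roots of `A` in an open ball. -/
noncomputable def no (A : Polynomial L) (γ b : L) : ℕ :=
  A.roots.countP fun η => v (η - γ) < v b

variable {v}

lemma Lam_ne_zero {A : Polynomial L} (hA : A ≠ 0) {b : L} (hb : b ≠ 0) (γ : L) :
    Lam v A γ b ≠ 0 :=
  mul_ne_zero (mul_ne_zero (leadingCoeff_ne_zero.2 hA) (pow_ne_zero _ hb)) (lam_ne_zero _)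

lemma card_roots_eq [IsAlgClosed L] (A : Polynomial L) : Multiset.card A.roots = A.natDegree :=
  (IsAlgClosed.splits A).natDegree_eq_card_roots.symm

lemma comp_eq [IsAlgClosed L] (A : Polynomial L) {b : L} (hb : b ≠ 0) (γ : L) :
    A.comp (C γ + C b * X) = C (A.leadingCoeff * b ^ A.natDegree) *
      ((shiftRoots A γ b).map fun η => X - C η).prod := by
  have h : A = C A.leadingCoeff * (A.roots.map fun a => X - C a).prod :=
    (IsAlgClosed.splits A).eq_prod_roots
  conv_lhs => rw [h]
  rw [mul_comp, C_comp, multiset_prod_comp, C_mul, mul_assoc, ← card_roots_eq, shiftRoots]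
  congr 1
  generalize A.roots = s
  induction s using Multiset.induction_on with
  | empty => simp
  | cons a s ih =>
    simp only [Multiset.map_cons, Multiset.prod_cons, Multiset.card_cons]
    rw [ih]
    have : C b * C ((a - γ) / b) = C a - C γ := by
      rw [← C_mul, mul_div_cancel₀ _ hb, C_sub]
    simp only [sub_comp, X_comp, C_comp, C_pow, C_mul, pow_succ]
    linear_combination (C b ^ Multiset.card s *
      (Multiset.map (fun η => X - C η) (Multiset.map (fun η => (η - γ) / b) s)).prod) * this

lemma isRed_red [IsAlgClosed L] {A : Polynomial L} (hA : A ≠ 0) {b : L} (hb : b ≠ 0) (γ : L) :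
    IsRed v (C (Lam v A γ b)⁻¹ * A.comp (C γ + C b * X)) (red v A γ b) := by
  have := isRed_redp (v := v) (shiftRoots A γ b)
  rw [red]
  convert this using 1
  rw [comp_eq A hb, Lam, mul_inv (A.leadingCoeff * b ^ A.natDegree), C_mul, mul_mul_mul_comm,
    ← C_mul, inv_mul_cancel₀, C_1, one_mul]
  exact mul_ne_zero (leadingCoeff_ne_zero.2 hA) (pow_ne_zero _ hb)

lemma red_monic (A : Polynomial L) (γ b : L) : (red v A γ b).Monic := redp_monic _

lemma red_natDegree (A : Polynomial L) {b : L} (hb : b ≠ 0) (γ : L) :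
    (red v A γ b).natDegree = nc v A γ b := by
  classical
  rw [red, redp_natDegree, shiftRoots, Multiset.countP_map, nc, Multiset.countP_eq_card_filter]
  congr 1
  refine Multiset.filter_congr fun η _ => ?_
  rw [map_div₀, div_le_one₀ (zero_lt_iff.2 ((v.ne_zero_iff).2 hb))]

lemma red_natTrailingDegree (A : Polynomial L) {b : L} (hb : b ≠ 0) (γ : L) :
    (red v A γ b).natTrailingDegree = no v A γ b := by
  classical
  rw [red, redp_natTrailingDegree, shiftRoots, Multiset.countP_map, no,
    Multiset.countP_eq_card_filter]
  congr 1
  refine Multiset.filter_congr fun η _ => ?_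
  rw [map_div₀, div_lt_one₀ (zero_lt_iff.2 ((v.ne_zero_iff).2 hb))]

lemma v_Lam [IsAlgClosed L] (A : Polynomial L) {b : L} (hb : b ≠ 0) (γ : L) :
    v (Lam v A γ b) = v A.leadingCoeff *
      (A.roots.map fun η => max (v b) (v (η - γ))).prod := by
  rw [Lam, map_mul, map_mul, map_pow, v_lam, mul_assoc, ← card_roots_eq, shiftRoots,
    Multiset.map_map]
  congr 1
  generalize A.roots = s
  have hb' : 0 < v b := zero_lt_iff.2 ((v.ne_zero_iff).2 hb)
  induction s using Multiset.induction_on with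
  | empty => simp
  | cons a s ih =>
    simp only [Multiset.map_cons, Multiset.prod_cons, Multiset.card_cons] at ih ⊢
    rw [← ih, pow_succ]
    have : max (v b) (v (a - γ)) = v b * max 1 (v ((a - γ) / b)) := by
      rw [mul_max, mul_one, map_div₀, mul_div_cancel₀ _ hb'.ne']
    simp only [this, Function.comp]
    ac_rfl

lemma v_eval [IsAlgClosed L] (A : Polynomial L) (γ : L) :
    v (A.eval γ) = v A.leadingCoeff * (A.roots.map fun η => v (η - γ)).prod := by
  have h : A = C A.leadingCoeff * (A.roots.map fun a => X - C a).prod :=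
    (IsAlgClosed.splits A).eq_prod_roots
  conv_lhs => rw [h]
  rw [eval_mul, eval_C, map_mul, eval_multiset_prod, map_multiset_prod, Multiset.map_map,
    Multiset.map_map]
  congr 2
  refine Multiset.map_congr rfl fun x _ => ?_
  simp [Valuation.map_sub_swap]

lemma v_eval_of_no [IsAlgClosed L] (A : Polynomial L) {b : L} (hb : b ≠ 0) {γ : L} (h : no v A γ b = 0) :
    v (A.eval γ) = v (Lam v A γ b) := by
  classical
  rw [v_eval, v_Lam A hb]
  congr 2
  refine Multiset.map_congr rfl fun x hx => ?_
  rw [no, Multiset.countP_eq_zero] at h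
  exact (max_eq_right (not_lt.1 (h x hx))).symm

lemma v_eval_le [IsAlgClosed L] (A : Polynomial L) {b : L} (hb : b ≠ 0) (γ : L) :
    v (A.eval γ) ≤ v (Lam v A γ b) := by
  by_cases hA : A = 0
  · simp [hA]
  have h := (isRed_red (v := v) hA hb γ).coeff_le 0
  have h0 := zero_lt_iff.2 ((v.ne_zero_iff).2 (Lam_ne_zero (v := v) hA hb γ))
  rw [coeff_zero_eq_eval_zero, eval_mul, eval_comp] at h
  simp only [eval_C, eval_add, eval_mul, eval_X, mul_zero, add_zero, map_mul, map_inv₀] at h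
  rwa [inv_mul_le_one₀ h0] at h

lemma coeff_comp (A : Polynomial L) (γ b : L) (j : ℕ) :
    (A.comp (C γ + C b * X)).coeff j = b ^ j * (hasseDeriv j A).eval γ := by
  have : A.comp (C γ + C b * X) = (taylor γ A).comp (C b * X) := by
    rw [taylor_apply, comp_assoc]
    simp [add_comm]
  rw [this, comp_C_mul_X_coeff, taylor_coeff, mul_comm]

/-- Ball counts and norms depend only on the valuations of the Taylor coefficients. -/
lemma inv_of_hasse [IsAlgClosed L] {A : Polynomial L} (hA : A ≠ 0) {b : L} (hb : b ≠ 0) {γ γ' : L}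
    (h : ∀ j, v ((hasseDeriv j A).eval γ) = v ((hasseDeriv j A).eval γ')) :
    nc v A γ b = nc v A γ' b ∧ no v A γ b = no v A γ' b := by
  have := (support_eq (Lam_ne_zero hA hb γ) (Lam_ne_zero hA hb γ') (red_monic A γ b).ne_zero
    (red_monic A γ' b).ne_zero (isRed_red (v := v) hA hb γ) (isRed_red hA hb γ')
    (fun j => by rw [coeff_comp, coeff_comp, map_mul, map_mul, h])).1
  rw [← red_natDegree A hb, ← red_natDegree A hb, ← red_natTrailingDegree A hb,
    ← red_natTrailingDegree A hb]
  refine ⟨natDegree_eq_of_support this, ?_⟩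
  rw [natTrailingDegree, natTrailingDegree, trailingDegree, trailingDegree, this]

/-- The cofactor of `P - Q` in `P ^ d - Q ^ d`, for `P`, `Q` monic of the same degree. -/
lemma geom_cofactor {R : Type*} [CommRing R] {P Q : Polynomial R} {N : ℕ} (hP : P.Monic)
    (hQ : Q.Monic) (hPN : P.natDegree = N) (hQN : Q.natDegree = N) (d : ℕ) :
    ∃ S : Polynomial R, P ^ d - Q ^ d = (P - Q) * S ∧ S.natDegree ≤ (d - 1) * N ∧
      S.coeff ((d - 1) * N) = d := by
  have hterm : ∀ i ∈ Finset.range d, (P ^ i * Q ^ (d - 1 - i)).Monic ∧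
      (P ^ i * Q ^ (d - 1 - i)).natDegree = (d - 1) * N := by
    intro i hi
    have hi' : i + (d - 1 - i) = d - 1 := by have := Finset.mem_range.1 hi; omega
    refine ⟨(hP.pow _).mul (hQ.pow _), ?_⟩
    rw [(hP.pow _).natDegree_mul (hQ.pow _), hP.natDegree_pow, hQ.natDegree_pow, hPN, hQN,
      ← add_mul, hi']
  refine ⟨∑ i ∈ Finset.range d, P ^ i * Q ^ (d - 1 - i), ?_, ?_, ?_⟩
  · rw [mul_comm, (Commute.all P Q).geom_sum₂_mul]
  · exact natDegree_sum_le_of_forall_le _ _ fun i hi => (hterm i hi).2.le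
  · rw [finsetSum_coeff, Finset.sum_congr rfl (g := fun _ => 1)]
    · simp
    · intro i hi
      rw [← (hterm i hi).2]
      exact (hterm i hi).1

/-- Existence of approximate roots. -/
lemma exists_approx_root {R : Type*} [CommRing R] [Nontrivial R] [Algebra ℚ R] {e : Polynomial R}
    (he : e.Monic) {M d : ℕ} (hd : d ≠ 0) (hm : e.natDegree = M * d) :
    ∃ P : Polynomial R, P.Monic ∧ P.natDegree = M ∧
      (e - P ^ d).degree < ((M * d - M : ℕ) : WithBot ℕ) := by
  obtain ⟨d, rfl⟩ := Nat.exists_eq_succ_of_ne_zero hd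
  have key : ∀ k ≤ M, ∃ P : Polynomial R, P.Monic ∧ P.natDegree = M ∧
      (e - P ^ (d + 1)).degree < ((M * (d + 1) - k : ℕ) : WithBot ℕ) := by
    intro k
    induction k with
    | zero =>
      intro _
      refine ⟨X ^ M, monic_X_pow M, natDegree_X_pow M, ?_⟩
      have h1 : ((X : Polynomial R) ^ M) ^ (d + 1) = X ^ (M * (d + 1)) := by rw [pow_mul]
      rw [h1]
      have h2 : e.degree = ((M * (d + 1) : ℕ) : WithBot ℕ) := by
        rw [degree_eq_natDegree he.ne_zero, hm]
      have := degree_sub_lt_left (p := e) (q := X ^ (M * (d + 1))) (by rw [h2, degree_X_pow])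
        he.ne_zero (by rw [he.leadingCoeff, (monic_X_pow _).leadingCoeff])
      rwa [h2] at this
    | succ k ih =>
      intro hk
      obtain ⟨P, hP, hPM, hPd⟩ := ih (by omega)
      set n := M * (d + 1) - (k + 1) with hn
      have hn' : n = d * M + (M - (k + 1)) := by
        have : M * (d + 1) = d * M + M := by ring
        omega
      set c := (e - P ^ (d + 1)).coeff n with hc
      set Q : Polynomial R := C (((d + 1 : ℕ) : ℚ)⁻¹ • c) * X ^ (M - (k + 1)) with hQ
      have hQd : Q.degree < P.degree := by
        rw [degree_eq_natDegree hP.ne_zero, hPM]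
        refine (degree_C_mul_X_pow_le _ _).trans_lt ?_
        exact_mod_cast (by omega : M - (k + 1) < M)
      have hmon : (P + Q).Monic := hP.add_of_left hQd
      have hnd : (P + Q).natDegree = M := by
        rw [natDegree_eq_of_degree_eq (degree_add_eq_left_of_degree_lt hQd), hPM]
      obtain ⟨S, hS, hSd, hSc⟩ := geom_cofactor hmon hP hnd hPM (d + 1)
      simp only [Nat.add_sub_cancel, add_sub_cancel_left] at hS hSd hSc
      refine ⟨P + Q, hmon, hnd, ?_⟩
      have h3 : e - (P + Q) ^ (d + 1) = (e - P ^ (d + 1)) - Q * S := by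
        rw [← hS]; ring
      have hle : (e - (P + Q) ^ (d + 1)).degree ≤ (n : WithBot ℕ) := by
        rw [h3]
        refine (degree_sub_le _ _).trans (max_le ?_ ?_)
        · have : M * (d + 1) - k = n + 1 := by
            have : M ≤ M * (d + 1) := Nat.le_mul_of_pos_right _ (Nat.succ_pos d)
            omega
          rw [this] at hPd
          refine (degree_le_iff_coeff_zero _ _).2 fun j hj => ?_
          exact (degree_lt_iff_coeff_zero _ _).1 hPd j (by exact_mod_cast hj)
        · refine (degree_mul_le _ _).trans ?_
          rw [hn', Nat.cast_add, add_comm]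
          exact add_le_add (degree_le_of_natDegree_le hSd) (degree_C_mul_X_pow_le _ _)
      refine lt_of_le_of_ne hle fun heq => ?_
      have h0 : (e - (P + Q) ^ (d + 1)).coeff n = 0 := by
        rw [h3, coeff_sub, ← hc, hQ, mul_assoc, coeff_C_mul, hn',
          mul_comm (X ^ (M - (k + 1))), coeff_mul_X_pow, hSc]
        have : (((d + 1 : ℕ) : ℚ)⁻¹ • c) * ((d + 1 : ℕ) : R) = c := by
          rw [smul_mul_assoc, mul_comm, ← nsmul_eq_mul, ← Nat.cast_smul_eq_nsmul ℚ, smul_smul,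
            inv_mul_cancel₀, one_smul]
          exact_mod_cast Nat.succ_ne_zero d
        rw [this, sub_self]
      have hne : e - (P + Q) ^ (d + 1) ≠ 0 := by
        rintro h; rw [h, degree_zero] at heq; simp at heq
      rw [← natDegree_eq_of_degree_eq_some heq] at h0
      exact hne (leadingCoeff_eq_zero.1 h0)
  exact key M le_rfl

lemma exists_nsmul_of_dvd_count {α : Type*} [DecidableEq α] {s : Multiset α} {d : ℕ}
    (h : ∀ a, d ∣ s.count a) : ∃ t : Multiset α, s = d • t := by
  refine ⟨∑ a ∈ s.toFinset, (s.count a / d) • {a}, ?_⟩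
  ext a
  rw [Multiset.count_nsmul, Multiset.count_sum']
  simp only [Multiset.count_nsmul, Multiset.count_singleton]
  by_cases ha : a ∈ s
  · rw [Finset.sum_eq_single a] <;> simp_all [Nat.mul_div_cancel' (h a)]
    intro b _ hb h'
    exact absurd h'.symm hb
  · rw [Finset.sum_eq_zero]
    · simp [ha]
    · intro b hb
      rw [if_neg, mul_zero]
      rintro rfl
      exact ha (Multiset.mem_toFinset.1 hb)

lemma sum_countP_le {α ι : Type*} [Fintype ι] (P : α → ι → Prop) [∀ a i, Decidable (P a i)]
    (s : Multiset α) (D : ℕ)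
    (h : ∀ a, (Finset.univ.filter (P a)).card ≤ D) :
    ∑ i, s.countP (P · i) ≤ D * Multiset.card s := by
  induction s using Multiset.induction_on with
  | empty => simp
  | cons a s ih =>
    simp only [Multiset.countP_cons, Finset.sum_add_distrib, Multiset.card_cons, mul_add, mul_one]
    refine add_le_add ih ?_
    rw [← Finset.card_filter]
    exact h a

/-- Balls of constant cardinality partition any union of them. -/
lemma dvd_card_of_classes {ι : Type*} [Fintype ι] (r : ι → ι → Prop) [DecidableRel r]
    (hr : Equivalence r) {d : ℕ} (hd : ∀ i, (Finset.univ.filter (r i)).card = d) (s : Finset ι)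
    (hs : ∀ i ∈ s, ∀ j, r i j → j ∈ s) : d ∣ s.card := by
  classical
  rw [Finset.card_eq_sum_card_image (fun i => Finset.univ.filter (r i)) s]
  refine Finset.dvd_sum fun t ht => ?_
  obtain ⟨i, hi, rfl⟩ := Finset.mem_image.1 ht
  have : (s.filter fun a => Finset.univ.filter (r a) = Finset.univ.filter (r i)) =
      Finset.univ.filter (r i) := by
    ext j
    simp only [Finset.mem_filter, Finset.mem_univ, true_and]
    constructor
    · rintro ⟨-, h⟩
      have : j ∈ Finset.univ.filter (r j) := by simpa using hr.refl j
      rw [h] at this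
      simpa using this
    · intro h
      refine ⟨hs i hi j h, ?_⟩
      ext k
      simp only [Finset.mem_filter, Finset.mem_univ, true_and]
      exact ⟨fun h' => hr.trans h h', fun h' => hr.trans (hr.symm h) h'⟩
  rw [this, hd]

variable {L Γ R ι : Type*} [Field L] [LinearOrderedCommGroupWithZero Γ] {v : Valuation L Γ}
  [CommRing R] [Algebra R L] [Fintype ι] {g : ι → L} {e : Polynomial R}

/-- A finite family of distinct elements of `L`, the roots of a polynomial over `R`, on which the
valuation does not distinguish the values of polynomials over `R`. -/
structure OrthSys (v : Valuation L Γ) (g : ι → L) (e : Polynomial R) : Prop where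
  inj : Function.Injective g
  monic : e.Monic
  map_e : e.map (algebraMap R L) = ∏ i, (X - C (g i))
  inv : ∀ (a : Polynomial R) (i j : ι), v (aeval (g i) a) = v (aeval (g j) a)
  char : ∀ n : ℕ, n ≠ 0 → v (n : L) = 1

lemma hasseDeriv_map' {R S : Type*} [CommRing R] [CommRing S] (f : R →+* S) (k : ℕ)
    (a : Polynomial R) : hasseDeriv k (a.map f) = (hasseDeriv k a).map f := by
  ext n
  simp [hasseDeriv_coeff]

namespace OrthSys

lemma roots_e (h : OrthSys v g e) : (e.map (algebraMap R L)).roots = Finset.univ.val.map g := by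
  rw [h.map_e]
  have : (∏ i, (X - C (g i))) = ((Finset.univ.val.map g).map fun a => X - C a).prod := by
    rw [Multiset.map_map]; rfl
  rw [this]
  exact roots_multiset_prod_X_sub_C _

open Classical in
lemma nc_e (h : OrthSys v g e) (i : ι) (b : L) : nc v (e.map (algebraMap R L)) (g i) b =
    (Finset.univ.filter fun j => v (g j - g i) ≤ v b).card := by
  rw [nc, h.roots_e, Multiset.countP_map]
  rfl

open Classical in
lemma no_e (h : OrthSys v g e) (i : ι) (b : L) : no v (e.map (algebraMap R L)) (g i) b =
    (Finset.univ.filter fun j => v (g j - g i) < v b).card := by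
  rw [no, h.roots_e, Multiset.countP_map]
  rfl

lemma natDegree_e (h : OrthSys v g e) : e.natDegree = Fintype.card ι := by
  have : Nontrivial R := (algebraMap R L).domain_nontrivial
  rw [← h.monic.natDegree_map (algebraMap R L), h.map_e, natDegree_finsetProd_X_sub_C_eq_card]
  rfl

variable [IsAlgClosed L]

lemma counts_eq (h : OrthSys v g e) {a : Polynomial R} (ha : a.map (algebraMap R L) ≠ 0) {b : L}
    (hb : b ≠ 0) (i j : ι) :
    nc v (a.map (algebraMap R L)) (g i) b = nc v (a.map (algebraMap R L)) (g j) b ∧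
    no v (a.map (algebraMap R L)) (g i) b = no v (a.map (algebraMap R L)) (g j) b := by
  refine inv_of_hasse ha hb fun k => ?_
  rw [hasseDeriv_map', eval_map_algebraMap, eval_map_algebraMap]
  exact h.inv _ _ _

lemma card_mul_nc_le (h : OrthSys v g e) {a : Polynomial R} (ha : a.map (algebraMap R L) ≠ 0)
    {b : L} (hb : b ≠ 0) (i : ι) :
    Fintype.card ι * nc v (a.map (algebraMap R L)) (g i) b ≤
      nc v (e.map (algebraMap R L)) (g i) b * (a.map (algebraMap R L)).natDegree := by
  classical
  have : Nontrivial R := (algebraMap R L).domain_nontrivial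
  have := sum_countP_le (fun (η : L) (j : ι) => v (η - g j) ≤ v b)
    (a.map (algebraMap R L)).roots (nc v (e.map (algebraMap R L)) (g i) b) fun η => by
      by_cases hne : ∃ j, v (η - g j) ≤ v b
      · obtain ⟨j, hj⟩ := hne
        have he : e.map (algebraMap R L) ≠ 0 := (h.monic.map _).ne_zero
        rw [(h.counts_eq he hb i j).1, h.nc_e]
        refine Finset.card_le_card fun k hk => ?_
        simp only [Finset.mem_filter, Finset.mem_univ, true_and] at hk ⊢
        have := v.map_sub_le hj hk
        simpa using this
      · push Not at hne
        rw [Finset.filter_false_of_mem (fun j _ => not_le.2 (hne j))]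
        simp
  rw [card_roots_eq] at this
  refine le_trans (le_of_eq ?_) this
  rw [← smul_eq_mul, ← Finset.card_univ, ← Finset.sum_const]
  exact Finset.sum_congr rfl fun j _ => (h.counts_eq ha hb i j).1

lemma card_mul_no_le (h : OrthSys v g e) {a : Polynomial R} (ha : a.map (algebraMap R L) ≠ 0)
    {b : L} (hb : b ≠ 0) (i : ι) :
    Fintype.card ι * no v (a.map (algebraMap R L)) (g i) b ≤
      no v (e.map (algebraMap R L)) (g i) b * (a.map (algebraMap R L)).natDegree := by
  classical
  have : Nontrivial R := (algebraMap R L).domain_nontrivial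
  have := sum_countP_le (fun (η : L) (j : ι) => v (η - g j) < v b)
    (a.map (algebraMap R L)).roots (no v (e.map (algebraMap R L)) (g i) b) fun η => by
      by_cases hne : ∃ j, v (η - g j) < v b
      · obtain ⟨j, hj⟩ := hne
        have he : e.map (algebraMap R L) ≠ 0 := (h.monic.map _).ne_zero
        rw [(h.counts_eq he hb i j).2, h.no_e]
        refine Finset.card_le_card fun k hk => ?_
        simp only [Finset.mem_filter, Finset.mem_univ, true_and] at hk ⊢
        have := v.map_sub_lt hj hk
        simpa using this
      · push Not at hne
        rw [Finset.filter_false_of_mem (fun j _ => not_lt.2 (hne j))]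
        simp
  rw [card_roots_eq] at this
  refine le_trans (le_of_eq ?_) this
  rw [← smul_eq_mul, ← Finset.card_univ, ← Finset.sum_const]
  exact Finset.sum_congr rfl fun j _ => (h.counts_eq ha hb i j).2

lemma nc_e_eq (h : OrthSys v g e) {b : L} (hb : b ≠ 0) (i j : ι) :
    nc v (e.map (algebraMap R L)) (g i) b = nc v (e.map (algebraMap R L)) (g j) b := by
  have : Nontrivial R := (algebraMap R L).domain_nontrivial
  exact (h.counts_eq (h.monic.map _).ne_zero hb i j).1

lemma nc_e_dvd (h : OrthSys v g e) {r : L} (hr : r ≠ 0) (i : ι) (s : Finset ι)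
    (hs : ∀ j ∈ s, ∀ k, v (g k - g j) ≤ v r → k ∈ s) :
    nc v (e.map (algebraMap R L)) (g i) r ∣ s.card := by
  classical
  refine dvd_card_of_classes (fun j k => v (g k - g j) ≤ v r) ⟨fun j => by simp, fun {j k} hjk => ?_,
    fun {j k l} h1 h2 => ?_⟩ (fun j => ?_) s hs
  · rwa [Valuation.map_sub_swap]
  · have := v.map_add_le h1 h2
    simpa using this
  · rw [h.nc_e_eq hr i j, h.nc_e]

/-- The reduction of `e` at a radius larger than `r` is a power. -/
lemma exists_red_e_eq_pow (h : OrthSys v g e) {r b : L} (hr : r ≠ 0) (hb : b ≠ 0)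
    (hrb : v r < v b) (i : ι) :
    ∃ φ : Polynomial (Res v), φ.Monic ∧
      red v (e.map (algebraMap R L)) (g i) b = φ ^ nc v (e.map (algebraMap R L)) (g i) r := by
  classical
  have hb' : 0 < v b := zero_lt_iff.2 ((v.ne_zero_iff).2 hb)
  set s := (shiftRoots (e.map (algebraMap R L)) (g i) b).filter fun η => v η ≤ 1 with hs
  obtain ⟨t, ht⟩ := exists_nsmul_of_dvd_count (s := s.map (rs v))
    (d := nc v (e.map (algebraMap R L)) (g i) r) (by
      intro a
      by_cases ha : a ∈ s.map (rs v)
      · obtain ⟨x, hx, rfl⟩ := Multiset.mem_map.1 ha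
        rw [hs, Multiset.mem_filter] at hx
        obtain ⟨hx1, hx2⟩ := hx
        rw [shiftRoots, h.roots_e, Multiset.map_map] at hx1
        obtain ⟨j, -, hj⟩ := Multiset.mem_map.1 hx1
        rw [hs, ← redp_roots, count_roots, redp_rootMultiplicity _ hx2, shiftRoots,
          Multiset.countP_map, h.roots_e, Multiset.filter_map, Multiset.card_map]
        have := h.nc_e_dvd hr i (Finset.univ.filter fun k => v (g k - g j) < v b) (by
          intro k hk l hl
          simp only [Finset.mem_filter, Finset.mem_univ, true_and] at hk ⊢
          have := v.map_add_lt (hl.trans_lt hrb) hk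
          simpa using this)
        convert this using 1
        rw [Finset.card_def, Finset.filter_val]
        congr 1
        refine Multiset.filter_congr fun k _ => ?_
        rw [← hj]
        simp only [Function.comp]
        rw [← sub_div, map_div₀, div_lt_one₀ hb']
        simp
      · rw [Multiset.count_eq_zero_of_notMem ha]
        exact dvd_zero _)
  refine ⟨(t.map fun a => X - C a).prod, monic_multiset_prod_of_monic _ _ fun _ _ =>
    monic_X_sub_C _, ?_⟩
  rw [← Multiset.prod_nsmul, ← Multiset.map_nsmul, ← ht, Multiset.map_map]
  rfl

end OrthSys

variable {L Γ R ι : Type*} [Field L] [LinearOrderedCommGroupWithZero Γ] {v : Valuation L Γ}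
  [CommRing R] [Algebra R L] [Fintype ι] {g : ι → L} {e : Polynomial R}

lemma natDegree_pow_sub_ge {κ : Type*} [Field κ] {φ ψ : Polynomial κ} (hφ : φ.Monic)
    (hψ : ψ.Monic) {d : ℕ} (hd : (d : κ) ≠ 0) (hdeg : φ.natDegree = ψ.natDegree)
    (hne : φ ≠ ψ) : (d - 1) * φ.natDegree ≤ (φ ^ d - ψ ^ d).natDegree := by
  obtain ⟨S, hS, -, hS2⟩ := geom_cofactor hφ hψ rfl hdeg.symm d
  have hSc : S.coeff ((d - 1) * φ.natDegree) ≠ 0 := by rwa [hS2]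
  have hS0 : S ≠ 0 := by rintro rfl; simp at hSc
  rw [hS, natDegree_mul (sub_ne_zero.2 hne) hS0]
  exact (le_natDegree_of_ne_zero hSc).trans (Nat.le_add_left _ _)

lemma res_natCast_ne_zero (hc : ∀ n : ℕ, n ≠ 0 → v (n : L) = 1) {n : ℕ} (hn : n ≠ 0) :
    (n : Res v) ≠ 0 := by
  have h : (n : Res v) = IsLocalRing.residue v.valuationSubring (n : v.valuationSubring) := by simp
  rw [h, Ne, IsLocalRing.residue_eq_zero_iff, Valuation.mem_maximalIdeal_iff]
  simp [hc n hn]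

namespace OrthSys

variable [IsAlgClosed L]

lemma counts_of_good (h : OrthSys v g e) {i : ι} {r b : L} (hr : r ≠ 0) (hb : b ≠ 0)
    (hrb : v r ≤ v b) {d M : ℕ} (hd : d = nc v (e.map (algebraMap R L)) (g i) r)
    (hM : M * d = Fintype.card ι)
    {ψ : Polynomial R} (hψ : ψ.Monic)
    (hlt : (e - ψ ^ d).degree < ((M * d - M : ℕ) : WithBot ℕ))
    (good : v (Lam v (ψ.map (algebraMap R L)) (g i) b) ^ d =
      v (Lam v (e.map (algebraMap R L)) (g i) b)) :
    d * nc v (ψ.map (algebraMap R L)) (g i) b = nc v (e.map (algebraMap R L)) (g i) b ∧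
    (v r < v b →
      d * no v (ψ.map (algebraMap R L)) (g i) b = no v (e.map (algebraMap R L)) (g i) b) := by
  classical
  have hnt : Nontrivial R := (algebraMap R L).domain_nontrivial
  set E := e.map (algebraMap R L) with hE
  set Ψ := ψ.map (algebraMap R L) with hΨ
  have hE0 : E ≠ 0 := (h.monic.map _).ne_zero
  have hΨ0 : Ψ ≠ 0 := (hψ.map _).ne_zero
  set D := nc v E (g i) b with hD
  have hd0 : 0 < d := by
    rw [hd, h.nc_e]
    exact Finset.card_pos.2 ⟨i, by simp⟩
  have hm0 : 0 < Fintype.card ι := Fintype.card_pos_iff.2 ⟨i⟩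
  have hM0 : 0 < M := Nat.pos_of_mul_pos_right (hM ▸ hm0)
  have hdD : d ≤ D := by
    rw [hd, hD, h.nc_e, h.nc_e]
    refine Finset.card_le_card fun j hj => ?_
    simp only [Finset.mem_filter, Finset.mem_univ, true_and] at hj ⊢
    exact hj.trans hrb
  set lE := Lam v E (g i) b with hlE
  set lΨ := Lam v Ψ (g i) b with hlΨ
  have hlE0 : lE ≠ 0 := Lam_ne_zero hE0 hb _
  have hlΨ0 : lΨ ≠ 0 := Lam_ne_zero hΨ0 hb _
  set u := lΨ ^ d / lE with hu
  have hvu : v u = 1 := by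
    rw [hu, map_div₀, map_pow, good, div_self ((v.ne_zero_iff).2 hlE0)]
  -- the reduction of `e - ψ ^ d`
  set ρ := e - ψ ^ d with hρ
  have hρmap : ρ.map (algebraMap R L) = E - Ψ ^ d := by simp [hρ, hE, hΨ]
  set ρb := red v E (g i) b - C (rs v u) * red v Ψ (g i) b ^ d with hρb
  have hred : IsRed v (C lE⁻¹ * (ρ.map (algebraMap R L)).comp (C (g i) + C b * X)) ρb := by
    have h1 := isRed_red (v := v) hE0 hb (g i)
    have h2 := ((IsRed.const hvu.le).mul ((isRed_red (v := v) hΨ0 hb (g i)).pow d))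
    convert h1.sub h2 using 1
    rw [hρmap, sub_comp, pow_comp, mul_sub, mul_pow, ← mul_assoc (C u), ← C_pow, ← C_mul]
    congr 3
    rw [hu, hlΨ, inv_pow, div_mul_eq_mul_div, mul_inv_cancel₀ (pow_ne_zero _ hlΨ0), one_div]
  have hdegρ : ρb ≠ 0 → d * ρb.natDegree < (d - 1) * D := by
    intro hne
    have hρ0 : ρ.map (algebraMap R L) ≠ 0 := by
      intro h0
      rw [h0, zero_comp, mul_zero] at hred
      obtain ⟨G, hG1, hG2⟩ := hred
      rw [Polynomial.map_eq_zero_iff (FaithfulSMul.algebraMap_injective _ _)] at hG1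
      rw [hG1, Polynomial.map_zero] at hG2
      exact hne hG2.symm
    have h1 : ρb.natDegree = nc v (ρ.map (algebraMap R L)) (g i) b := by
      rw [← red_natDegree _ hb]
      exact natDegree_eq_of_support (support_eq hlE0 (Lam_ne_zero hρ0 hb (g i)) hne
        (red_monic _ _ _).ne_zero hred (isRed_red hρ0 hb (g i)) fun _ => rfl).1
    have h2 := h.card_mul_nc_le hρ0 hb i
    rw [← h1, ← hE, ← hD] at h2
    have h3 : (ρ.map (algebraMap R L)).natDegree < M * d - M := by
      refine natDegree_map_le.trans_lt ?_
      have : ρ ≠ 0 := by rintro h0; rw [h0] at hρ0; simp at hρ0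
      rwa [← natDegree_lt_iff_degree_lt this] at hlt
    have h4 : M * (d * ρb.natDegree) < M * ((d - 1) * D) := by
      calc M * (d * ρb.natDegree) = Fintype.card ι * ρb.natDegree := by rw [← hM]; ring
        _ ≤ D * (ρ.map (algebraMap R L)).natDegree := h2
        _ < D * (M * d - M) := (Nat.mul_lt_mul_left (hd0.trans_le hdD)).2 h3
        _ = M * ((d - 1) * D) := by
          rw [Nat.sub_mul, one_mul, Nat.mul_sub, Nat.mul_sub]
          congr 1 <;> ring
    exact Nat.lt_of_mul_lt_mul_left h4
  have hdegρ' : ρb.degree < (D : WithBot ℕ) := by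
    by_cases h0 : ρb = 0
    · rw [h0, degree_zero]; exact WithBot.bot_lt_coe _
    · rw [← natDegree_lt_iff_degree_lt h0]
      have h1 := hdegρ h0
      have h2 : (d - 1) * D ≤ d * D := Nat.mul_le_mul_right _ (Nat.sub_le _ _)
      exact Nat.lt_of_mul_lt_mul_left (h1.trans_le h2)
  have hEdeg : (red v E (g i) b).degree = (D : WithBot ℕ) := by
    rw [degree_eq_natDegree (red_monic _ _ _).ne_zero, red_natDegree _ hb]
  have hEq : C (rs v u) * red v Ψ (g i) b ^ d = red v E (g i) b - ρb := by rw [hρb]; ring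
  have hu0 : rs v u ≠ 0 := by rw [Ne, rs_eq_zero_iff hvu.le, hvu]; exact lt_irrefl _
  have hmonΨ : (red v Ψ (g i) b ^ d).Monic := (red_monic _ _ _).pow _
  have hlc : rs v u = 1 := by
    have h1 : (red v E (g i) b - ρb).Monic := (red_monic _ _ _).sub_of_left (by rwa [hEdeg])
    rw [← hEq, Monic, leadingCoeff_mul, hmonΨ.leadingCoeff, leadingCoeff_C, mul_one] at h1
    exact h1
  rw [hlc, C_1, one_mul] at hEq
  have hcount : d * nc v Ψ (g i) b = D := by
    have h1 : (red v Ψ (g i) b ^ d).natDegree = D := by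
      rw [hEq]
      refine natDegree_eq_of_degree_eq_some ?_
      rw [degree_sub_eq_left_of_degree_lt (by rwa [hEdeg]), hEdeg]
    rwa [natDegree_pow, red_natDegree _ hb] at h1
  refine ⟨hcount, fun hrb' => ?_⟩
  obtain ⟨φ, hφ, hφE⟩ := h.exists_red_e_eq_pow hr hb hrb' i
  rw [← hE, ← hd] at hφE
  have hφdeg : φ.natDegree = (red v Ψ (g i) b).natDegree := by
    have h1 : d * φ.natDegree = D := by
      rw [← natDegree_pow, ← hφE, red_natDegree _ hb]
    rw [red_natDegree _ hb]
    exact Nat.eq_of_mul_eq_mul_left hd0 (h1.trans hcount.symm)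
  have hφψ : φ = red v Ψ (g i) b := by
    by_contra hne
    have h1 := natDegree_pow_sub_ge hφ (red_monic _ _ _)
      (res_natCast_ne_zero h.char hd0.ne') hφdeg hne
    have h2 : φ ^ d - red v Ψ (g i) b ^ d = ρb := by rw [hEq, hφE]; ring
    rw [h2] at h1
    have h3 : ρb ≠ 0 := by
      rw [← h2]
      intro h0
      have := sub_eq_zero.1 h0
      obtain ⟨S, hS, -, hS2⟩ := geom_cofactor hφ (red_monic Ψ (g i) b) rfl hφdeg.symm d
      rw [h0] at hS
      rcases mul_eq_zero.1 hS.symm with h4 | h4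
      · exact hne (sub_eq_zero.1 h4)
      · rw [h4, coeff_zero] at hS2
        exact res_natCast_ne_zero h.char hd0.ne' hS2.symm
    have h4 := hdegρ h3
    have h5 : d * φ.natDegree = D := by rw [hφdeg, red_natDegree _ hb, hcount]
    rw [← h5] at h4
    have h6 : d * ((d - 1) * φ.natDegree) ≤ d * ρb.natDegree := Nat.mul_le_mul_left _ h1
    have h7 : d * ((d - 1) * φ.natDegree) = (d - 1) * (d * φ.natDegree) := by ring
    omega
  rw [← red_natTrailingDegree _ hb, ← red_natTrailingDegree _ hb, hφE, hφψ]
  rw [← rootMultiplicity_eq_natTrailingDegree', ← rootMultiplicity_eq_natTrailingDegree',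
    ← count_roots, ← count_roots, roots_pow, Multiset.count_nsmul]

end OrthSys

variable {L Γ R ι : Type*} [Field L] [LinearOrderedCommGroupWithZero Γ] {v : Valuation L Γ}
  [CommRing R] [Algebra R L] [Fintype ι] {g : ι → L} {e : Polynomial R}

open Classical in
lemma prod_max_transfer {s : Multiset L} {γ b b' : L} (hbb : v b ≤ v b')
    (hs : ∀ η ∈ s, v (η - γ) ≤ v b ∨ v b' ≤ v (η - γ)) :
    (s.map fun η => max (v b) (v (η - γ))).prod *
        v b' ^ s.countP (fun η => v (η - γ) < v b') =
      (s.map fun η => max (v b') (v (η - γ))).prod *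
        v b ^ s.countP (fun η => v (η - γ) < v b') := by
  induction s using Multiset.induction_on with
  | empty => simp
  | cons a s ih =>
    have ih := ih fun η hη => hs η (Multiset.mem_cons_of_mem hη)
    simp only [Multiset.map_cons, Multiset.prod_cons, Multiset.countP_cons]
    by_cases hlt : v (a - γ) < v b'
    · have hle : v (a - γ) ≤ v b := (hs a (Multiset.mem_cons_self _ _)).resolve_right
        (not_le.2 hlt)
      rw [max_eq_left hle, max_eq_left hlt.le, if_pos hlt, pow_succ, pow_succ]
      calc _ = v b * v b' * ((s.map fun η => max (v b) (v (η - γ))).prod *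
            v b' ^ s.countP (fun η => v (η - γ) < v b')) := by ac_rfl
        _ = _ := by rw [ih]; ac_rfl
    · have hle := not_lt.1 hlt
      rw [max_eq_right (hbb.trans hle), max_eq_right hle, if_neg hlt, add_zero, mul_assoc, ih,
        mul_assoc]

namespace OrthSys

variable [IsAlgClosed L]

lemma good_of_approx (h : OrthSys v g e) {i : ι} {r : L} (hr : r ≠ 0)
    {d M : ℕ} (hd : d = nc v (e.map (algebraMap R L)) (g i) r)
    (hM : M * d = Fintype.card ι)
    {ψ : Polynomial R} (hψ : ψ.Monic) (hψM : ψ.natDegree = M)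
    (hlt : (e - ψ ^ d).degree < ((M * d - M : ℕ) : WithBot ℕ)) :
    ∀ (n : ℕ) (b : L), b ≠ 0 → v r ≤ v b →
      Multiset.card ((((e.map (algebraMap R L)).roots + (ψ.map (algebraMap R L)).roots).map
        fun η => v (η - g i)).filter fun x => v b < x) = n →
      v (Lam v (ψ.map (algebraMap R L)) (g i) b) ^ d =
        v (Lam v (e.map (algebraMap R L)) (g i) b) := by
  classical
  have hnt : Nontrivial R := (algebraMap R L).domain_nontrivial
  set E := e.map (algebraMap R L) with hE
  set Ψ := ψ.map (algebraMap R L) with hΨ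
  have hEm : E.Monic := h.monic.map _
  have hΨm : Ψ.Monic := hψ.map _
  have hEd : E.natDegree = M * d := by rw [hE, h.monic.natDegree_map, h.natDegree_e, hM]
  have hΨd : Ψ.natDegree = M := by rw [hΨ, hψ.natDegree_map, hψM]
  intro n
  induction n using Nat.strong_induction_on with
  | _ n ih =>
    intro b hb hrb hn
    set Δ := (E.roots + Ψ.roots).map fun η => v (η - g i) with hΔ
    rw [v_Lam _ hb, v_Lam _ hb, hEm.leadingCoeff, hΨm.leadingCoeff, map_one, one_mul, one_mul]
    rcases Nat.eq_zero_or_pos n with rfl | hpos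
    · have hall : ∀ η ∈ E.roots + Ψ.roots, v (η - g i) ≤ v b := by
        intro η hη
        by_contra hlt'
        rw [Multiset.card_eq_zero, Multiset.filter_eq_nil] at hn
        exact hn _ (Multiset.mem_map_of_mem _ hη) (not_le.1 hlt')
      have hprod : ∀ s : Multiset L, (∀ η ∈ s, v (η - g i) ≤ v b) →
          (s.map fun η => max (v b) (v (η - g i))).prod = v b ^ Multiset.card s := by
        intro s hs
        rw [Multiset.map_congr rfl (g := fun _ => v b) fun η hη => max_eq_left (hs η hη)]
        simp
      rw [hprod _ fun η hη => hall η (Multiset.mem_add.2 (Or.inl hη)),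
        hprod _ fun η hη => hall η (Multiset.mem_add.2 (Or.inr hη)), card_roots_eq, card_roots_eq,
        hEd, hΨd, pow_mul]
    · set T := (Δ.filter fun x => v b < x).toFinset with hT
      have hTne : T.Nonempty := by
        obtain ⟨x, hx⟩ := Multiset.card_pos_iff_exists_mem.1 (hn ▸ hpos)
        exact ⟨x, Multiset.mem_toFinset.2 hx⟩
      obtain ⟨x, hxT, hxmin⟩ := T.exists_min_image id hTne
      rw [hT, Multiset.mem_toFinset, Multiset.mem_filter, hΔ, Multiset.mem_map] at hxT
      obtain ⟨⟨η₀, hη₀, rfl⟩, hbx⟩ := hxT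
      set b' := η₀ - g i with hb'def
      have hgap : ∀ η ∈ E.roots + Ψ.roots, v (η - g i) ≤ v b ∨ v b' ≤ v (η - g i) := by
        intro η hη
        by_cases hle : v (η - g i) ≤ v b
        · exact Or.inl hle
        · right
          refine hxmin _ ?_
          rw [hT, Multiset.mem_toFinset, Multiset.mem_filter]
          exact ⟨Multiset.mem_map_of_mem _ hη, not_le.1 hle⟩
      have hb'0 : b' ≠ 0 := by
        intro h0
        rw [h0, map_zero] at hbx
        exact not_lt_zero hbx
      have hlt' : Multiset.card (Δ.filter fun x => v b' < x) < n := by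
        rw [← hn]
        refine Multiset.card_lt_card (lt_of_le_of_ne (Multiset.monotone_filter_right _
          fun x hx => hbx.trans hx) fun heq => ?_)
        have hmem : v b' ∈ Δ.filter fun x => v b < x :=
          Multiset.mem_filter.2 ⟨Multiset.mem_map_of_mem _ hη₀, hbx⟩
        rw [← heq] at hmem
        exact lt_irrefl _ (Multiset.mem_filter.1 hmem).2
      have good' := ih _ hlt' b' hb'0 (hrb.trans hbx.le) rfl
      have hno := (h.counts_of_good hr hb'0 (hrb.trans hbx.le) hd hM hψ hlt good').2
        (hrb.trans_lt hbx)
      rw [v_Lam _ hb'0, v_Lam _ hb'0, hEm.leadingCoeff, hΨm.leadingCoeff, map_one, one_mul,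
        one_mul] at good'
      have e1 := prod_max_transfer (v := v) (s := E.roots) (γ := g i) hbx.le
        fun η hη => hgap η (Multiset.mem_add.2 (Or.inl hη))
      have e2 := prod_max_transfer (v := v) (s := Ψ.roots) (γ := g i) hbx.le
        fun η hη => hgap η (Multiset.mem_add.2 (Or.inr hη))
      change _ * v b' ^ no v E (g i) b' = _ * v b ^ no v E (g i) b' at e1
      change _ * v b' ^ no v Ψ (g i) b' = _ * v b ^ no v Ψ (g i) b' at e2
      refine mul_right_cancel₀ (pow_ne_zero (no v E (g i) b') ((v.ne_zero_iff).2 hb'0)) ?_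
      rw [e1, ← good', ← hno, mul_comm d, pow_mul, pow_mul, ← mul_pow, ← mul_pow, e2]

/-- An approximate root has exactly one root in the closed ball it belongs to. -/
lemma nc_approx (h : OrthSys v g e) {i : ι} {r : L} (hr : r ≠ 0)
    {d M : ℕ} (hd : d = nc v (e.map (algebraMap R L)) (g i) r)
    (hM : M * d = Fintype.card ι)
    {ψ : Polynomial R} (hψ : ψ.Monic) (hψM : ψ.natDegree = M)
    (hlt : (e - ψ ^ d).degree < ((M * d - M : ℕ) : WithBot ℕ)) :
    nc v (ψ.map (algebraMap R L)) (g i) r = 1 := by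
  have h1 := (h.counts_of_good hr hr le_rfl hd hM hψ hlt
    (h.good_of_approx hr hd hM hψ hψM hlt _ r hr le_rfl rfl)).1
  rw [← hd] at h1
  have hd0 : 0 < d := by
    classical
    rw [hd, h.nc_e]
    exact Finset.card_pos.2 ⟨i, by simp⟩
  exact Nat.eq_of_mul_eq_mul_left hd0 (h1.trans (mul_one d).symm)

end OrthSys

variable {L Γ R ι : Type*} [Field L] [LinearOrderedCommGroupWithZero Γ] {v : Valuation L Γ}
  [CommRing R] [Algebra R L] [Fintype ι] {g : ι → L} {e : Polynomial R}

lemma sum_range_mul_eq {M : Type*} [AddCommMonoid M] (f : ℕ → M) (m q : ℕ) :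
    ∑ k ∈ Finset.range (m * q), f k =
      ∑ l ∈ Finset.range q, ∑ k ∈ Finset.range m, f (m * l + k) := by
  induction q with
  | zero => simp
  | succ q ih => rw [mul_add, mul_one, Finset.sum_range_add, ih, Finset.sum_range_succ]

/-- `P 0, …, P (M - 1)` is a monic basis with respect to which the valuation at `γ` is
computed as a maximum. -/
def Orth (v : Valuation L Γ) (γ : L) (P : ℕ → Polynomial R) (M : ℕ) : Prop :=
  (∀ k < M, (P k).Monic ∧ (P k).natDegree = k) ∧
    ∀ (c : ℕ → R), ∀ k < M, v (aeval γ (C (c k) * P k)) ≤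
      v (aeval γ (∑ k ∈ Finset.range M, C (c k) * P k))

lemma IsRed.zero : IsRed v 0 0 := ⟨0, by simp, by simp⟩

lemma IsRed.add {F G : Polynomial L} {f g : Polynomial (Res v)} (hF : IsRed v F f)
    (hG : IsRed v G g) : IsRed v (F + G) (f + g) := by
  obtain ⟨a, rfl, rfl⟩ := hF
  obtain ⟨b, rfl, rfl⟩ := hG
  exact ⟨a + b, by simp, by simp⟩

lemma IsRed.sum {α : Type*} {s : Finset α} {F : α → Polynomial L}
    {f : α → Polynomial (Res v)} (h : ∀ i ∈ s, IsRed v (F i) (f i)) :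
    IsRed v (∑ i ∈ s, F i) (∑ i ∈ s, f i) := by
  classical
  induction s using Finset.induction_on with
  | empty => simpa using IsRed.zero
  | insert a s ha ih =>
    rw [Finset.sum_insert ha, Finset.sum_insert ha]
    exact (h a (Finset.mem_insert_self _ _)).add
      (ih fun i hi => h i (Finset.mem_insert_of_mem hi))

/-- Orthogonality of the powers of a polynomial with a single root in a ball, with coefficients
without roots in it. -/
lemma orth_pow [IsAlgClosed L] {γ b : L} (hb : b ≠ 0) {Ψ : Polynomial L} (hΨ : nc v Ψ γ b = 1)
    {A : ℕ → Polynomial L} {q : ℕ} (hA : ∀ l < q, A l ≠ 0 → nc v (A l) γ b = 0)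
    (hno : ∑ l ∈ Finset.range q, A l * Ψ ^ l ≠ 0 →
      no v (∑ l ∈ Finset.range q, A l * Ψ ^ l) γ b = 0) {l : ℕ} (hl : l < q) :
    v ((A l * Ψ ^ l).eval γ) ≤ v ((∑ l ∈ Finset.range q, A l * Ψ ^ l).eval γ) := by
  classical
  have hΨ0 : Ψ ≠ 0 := by rintro rfl; simp [nc] at hΨ
  set S := ∑ l ∈ Finset.range q, A l * Ψ ^ l with hS
  by_cases hAl : A l = 0
  · simp [hAl]
  set lm : ℕ → L := fun l => Lam v (A l) γ b * Lam v Ψ γ b ^ l with hlm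
  set T := (Finset.range q).filter fun l => A l ≠ 0 with hT
  have hlT : l ∈ T := by simp [hT, hl, hAl]
  obtain ⟨p, hpT, hpmax⟩ := T.exists_max_image (fun l => v (lm l)) ⟨l, hlT⟩
  simp only [hT, Finset.mem_filter, Finset.mem_range] at hpT
  have hlm0 : ∀ l, A l ≠ 0 → lm l ≠ 0 := fun l h =>
    mul_ne_zero (Lam_ne_zero h hb _) (pow_ne_zero _ (Lam_ne_zero hΨ0 hb _))
  have hμ0 := hlm0 p hpT.2
  have hμv : 0 < v (lm p) := zero_lt_iff.2 ((v.ne_zero_iff).2 hμ0)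
  set cf : ℕ → Res v := fun l => if A l = 0 then 0 else rs v (lm l / lm p) with hcf
  have hred : IsRed v (C (lm p)⁻¹ * S.comp (C γ + C b * X))
      (∑ l ∈ Finset.range q, C (cf l) * red v Ψ γ b ^ l) := by
    rw [hS, sum_comp, Finset.mul_sum]
    refine IsRed.sum fun l hl => ?_
    by_cases hAl : A l = 0
    · simpa [hAl, hcf] using IsRed.zero
    · have hle : v (lm l / lm p) ≤ 1 := by
        rw [map_div₀, div_le_one₀ hμv]
        exact hpmax l (by simp [hT, Finset.mem_range.1 hl, hAl])
      have h1 := ((IsRed.const hle).mul (isRed_red (v := v) hAl hb γ)).mul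
        ((isRed_red (v := v) hΨ0 hb γ).pow l)
      have h2 : red v (A l) γ b = 1 := by
        refine eq_one_of_monic_natDegree_zero (red_monic _ _ _) ?_
        rw [red_natDegree _ hb, hA l (Finset.mem_range.1 hl) hAl]
      rw [h2, mul_one] at h1
      simp only [hcf, hAl, if_false]
      convert h1 using 1
      rw [mul_comp, pow_comp, mul_pow, ← C_pow, ← mul_assoc (C (lm l / lm p)), ← C_mul]
      have h3 : lm l / lm p * (Lam v (A l) γ b)⁻¹ * (Lam v Ψ γ b)⁻¹ ^ l = (lm p)⁻¹ := by
        have := Lam_ne_zero (v := v) hAl hb γ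
        have := Lam_ne_zero (v := v) hΨ0 hb γ
        simp only [hlm, inv_pow]
        field_simp
      rw [mul_mul_mul_comm, ← C_mul, h3]
  have hne : (∑ l ∈ Finset.range q, C (cf l) * red v Ψ γ b ^ l) ≠ 0 := by
    have h1 : (∑ l ∈ Finset.range q, C (cf l) * red v Ψ γ b ^ l) =
        (∑ l ∈ Finset.range q, C (cf l) * X ^ l).comp (red v Ψ γ b) := by
      simp [sum_comp]
    rw [h1, Ne, comp_eq_zero_iff, not_or]
    constructor
    · intro h2
      have h3 := congrArg (fun f => coeff f p) h2
      simp only [finsetSum_coeff, coeff_C_mul, coeff_X_pow, coeff_zero, mul_ite, mul_one,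
        mul_zero, Finset.sum_ite_eq, Finset.mem_range, hpT.1, if_true] at h3
      simp only [hcf, hpT.2, if_false, div_self hμ0] at h3
      rw [rs_eq_zero_iff (by simp)] at h3
      simp at h3
    · rintro ⟨-, h2⟩
      have h3 := congrArg natDegree h2
      rw [red_natDegree _ hb, hΨ, natDegree_C] at h3
      exact one_ne_zero h3
  have hS0 : S ≠ 0 := by
    intro h0
    rw [h0, zero_comp, mul_zero] at hred
    obtain ⟨G, hG1, hG2⟩ := hred
    rw [Polynomial.map_eq_zero_iff (FaithfulSMul.algebraMap_injective _ _)] at hG1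
    rw [hG1, Polynomial.map_zero] at hG2
    exact hne hG2.symm
  have hv := (support_eq hμ0 (Lam_ne_zero hS0 hb γ) hne (red_monic _ _ _).ne_zero hred
    (isRed_red hS0 hb γ) fun _ => rfl).2
  rw [v_eval_of_no S hb (hno hS0), ← hv]
  refine le_trans ?_ (hpmax l hlT)
  rw [eval_mul, eval_pow, map_mul, map_pow, map_mul, map_pow]
  exact mul_le_mul' (v_eval_le _ hb _) (pow_le_pow_left' (v_eval_le _ hb _) _)

namespace OrthSys

variable [IsAlgClosed L]

open Classical in
lemma ball_dvd (h : OrthSys v g e) (r : L) (i : ι) (s : Finset ι)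
    (hs : ∀ j ∈ s, ∀ k, v (g k - g j) ≤ v r → k ∈ s) :
    (Finset.univ.filter fun j => v (g j - g i) ≤ v r).card ∣ s.card := by
  by_cases hr : r = 0
  · have : (Finset.univ.filter fun j => v (g j - g i) ≤ v r) = {i} := by
      ext j
      simp only [hr, map_zero, Finset.mem_filter, Finset.mem_univ, true_and, le_zero_iff,
        Valuation.zero_iff, sub_eq_zero, Finset.mem_singleton]
      exact h.inj.eq_iff
    rw [this, Finset.card_singleton]
    exact one_dvd _
  · rw [← h.nc_e]
    exact h.nc_e_dvd hr i s hs

open Classical in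
lemma exists_orth_aux [Algebra ℚ R] (h : OrthSys v g e) (i : ι) :
    ∀ (n : ℕ) (r : L), (Finset.univ.filter fun j => v r < v (g j - g i)).card = n →
      ∀ M, M * (Finset.univ.filter fun j => v (g j - g i) ≤ v r).card = Fintype.card ι →
        ∃ P : ℕ → Polynomial R, Orth v (g i) P M := by
  have hnt : Nontrivial R := (algebraMap R L).domain_nontrivial
  have hm0 : 0 < Fintype.card ι := Fintype.card_pos_iff.2 ⟨i⟩
  intro n
  induction n using Nat.strong_induction_on with
  | _ n ih =>
    intro r hn M hM
    set N := (Finset.univ.filter fun j => v (g j - g i) ≤ v r).card with hN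
    have hN0 : 0 < N := Finset.card_pos.2 ⟨i, by simp⟩
    rcases Nat.eq_zero_or_pos n with rfl | hpos
    · have hNm : N = Fintype.card ι := by
        rw [hN, ← Finset.card_univ]
        congr 1
        rw [Finset.card_eq_zero, Finset.filter_eq_empty_iff] at hn
        exact Finset.filter_true_of_mem fun j hj => not_lt.1 (hn hj)
      have hM1 : M = 1 := by
        rw [hNm] at hM
        exact Nat.eq_of_mul_eq_mul_right hm0 (by rw [hM, one_mul])
      subst hM1
      refine ⟨fun _ => 1, fun k hk => ?_, fun c k hk => ?_⟩
      · obtain rfl : k = 0 := by omega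
        simp
      · obtain rfl : k = 0 := by omega
        simp
    · obtain ⟨j, hj, hjmin⟩ := (Finset.univ.filter fun j => v r < v (g j - g i)).exists_min_image
        (fun j => v (g j - g i)) (Finset.card_pos.1 (hn ▸ hpos))
      simp only [Finset.mem_filter, Finset.mem_univ, true_and] at hj hjmin
      set b := g j - g i with hb
      have hb0 : b ≠ 0 := by
        intro h0
        rw [h0, map_zero] at hj
        exact not_lt_zero hj
      set d := nc v (e.map (algebraMap R L)) (g i) b with hd
      have hdcard : d = (Finset.univ.filter fun j => v (g j - g i) ≤ v b).card := h.nc_e i b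
      have hd0 : 0 < d := by
        rw [hdcard]
        exact Finset.card_pos.2 ⟨i, by simp⟩
      obtain ⟨Mc, hMc⟩ : d ∣ Fintype.card ι := by
        have := h.nc_e_dvd hb0 i Finset.univ (fun _ _ k _ => Finset.mem_univ k)
        rwa [Finset.card_univ] at this
      rw [mul_comm] at hMc
      have hlt : (Finset.univ.filter fun j => v b < v (g j - g i)).card < n := by
        rw [← hn]
        refine Finset.card_lt_card (Finset.ssubset_iff_subset_ne.2 ⟨fun k hk => ?_, fun heq => ?_⟩)
        · simp only [Finset.mem_filter, Finset.mem_univ, true_and] at hk ⊢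
          exact hj.trans hk
        · have : j ∈ (Finset.univ.filter fun j => v r < v (g j - g i)) := by simpa using hj
          rw [← heq] at this
          simp [hb] at this
      obtain ⟨P, hP1, hP2⟩ := ih _ hlt b rfl Mc (by rw [← hdcard, hMc])
      have hMc0 : 0 < Mc := by
        rcases Nat.eq_zero_or_pos Mc with h0 | h0
        · rw [h0, zero_mul] at hMc; omega
        · exact h0
      obtain ⟨q, hq⟩ : N ∣ d := by
        rw [hdcard]
        refine h.ball_dvd r i _ fun k hk l hl => ?_
        simp only [Finset.mem_filter, Finset.mem_univ, true_and] at hk ⊢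
        have := v.map_add_le (hl.trans hj.le) hk
        simpa using this
      have hMq : M = Mc * q := by
        refine Nat.eq_of_mul_eq_mul_right hN0 ?_
        rw [hM, hMc, hq]; ring
      have hnoe : no v (e.map (algebraMap R L)) (g i) b = N := by
        rw [h.no_e, hN]
        congr 1
        ext k
        simp only [Finset.mem_filter, Finset.mem_univ, true_and]
        constructor
        · intro hk
          by_contra hk'
          exact absurd (hjmin k (not_le.1 hk')) (not_le.2 hk)
        · intro hk
          exact hk.trans_lt hj
      obtain ⟨ψ, hψ, hψM, hψlt⟩ := exists_approx_root h.monic hd0.ne'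
        (by rw [h.natDegree_e, hMc])
      have hnc := h.nc_approx hb0 hd hMc.symm hψ hψM hψlt
      refine ⟨fun k => P (k % Mc) * ψ ^ (k / Mc), fun k hk => ?_, fun c k hk => ?_⟩
      · have hkM := Nat.mod_lt k hMc0
        have hmon := (hP1 _ hkM).1.mul (hψ.pow (k / Mc))
        refine ⟨hmon, ?_⟩
        rw [(hP1 _ hkM).1.natDegree_mul (hψ.pow _), (hP1 _ hkM).2, hψ.natDegree_pow, hψM,
          mul_comm]
        exact Nat.mod_add_div k Mc
      · set a : ℕ → Polynomial R := fun l => ∑ k ∈ Finset.range Mc, C (c (Mc * l + k)) * P k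
          with ha
        have hsum : ∑ k ∈ Finset.range M, C (c k) * (P (k % Mc) * ψ ^ (k / Mc)) =
            ∑ l ∈ Finset.range q, a l * ψ ^ l := by
          rw [hMq, sum_range_mul_eq]
          refine Finset.sum_congr rfl fun l _ => ?_
          rw [ha, Finset.sum_mul]
          refine Finset.sum_congr rfl fun k hk => ?_
          have hk' := Finset.mem_range.1 hk
          rw [Nat.mul_add_mod, Nat.mod_eq_of_lt hk', Nat.mul_add_div hMc0,
            Nat.div_eq_of_lt hk', add_zero, mul_assoc]
        have hadeg : ∀ l, (a l).natDegree ≤ Mc - 1 := fun l => by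
          refine natDegree_sum_le_of_forall_le _ _ fun k hk => ?_
          have hk' := Finset.mem_range.1 hk
          refine (natDegree_C_mul_le _ _).trans ?_
          rw [(hP1 k hk').2]
          omega
        have hmapsum : (∑ l ∈ Finset.range q, a l * ψ ^ l).map (algebraMap R L) =
            ∑ l ∈ Finset.range q, (a l).map (algebraMap R L) * ψ.map (algebraMap R L) ^ l := by
          simp [Polynomial.map_sum]
        have key := orth_pow (v := v) (γ := g i) hb0 hnc
          (A := fun l => (a l).map (algebraMap R L)) (q := q) (fun l _ hl0 => by
            have h1 := h.card_mul_nc_le hl0 hb0 i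
            rw [← hd] at h1
            by_contra h2
            have h3 : Fintype.card ι * 1 ≤ _ := (Nat.mul_le_mul_left _ (Nat.pos_of_ne_zero h2)).trans h1
            have h4 : ((a l).map (algebraMap R L)).natDegree < Mc := by
              have := natDegree_map_le (f := algebraMap R L) (p := a l)
              have := hadeg l
              omega
            have h5 := (Nat.mul_lt_mul_left hd0).2 h4
            rw [mul_comm d Mc, ← hMc] at h5
            omega) (fun h0 => by
            rw [← hmapsum] at h0 ⊢
            have h1 := h.card_mul_no_le h0 hb0 i
            rw [hnoe] at h1
            by_contra h2
            have h3 : Fintype.card ι * 1 ≤ _ := (Nat.mul_le_mul_left _ (Nat.pos_of_ne_zero h2)).trans h1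
            have h4 : ((∑ l ∈ Finset.range q, a l * ψ ^ l).map (algebraMap R L)).natDegree < M := by
              refine natDegree_map_le.trans_lt ?_
              rw [← hsum]
              refine (natDegree_sum_le_of_forall_le (n := M - 1) _ _ fun k hk => ?_).trans_lt ?_
              · have hk' := Finset.mem_range.1 hk
                refine (natDegree_C_mul_le _ _).trans ?_
                have hkM := Nat.mod_lt k hMc0
                rw [(hP1 _ hkM).1.natDegree_mul (hψ.pow _), (hP1 _ hkM).2, hψ.natDegree_pow, hψM,
                  mul_comm, Nat.mod_add_div k Mc]
                omega
              · omega
            have h5 := (Nat.mul_lt_mul_left hN0).2 h4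
            rw [mul_comm N M, hM] at h5
            omega) (l := k / Mc) (Nat.div_lt_of_lt_mul (hMq ▸ hk))
        have horth := hP2 (fun k' => c (Mc * (k / Mc) + k')) (k % Mc) (Nat.mod_lt k hMc0)
        rw [Nat.div_add_mod] at horth
        rw [hsum, ← eval_map_algebraMap (∑ l ∈ Finset.range q, a l * ψ ^ l), hmapsum]
        refine le_trans ?_ key
        rw [eval_mul, eval_pow, eval_map_algebraMap, eval_map_algebraMap, ← mul_assoc,
          map_mul (aeval (g i)) (C (c k) * P (k % Mc)), v.map_mul, v.map_mul, map_pow]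
        exact mul_le_mul' horth le_rfl

/-- An orthogonal monic basis for the polynomials of degree less than that of `e`. -/
theorem exists_orth [Algebra ℚ R] (h : OrthSys v g e) (i : ι) :
    ∃ P : ℕ → Polynomial R, Orth v (g i) P (Fintype.card ι) := by
  classical
  refine h.exists_orth_aux i _ 0 rfl _ ?_
  have : (Finset.univ.filter fun j => v (g j - g i) ≤ v (0 : L)) = {i} := by
    ext j
    simp only [map_zero, Finset.mem_filter, Finset.mem_univ, true_and, le_zero_iff,
      Valuation.zero_iff, sub_eq_zero, Finset.mem_singleton]
    exact h.inj.eq_iff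
  rw [this, Finset.card_singleton, mul_one]

end OrthSys

section Values

variable {O K L Γ : Type*} [CommRing O] [IsDomain O] [IsDiscreteValuationRing O] [Field K]
  [Algebra O K] [IsFractionRing O K] [Field L] [Algebra K L] [Algebra O L] [IsScalarTower O K L]
  [LinearOrderedCommGroupWithZero Γ] {v : Valuation L Γ}

/-- `v` is nonnegative on `O`, and `T` is large, but infinitely smaller than the inverses of the
nonunits of `O`. -/
structure Big (O : Type*) [CommRing O] [IsLocalRing O] [Algebra O L] (v : Valuation L Γ) (T : L) :
    Prop where
  le_one : ∀ c : O, v (algebraMap O L c) ≤ 1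
  one_lt : 1 < v T
  lt_one : ∀ c ∈ IsLocalRing.maximalIdeal O, ∀ N : ℕ, v (algebraMap O L c) * v T ^ N < 1

namespace Big

variable {T τ : L}

lemma congr (h : Big O v τ) (hT : v T = v τ) : Big O v T :=
  ⟨h.le_one, hT ▸ h.one_lt, fun c hc N => hT ▸ h.lt_one c hc N⟩

lemma pow (h : Big O v τ) {n : ℕ} (hn : n ≠ 0) (hT : v T = v τ ^ n) : Big O v T :=
  ⟨h.le_one, hT ▸ one_lt_pow₀ h.one_lt hn, fun c hc N => by
    rw [hT, ← pow_mul]; exact h.lt_one c hc _⟩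

lemma v_unit (h : Big O v τ) {c : O} (hc : IsUnit c) : v (algebraMap O L c) = 1 := by
  obtain ⟨d, hd⟩ := hc.exists_right_inv
  refine le_antisymm (h.le_one c) ?_
  have h1 : v (algebraMap O L c) * v (algebraMap O L d) = 1 := by
    rw [← map_mul, ← map_mul, hd, map_one, map_one]
  rw [← h1]
  exact mul_le_of_le_one_right' (h.le_one d)

lemma zero_lt (h : Big O v τ) : 0 < v τ := zero_lt_one.trans h.one_lt

end Big

lemma v_aeval_eq {O : Type*} [CommRing O] [Algebra O L]
    (hO : ∀ c : O, v (algebraMap O L c) ≤ 1) {T : L} (hT : 1 < v T) {P : Polynomial O}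
    {j : ℕ} (hj : v (algebraMap O L (P.coeff j)) = 1)
    (hgt : ∀ i, j < i → v (algebraMap O L (P.coeff i)) * v T ^ i < v T ^ j) :
    v (aeval T P) = v T ^ j := by
  have h0 : v T ^ j ≠ 0 := pow_ne_zero _ (zero_lt_one.trans hT).ne'
  have hP : aeval T P = algebraMap O L (P.coeff j) * T ^ j + aeval T (P.erase j) := by
    conv_lhs => rw [← P.monomial_add_erase j]
    rw [map_add, aeval_monomial]
  have h1 : v (algebraMap O L (P.coeff j) * T ^ j) = v T ^ j := by
    rw [map_mul, hj, one_mul, map_pow]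
  rw [hP, ← h1]
  refine v.map_add_eq_of_lt_left ?_
  rw [h1, aeval_eq_sum_range]
  refine v.map_sum_lt h0 fun i _ => ?_
  rw [Algebra.smul_def, map_mul, map_pow, coeff_erase]
  split_ifs with hij
  · simpa using zero_lt_iff.2 h0
  · rcases lt_or_gt_of_ne hij with hlt | hlt
    · refine (mul_le_of_le_one_left' (hO _)).trans_lt (pow_lt_pow_right₀ hT hlt)
    · exact hgt i hlt

namespace Big

variable {T τ : L}

lemma v_aeval (h : Big O v τ) {P : Polynomial O} (hP : P.map (IsLocalRing.residue O) ≠ 0) :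
    v (aeval τ P) = v τ ^ (P.map (IsLocalRing.residue O)).natDegree := by
  refine v_aeval_eq h.le_one h.one_lt (h.v_unit ?_) fun i hi => ?_
  · have := leadingCoeff_ne_zero.2 hP
    rw [leadingCoeff, coeff_map] at this
    exact (IsLocalRing.residue_ne_zero_iff_isUnit _).1 this
  · refine (h.lt_one _ ?_ i).trans_le (one_le_pow₀ h.one_lt.le)
    rw [← IsLocalRing.residue_eq_zero_iff, ← coeff_map]
    exact coeff_eq_zero_of_natDegree_lt hi

lemma exists_primitive {H : Polynomial K} (hH : H ≠ 0) : ∃ (c : K) (P : Polynomial O), c ≠ 0 ∧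
    P.map (IsLocalRing.residue O) ≠ 0 ∧ H = C c * P.map (algebraMap O K) := by
  obtain ⟨ϖ, hϖ⟩ := IsDiscreteValuationRing.exists_irreducible O
  have hinj := IsFractionRing.injective O K
  obtain ⟨b, hbm, hb⟩ := IsLocalization.integerNormalization_spec (nonZeroDivisors O) H
  set P0 := IsLocalization.integerNormalization (nonZeroDivisors O) H
  have hb0 : b ≠ 0 := nonZeroDivisors.ne_zero hbm
  have hbK : algebraMap O K b ≠ 0 := by simpa using hb0
  have hb' : P0.map (algebraMap O K) = C (algebraMap O K b) * H := by
    rw [hb, ← algebraMap_smul K b H, smul_eq_C_mul]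
  have hP0 : P0 ≠ 0 := by
    rintro h0
    rw [h0, Polynomial.map_zero] at hb'
    exact mul_ne_zero (C_ne_zero.2 hbK) hH hb'.symm
  have hpr : Prime (C ϖ : Polynomial O) := prime_C_iff.2 hϖ.prime
  obtain ⟨n, P, hP, hP0P⟩ := WfDvdMonoid.max_power_factor hP0 hpr.irreducible
  refine ⟨(algebraMap O K b)⁻¹ * algebraMap O K ϖ ^ n, P, ?_, ?_, ?_⟩
  · exact mul_ne_zero (inv_ne_zero hbK) (pow_ne_zero _ (by simp [hϖ.ne_zero]))
  · intro h0
    refine hP ((C_dvd_iff_dvd_coeff _ _).2 fun i => ?_)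
    rw [← Ideal.mem_span_singleton, ← hϖ.maximalIdeal_eq, ← IsLocalRing.residue_eq_zero_iff,
      ← coeff_map, h0, coeff_zero]
  · rw [hP0P, Polynomial.map_mul, Polynomial.map_pow, map_C] at hb'
    rw [C_mul, mul_assoc, C_pow, hb', ← mul_assoc, ← C_mul, inv_mul_cancel₀ hbK, C_1, one_mul]

variable (O) in
lemma v_aeval_field {H : Polynomial K} (hH : H ≠ 0) : ∃ (c : K) (j : ℕ), c ≠ 0 ∧
    ∀ T : L, Big O v T → v (aeval T H) = v (algebraMap K L c) * v T ^ j := by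
  obtain ⟨c, P, hc, hP, rfl⟩ := exists_primitive (O := O) hH
  refine ⟨c, (P.map (IsLocalRing.residue O)).natDegree, hc, fun T hT => ?_⟩
  rw [map_mul, aeval_C, aeval_map_algebraMap, map_mul, hT.v_aeval hP]

lemma v_eq_imp (h : Big O v τ) {c d : K} (hc : c ≠ 0) (hd : d ≠ 0) {i j : ℕ}
    (hcd : v (algebraMap K L c) * v τ ^ i = v (algebraMap K L d) * v τ ^ j) : i = j := by
  wlog hO : ∃ r : O, algebraMap O K r = c / d generalizing c d i j
  · refine (this hd hc hcd.symm ?_).symm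
    rcases ValuationRing.isInteger_or_isInteger O (c / d) with ⟨r, hr⟩ | ⟨r, hr⟩
    · exact absurd ⟨r, hr⟩ hO
    · exact ⟨r, by rw [hr, inv_div]⟩
  obtain ⟨r, hr⟩ := hO
  have hcd' : v (algebraMap O L r) * v τ ^ i = v τ ^ j := by
    have hd' : v (algebraMap K L d) ≠ 0 := by simpa using hd
    rw [IsScalarTower.algebraMap_apply O K L, hr, map_div₀, map_div₀, div_mul_eq_mul_div,
      div_eq_iff hd', hcd, mul_comm]
  by_cases hu : IsUnit r
  · rw [h.v_unit hu, one_mul] at hcd'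
    exact pow_right_injective₀ h.zero_lt h.one_lt.ne' hcd'
  · have := h.lt_one r hu i
    rw [hcd'] at this
    exact absurd this (not_lt.2 (one_le_pow₀ h.one_lt.le))

end Big

variable (O) in
/-- Chevalley's extension theorem gives a valuation for which `τ` is big. -/
lemma exists_big {τ : L} (hτ : Transcendental K τ) :
    ∃ V : ValuationSubring L, Big O V.valuation τ := by
  have hinj : Function.Injective (aeval τ : Polynomial O →ₐ[O] L) := by
    refine (transcendental_iff_injective).1 ?_
    exact hτ.restrictScalars (IsFractionRing.injective O K)
  have hτ0 : τ ≠ 0 := by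
    rintro rfl
    exact hτ (isAlgebraic_zero)
  let r := IsLocalRing.residue O
  have mulX : ∀ (P : Polynomial O) (N : ℕ), (((P * X ^ N).map r)).degree = (P.map r).degree + N := by
    intro P N
    simp
  let A : Subring L :=
    { carrier := {f | ∃ (N : ℕ) (P : Polynomial O), τ ^ N * f = aeval τ P ∧
        (P.map r).degree ≤ N}
      mul_mem' := by
        rintro f f' ⟨N, P, h1, h2⟩ ⟨N', P', h1', h2'⟩
        refine ⟨N + N', P * P', ?_, ?_⟩
        · rw [map_mul, ← h1, ← h1']; ring
        · rw [Polynomial.map_mul, degree_mul]; push_cast; exact add_le_add h2 h2'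
      one_mem' := ⟨0, 1, by simp, by simp⟩
      add_mem' := by
        rintro f f' ⟨N, P, h1, h2⟩ ⟨N', P', h1', h2'⟩
        refine ⟨N + N', P * X ^ N' + P' * X ^ N, ?_, ?_⟩
        · simp only [map_add, map_mul, map_pow, aeval_X, ← h1, ← h1']; ring
        · rw [Polynomial.map_add]
          refine (degree_add_le _ _).trans (max_le ?_ ?_)
          · rw [mulX]; push_cast; gcongr
          · rw [mulX]; push_cast; rw [add_comm]; gcongr
      zero_mem' := ⟨0, 0, by simp, by simp⟩
      neg_mem' := by
        rintro f ⟨N, P, h1, h2⟩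
        exact ⟨N, -P, by rw [map_neg, ← h1]; ring, by simpa using h2⟩ }
  have add_lt : ∀ {a b : WithBot ℕ} {N N' : ℕ}, a < N → b ≤ N' → a + b < ((N + N' : ℕ) : WithBot ℕ) := by
    intro a b N N' ha hb
    induction a with
    | bot => simp
    | coe a =>
      induction b with
      | bot => simp
      | coe b =>
        have ha' : a < N := WithBot.coe_lt_coe.1 ha
        have hb' : b ≤ N' := WithBot.coe_le_coe.1 hb
        have : a + b < N + N' := by omega
        exact WithBot.coe_lt_coe.2 this
  have mulX' : ∀ (P : Polynomial O) (N N' : ℕ), (P.map r).degree < N →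
      (((P * X ^ N').map r)).degree < ((N + N' : ℕ) : WithBot ℕ) := by
    intro P N N' h
    rw [mulX]
    exact add_lt h le_rfl
  let I : Ideal A :=
    { carrier := {f | ∃ (N : ℕ) (P : Polynomial O), τ ^ N * (f : L) = aeval τ P ∧
        (P.map r).degree < N}
      add_mem' := by
        rintro f f' ⟨N, P, h1, h2⟩ ⟨N', P', h1', h2'⟩
        refine ⟨N + N', P * X ^ N' + P' * X ^ N, ?_, ?_⟩
        · simp only [map_add, map_mul, map_pow, aeval_X, ← h1, ← h1', Subring.coe_add]; ring
        · rw [Polynomial.map_add]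
          refine (degree_add_le _ _).trans_lt (max_lt (mulX' _ _ _ h2) ?_)
          rw [add_comm N]
          exact mulX' _ _ _ h2'
      zero_mem' := ⟨1, 0, by simp, by simp⟩
      smul_mem' := by
        rintro ⟨f', N', P', h1', h2'⟩ f ⟨N, P, h1, h2⟩
        refine ⟨N + N', P * P', ?_, ?_⟩
        · simp only [smul_eq_mul, Subring.coe_mul, map_mul, ← h1, ← h1']; ring
        · rw [Polynomial.map_mul, degree_mul]
          exact add_lt h2 h2' }
  have hI : I ≠ ⊤ := by
    intro h
    have h1 : ∃ (N : ℕ) (P : Polynomial O), τ ^ N * ((1 : A) : L) = aeval τ P ∧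
        (P.map r).degree < N := (Ideal.eq_top_iff_one I).1 h
    obtain ⟨N, P, h1, h2⟩ := h1
    have : P = X ^ N := hinj (by rw [← h1]; simp)
    rw [this] at h2
    simp at h2
  obtain ⟨V, hAV, hIV⟩ := Ideal.image_subset_nonunits_valuationSubring I hI
  have hVI : ∀ f (N : ℕ) (P : Polynomial O), τ ^ N * f = aeval τ P → (P.map r).degree < N →
      V.valuation f < 1 := fun f N P h1 h2 =>
    (ValuationSubring.mem_nonunits_iff V).1
      (hIV ⟨⟨f, ⟨N, P, h1, h2.le⟩⟩, ⟨N, P, h1, h2⟩, rfl⟩)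
  refine ⟨V, fun c => ?_, ?_, fun c hc N => ?_⟩
  · exact (V.valuation_le_one_iff _).2 (hAV ⟨0, C c, by simp, by simpa using degree_C_le⟩)
  · have := hVI τ⁻¹ 1 1 (by simp [hτ0]) (by simp)
    rwa [map_inv₀, inv_lt_one₀ (zero_lt_iff.2 (by simpa using hτ0))] at this
  · rw [← map_pow, ← map_mul]
    refine hVI _ 0 (C c * X ^ N) (by simp) ?_
    have hc0 : r c = 0 := (IsLocalRing.residue_eq_zero_iff _).2 hc
    simp [hc0]

end Values

section

variable {O K L Γ : Type*} [CommRing O] [IsDomain O] [IsDiscreteValuationRing O] [Algebra ℚ O]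
  [Field K] [Algebra O K] [IsFractionRing O K] [Field L] [IsAlgClosed L] [Algebra K L]
  [Algebra O L] [IsScalarTower O K L]
  [LinearOrderedCommGroupWithZero Γ] {v : Valuation L Γ} {τ : L}
  {S g h : Polynomial O} [Algebra (Polynomial K) L]

/-- The fibre of `S` through `τ`, as a polynomial. -/
noncomputable def fib (S : Polynomial O) (τ : L) : Polynomial L :=
  S.map (algebraMap O L) - C (aeval τ S)

lemma natDegree_fib (hinj : Function.Injective (algebraMap O L)) :
    (fib S τ).natDegree = S.natDegree := by
  rw [fib, natDegree_sub_C, natDegree_map_eq_of_injective hinj]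

lemma leadingCoeff_fib (hinj : Function.Injective (algebraMap O L)) (hm : S.natDegree ≠ 0) :
    (fib S τ).leadingCoeff = algebraMap O L S.leadingCoeff := by
  rw [leadingCoeff, natDegree_fib hinj, fib, coeff_sub, coeff_C_of_ne_zero hm, sub_zero, coeff_map,
    leadingCoeff]

lemma fib_ne_zero (hinj : Function.Injective (algebraMap O L)) (hm : S.natDegree ≠ 0) :
    fib S τ ≠ 0 := by
  intro h0
  rw [← natDegree_fib hinj (τ := τ), h0, natDegree_zero] at hm
  exact hm rfl

lemma mem_fib (hinj : Function.Injective (algebraMap O L)) (hm : S.natDegree ≠ 0) {T : L} :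
    T ∈ (fib S τ).roots ↔ aeval T S = aeval τ S := by
  rw [mem_roots (fib_ne_zero hinj hm), IsRoot.def, fib, eval_sub, eval_C, eval_map_algebraMap,
    sub_eq_zero]

lemma v_aeval_of_isUnit {O : Type*} [CommRing O] [Algebra O L] {S : Polynomial O}
    (hO : ∀ c : O, v (algebraMap O L c) ≤ 1)
    (hS : v (algebraMap O L S.leadingCoeff) = 1) {T : L} (hT : 1 < v T) :
    v (aeval T S) = v T ^ S.natDegree :=
  v_aeval_eq hO hT hS fun i hi => by
    rw [coeff_eq_zero_of_natDegree_lt hi]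
    simpa using zero_lt_iff.2 (pow_ne_zero _ (zero_lt_one.trans hT).ne')

lemma v_aeval_le_one {O : Type*} [CommRing O] [Algebra O L] {S : Polynomial O}
    (hO : ∀ c : O, v (algebraMap O L c) ≤ 1) {T : L} (hT : v T ≤ 1) :
    v (aeval T S) ≤ 1 := by
  rw [aeval_eq_sum_range]
  refine v.map_sum_le fun i _ => ?_
  rw [Algebra.smul_def, map_mul, map_pow]
  exact mul_le_one' (hO _) (pow_le_one' hT _)

lemma v_of_fib (hb : Big O v τ) (hS : IsUnit S.leadingCoeff) (hm : S.natDegree ≠ 0) {T : L}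
    (hT : aeval T S = aeval τ S) : v T = v τ := by
  have h1 := v_aeval_of_isUnit hb.le_one (hb.v_unit hS) hb.one_lt
  rcases le_or_gt (v T) 1 with h2 | h2
  · have := v_aeval_le_one (S := S) hb.le_one h2
    rw [hT, h1] at this
    exact absurd this (not_le.2 (one_lt_pow₀ hb.one_lt hm))
  · have h3 := v_aeval_of_isUnit hb.le_one (hb.v_unit hS) h2
    rw [hT, h1] at h3
    exact ((pow_left_inj₀ zero_le zero_le hm).1 h3).symm

lemma nodup_fib (hinj : Function.Injective (algebraMap O L)) (hb : Big O v τ)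
    (hS : IsUnit S.leadingCoeff) (hm : S.natDegree ≠ 0) : (fib S τ).roots.Nodup := by
  classical
  rw [Multiset.nodup_iff_count_le_one]
  intro T
  rw [count_roots]
  by_contra! h1
  obtain ⟨h3, h2⟩ := (one_lt_rootMultiplicity_iff_isRoot (fib_ne_zero hinj hm)).1 h1
  have hT : aeval T S = aeval τ S := (mem_fib hinj hm).1 ((mem_roots (fib_ne_zero hinj hm)).2 h3)
  have hvT : 1 < v T := by rw [v_of_fib hb hS hm hT]; exact hb.one_lt
  rw [fib, derivative_sub, derivative_C, sub_zero, IsRoot.def, derivative_map,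
    eval_map_algebraMap] at h2
  have hlc : IsUnit ((derivative S).coeff (S.natDegree - 1)) := by
    rw [coeff_derivative]
    have e1 : S.natDegree - 1 + 1 = S.natDegree := by omega
    rw [e1]
    refine hS.mul ?_
    have : ((S.natDegree - 1 : ℕ) : O) + 1 = algebraMap ℚ O S.natDegree := by
      rw [map_natCast, ← e1]; norm_cast
    rw [this]
    exact (IsUnit.mk0 _ (by exact_mod_cast hm)).map _
  have h4 := v_aeval_eq hb.le_one hvT (hb.v_unit hlc) fun i hi => by
    rw [coeff_eq_zero_of_natDegree_lt ((natDegree_derivative_le S).trans_lt hi)]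
    simpa using zero_lt_iff.2 (pow_ne_zero _ (zero_lt_one.trans hvT).ne')
  rw [h2, map_zero] at h4
  exact pow_ne_zero _ (zero_lt_one.trans hvT).ne' h4.symm

/-- A polynomial which is the variable modulo the maximal ideal is injective on the elements of a
given large value. -/
lemma aeval_inj (hb : Big O v τ) (hh : h.map (IsLocalRing.residue O) = X) {T T' : L}
    (hT : v T = v τ) (hT' : v T' = v τ) (heq : aeval T h = aeval T' h) : T = T' := by
  by_contra hne
  have hne' : v (T - T') ≠ 0 := by simpa [sub_eq_zero] using hne
  set Q := h - X with hQ
  have hmem : ∀ i, Q.coeff i ∈ IsLocalRing.maximalIdeal O := fun i => by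
    rw [← IsLocalRing.residue_eq_zero_iff, ← coeff_map, hQ, Polynomial.map_sub, hh, map_X,
      sub_self, coeff_zero]
  have hhQ : h = X + Q := by rw [hQ]; ring
  have h1 : T - T' = -(aeval T Q - aeval T' Q) := by
    rw [hhQ] at heq
    simp only [map_add, aeval_X] at heq
    linear_combination heq
  have h2 : v (aeval T Q - aeval T' Q) < v (T - T') := by
    rw [aeval_eq_sum_range, aeval_eq_sum_range, ← Finset.sum_sub_distrib]
    refine v.map_sum_lt hne' fun i _ => ?_
    rw [Algebra.smul_def, Algebra.smul_def, ← mul_sub, ← (Commute.all T T').geom_sum₂_mul, map_mul,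
      map_mul, ← mul_assoc]
    have h3 : v (∑ a ∈ Finset.range i, T ^ a * T' ^ (i - 1 - a)) ≤ v τ ^ i := by
      refine v.map_sum_le fun a ha => ?_
      rw [map_mul, map_pow, map_pow, hT, hT', ← pow_add]
      exact pow_le_pow_right₀ hb.one_lt.le (by have := Finset.mem_range.1 ha; omega)
    refine mul_lt_of_lt_one_left (zero_lt_iff.2 hne') ?_
    exact (mul_le_mul' le_rfl h3).trans_lt (hb.lt_one _ (hmem i) i)
  rw [h1, Valuation.map_neg] at h2
  exact lt_irrefl _ h2

/-- Substitution of `S` and `g` in a polynomial in two variables. -/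
noncomputable def subst (K : Type*) [Field K] [Algebra O K] (S g : Polynomial O) :
    Polynomial (Polynomial K) →+* Polynomial K :=
  eval₂RingHom (compRingHom (S.map (algebraMap O K))) (g.map (algebraMap O K))

lemma aeval_subst (hR : ∀ a : Polynomial K, algebraMap (Polynomial K) L a = aeval (aeval τ S) a)
    {T : L} (hT : aeval T S = aeval τ S) (a : Polynomial (Polynomial K)) :
    aeval T (subst K S g a) = aeval (aeval T g) a := by
  have h1 : (aeval T : Polynomial K →ₐ[K] L).toRingHom.comp
      (compRingHom (S.map (algebraMap O K))) = algebraMap (Polynomial K) L := by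
    refine RingHom.ext fun p => ?_
    rw [hR, ← hT]
    simp [aeval_comp, aeval_map_algebraMap]
  have h2 := hom_eval₂ a (compRingHom (S.map (algebraMap O K)))
    (aeval T : Polynomial K →ₐ[K] L).toRingHom (g.map (algebraMap O K))
  rw [h1] at h2
  rw [aeval_def (aeval T g)]
  refine Eq.trans h2 ?_
  congr 1
  simp [aeval_map_algebraMap]

lemma range_subst (hadj : h.map (algebraMap O K) ∈
    Algebra.adjoin K {S.map (algebraMap O K), g.map (algebraMap O K)}) :
    ∃ a, subst K S g a = h.map (algebraMap O K) := by
  refine Algebra.adjoin_induction (p := fun x _ => ∃ a, subst K S g a = x) ?_ ?_ ?_ ?_ hadj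
  · rintro x (rfl | rfl)
    · exact ⟨C X, by simp [subst]⟩
    · exact ⟨X, by simp [subst]⟩
  · exact fun r => ⟨C (C r), by simp [subst]⟩
  · rintro x y - - ⟨a, rfl⟩ ⟨b, rfl⟩
    exact ⟨a + b, map_add _ _ _⟩
  · rintro x y - - ⟨a, rfl⟩ ⟨b, rfl⟩
    exact ⟨a * b, map_mul _ _ _⟩

lemma exists_e (hinj : Function.Injective (algebraMap O L)) (hm : S.natDegree ≠ 0)
    (hR : ∀ a : Polynomial K, algebraMap (Polynomial K) L a = aeval (aeval τ S) a)
    (hRinj : Function.Injective (algebraMap (Polynomial K) L)) :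
    ∃ e : Polynomial (Polynomial K), e.Monic ∧ e.map (algebraMap (Polynomial K) L) =
      ((fib S τ).roots.map fun T => X - C (aeval T g)).prod := by
  have hinjK : Function.Injective (algebraMap O K) := by
    rw [IsScalarTower.algebraMap_eq O K L] at hinj
    exact Function.Injective.of_comp (f := algebraMap K L) hinj
  let iK : O →+* Polynomial (Polynomial K) := (C.comp C).comp (algebraMap O K)
  let φ : Polynomial (Polynomial K) →+* Polynomial L := mapRingHom (algebraMap (Polynomial K) L)
  have hφ : φ.comp iK = C.comp (algebraMap O L) := by
    refine RingHom.ext fun c => ?_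
    simp [φ, iK, hR, ← IsScalarTower.algebraMap_apply O K L]
  set s := algebraMap O K S.leadingCoeff with hs
  have hs0 : s ≠ 0 := by
    rw [hs, Ne, map_eq_zero_iff _ hinjK, leadingCoeff_eq_zero]
    rintro rfl; simp at hm
  let f := S.map iK - C (C X)
  let gg := C X - g.map iK
  have hf : f.map φ = (fib S τ).map C := by
    simp [f, fib, φ, Polynomial.map_map, ← hφ, hR]
  have hgg : gg.map φ = C X - (g.map (algebraMap O L)).map C := by
    simp [gg, φ, Polynomial.map_map, ← hφ]
  have hspl : (fib S τ).Splits := IsAlgClosed.splits _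
  have hfd : (f.map φ).natDegree = S.natDegree := by
    rw [hf, natDegree_map_eq_of_injective C_injective, natDegree_fib hinj]
  have hres : φ (resultant f gg S.natDegree gg.natDegree) =
      C (algebraMap K L s) ^ gg.natDegree * ((fib S τ).roots.map fun T => X - C (aeval T g)).prod := by
    rw [← resultant_map_map]
    conv_lhs => rw [← hfd]
    rw [resultant_eq_prod_eval (f.map φ) (gg.map φ) _ natDegree_map_le (by rw [hf]; exact hspl.map C)]
    congr 1
    · rw [hf, leadingCoeff_map_of_injective C_injective, leadingCoeff_fib hinj hm, hs,
        ← IsScalarTower.algebraMap_apply O K L]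
    · rw [hf, hgg, hspl.roots_map_of_injective C_injective, Multiset.map_map]
      congr 1
      refine Multiset.map_congr rfl fun T _ => ?_
      simp [eval_map_algebraMap]
  refine ⟨C (C (s⁻¹ ^ gg.natDegree)) * resultant f gg S.natDegree gg.natDegree, ?_, ?_⟩
  all_goals
    have hmap : (C (C (s⁻¹ ^ gg.natDegree)) * resultant f gg S.natDegree gg.natDegree).map
        (algebraMap (Polynomial K) L) =
          ((fib S τ).roots.map fun T => X - C (aeval T g)).prod := by
      rw [Polynomial.map_mul, map_C, hR, aeval_C]
      refine Eq.trans (congrArg _ hres) ?_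
      rw [← mul_assoc, ← C_pow, ← C_mul, ← map_pow, ← map_mul, ← mul_pow, inv_mul_cancel₀ hs0]
      simp
  · refine monic_of_injective hRinj ?_
    rw [hmap]
    exact monic_multiset_prod_of_monic _ _ fun T _ => monic_X_sub_C _
  · exact hmap

end

lemma exists_combination {R : Type*} [CommRing R] [Nontrivial R] {P : ℕ → Polynomial R} {M : ℕ}
    (hP : ∀ k < M, (P k).Monic ∧ (P k).natDegree = k) (a : Polynomial R) (ha : a.degree < M) :
    ∃ c : ℕ → R, a = ∑ k ∈ Finset.range M, C (c k) * P k := by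
  induction M generalizing a with
  | zero =>
    refine ⟨0, ?_⟩
    have : a = 0 := by simpa [Nat.WithBot.lt_zero_iff] using ha
    simp [this]
  | succ M ih =>
    obtain ⟨h1, h2⟩ := hP M (by omega)
    have h3 : (a - C (a.coeff M) * P M).degree < M := by
      rw [degree_lt_iff_coeff_zero]
      intro k hk
      rw [coeff_sub, coeff_C_mul]
      rcases hk.eq_or_lt with rfl | hk
      · have h4 : (P M).coeff M = 1 := by
          have := h1.coeff_natDegree
          rwa [h2] at this
        rw [h4, mul_one, sub_self]
      · rw [coeff_eq_zero_of_degree_lt (ha.trans_le (by exact_mod_cast hk)),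
          coeff_eq_zero_of_natDegree_lt (by omega : (P M).natDegree < k), mul_zero, sub_zero]
    obtain ⟨c, hc⟩ := ih (fun k hk => hP k (by omega)) _ h3
    refine ⟨fun k => if k = M then a.coeff M else c k, ?_⟩
    rw [Finset.sum_range_succ]
    beta_reduce
    rw [if_pos rfl, Finset.sum_congr rfl (g := fun k => C (c k) * P k)
      (fun k hk => by rw [if_neg (Finset.mem_range.1 hk).ne]), ← hc]
    ring

section

variable {O K L Γ : Type*} [CommRing O] [IsDomain O] [IsDiscreteValuationRing O] [Algebra ℚ O]
  [Field K] [Algebra O K] [IsFractionRing O K] [Field L] [IsAlgClosed L] [Algebra K L]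
  [Algebra O L] [IsScalarTower O K L]
  [LinearOrderedCommGroupWithZero Γ] {v : Valuation L Γ} {τ : L}
  {S g h : Polynomial O}

lemma natDegree_lt_of_big (hb : Big O v τ) (hτ : Transcendental K τ)
    (hS : IsUnit S.leadingCoeff) (hm : S.natDegree ≠ 0)
    (hg : g.map (IsLocalRing.residue O) ≠ 0) (hh : h.map (IsLocalRing.residue O) = X)
    (hadj : h.map (algebraMap O K) ∈
      Algebra.adjoin K {S.map (algebraMap O K), g.map (algebraMap O K)})
    (hdvd : ¬ S.natDegree ∣ (g.map (IsLocalRing.residue O)).natDegree) :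
    (g.map (IsLocalRing.residue O)).natDegree < S.natDegree := by
  classical
  have hinj : Function.Injective (algebraMap O L) := by
    rw [IsScalarTower.algebraMap_eq O K L]
    exact (algebraMap K L).injective.comp (IsFractionRing.injective O K)
  set n := (g.map (IsLocalRing.residue O)).natDegree with hn
  set m := S.natDegree with hmdef
  let := (aeval (aeval τ S) : Polynomial K →ₐ[K] L).toRingHom.toAlgebra
  have hR : ∀ a : Polynomial K, algebraMap (Polynomial K) L a = aeval (aeval τ S) a := fun _ => rfl
  have hvS : v (aeval τ S) = v τ ^ m := v_aeval_of_isUnit hb.le_one (hb.v_unit hS) hb.one_lt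
  have hbS : Big O v (aeval τ S) := hb.pow hm hvS
  have hv0 : v τ ≠ 0 := hb.zero_lt.ne'
  have hvR : ∀ a : Polynomial K, a ≠ 0 → ∃ (c : K) (t : ℕ), c ≠ 0 ∧
      v (algebraMap (Polynomial K) L a) = v (algebraMap K L c) * v τ ^ (m * t) := fun a ha => by
    obtain ⟨c, t, hc, h1⟩ := Big.v_aeval_field (L := L) (v := v) O ha
    exact ⟨c, t, hc, by rw [hR, h1 _ hbS, hvS, pow_mul]⟩
  have hRinj : Function.Injective (algebraMap (Polynomial K) L) := by
    rw [injective_iff_map_eq_zero]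
    intro a ha
    by_contra ha0
    obtain ⟨c, t, hc, h1⟩ := hvR a ha0
    rw [ha, map_zero] at h1
    exact mul_ne_zero (by simpa using hc) (pow_ne_zero _ hv0) h1.symm
  obtain ⟨e, he, hemap⟩ := exists_e (g := g) hinj hm hR hRinj
  have : CharZero K :=
    have := algebraRat.charZero O
    charZero_of_injective_algebraMap (IsFractionRing.injective O K)
  let ι := {T // T ∈ (fib S τ).roots.toFinset}
  have hι : ∀ T : ι, aeval T.1 S = aeval τ S := fun T =>
    (mem_fib hinj hm).1 (Multiset.mem_toFinset.1 T.2)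
  have hιv : ∀ T : ι, v T.1 = v τ := fun T => v_of_fib hb hS hm (hι T)
  have hnd := nodup_fib hinj hb hS hm
  have hsys : OrthSys v (fun T : ι => aeval T.1 g) e := by
    refine ⟨fun T T' hTT => ?_, he, ?_, fun a T T' => ?_, fun k hk => ?_⟩
    · obtain ⟨b, hb'⟩ := range_subst hadj
      refine Subtype.ext (aeval_inj hb hh (hιv T) (hιv T') ?_)
      rw [← aeval_map_algebraMap K T.1, ← aeval_map_algebraMap K T'.1, ← hb',
        aeval_subst hR (hι T), aeval_subst hR (hι T')]
      exact congrArg (fun y => aeval y b) hTT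
    · rw [hemap, Finset.prod_coe_sort (fib S τ).roots.toFinset fun T => X - C (aeval T g),
        Finset.prod, Multiset.toFinset_val, hnd.dedup]
    · rw [← aeval_subst hR (hι T), ← aeval_subst hR (hι T')]
      by_cases h0 : subst K S g a = 0
      · simp only [h0, map_zero]
      · obtain ⟨c, j, hc, h1⟩ := Big.v_aeval_field (L := L) (v := v) O h0
        rw [h1 _ (hb.congr (hιv T)), h1 _ (hb.congr (hιv T')), hιv, hιv]
    · have := hb.v_unit (c := algebraMap ℚ O k) ((IsUnit.mk0 _ (by exact_mod_cast hk)).map _)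
      rwa [map_natCast, map_natCast] at this
  have hcard : Fintype.card ι = m := by
    rw [Fintype.card_coe, Multiset.toFinset_card_of_nodup hnd,
      ← (IsAlgClosed.splits (fib S τ)).natDegree_eq_card_roots, natDegree_fib hinj]
  let τ0 : ι := ⟨τ, Multiset.mem_toFinset.2 ((mem_fib hinj hm).2 rfl)⟩
  obtain ⟨P, hP1, hP2⟩ := hsys.exists_orth τ0
  rw [hcard] at hP1 hP2
  set γ := aeval τ g with hγ
  change ∀ (c : ℕ → Polynomial K), ∀ k < m, v (aeval γ (C (c k) * P k)) ≤
      v (aeval γ (∑ k ∈ Finset.range m, C (c k) * P k)) at hP2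
  have heγ : aeval γ e = 0 := by
    rw [← eval_map_algebraMap, hsys.map_e, eval_prod]
    exact Finset.prod_eq_zero (Finset.mem_univ τ0) (by simp [τ0, hγ])
  have hvP : ∀ k, aeval γ (P k) ≠ 0 → ∃ (c : K) (j : ℕ), c ≠ 0 ∧
      v (aeval γ (P k)) = v (algebraMap K L c) * v τ ^ j := fun k hk => by
    rw [← aeval_subst hR rfl] at hk
    obtain ⟨c, j, hc, h1⟩ := Big.v_aeval_field (L := L) (v := v) O (H := subst K S g (P k))
      (by rintro h0; rw [h0, map_zero] at hk; exact hk rfl)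
    exact ⟨c, j, hc, by rw [← aeval_subst hR rfl, h1 _ hb]⟩
  have hnt : Nontrivial (Polynomial K) := inferInstance
  -- every power of `τ` below the degree is the value of some member of the basis
  have key : ∀ i < m, ∃ k < m, ∃ c : K, c ≠ 0 ∧
      v (aeval γ (P k)) = v (algebraMap K L c) * v τ ^ i := by
    intro i hi
    obtain ⟨b, hb'⟩ := range_subst hadj
    have h1 : aeval γ ((b ^ i) %ₘ e) = aeval τ h ^ i := by
      have h2 := congrArg (aeval γ) (modByMonic_add_div (b ^ i) e)
      rw [map_add, map_mul, heγ, zero_mul, add_zero, map_pow,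
        ← aeval_subst (g := g) hR rfl b, hb', aeval_map_algebraMap] at h2
      exact h2
    have hed : e.natDegree = m := by rw [hsys.natDegree_e, hcard]
    obtain ⟨c, hc⟩ := exists_combination hP1 ((b ^ i) %ₘ e) (by
      refine (degree_modByMonic_lt _ he).trans_le ?_
      rw [← hed]; exact degree_le_natDegree)
    have hvh : v (aeval γ ((b ^ i) %ₘ e)) = v τ ^ i := by
      rw [h1, map_pow, hb.v_aeval (by rw [hh]; exact X_ne_zero), hh, natDegree_X, pow_one]
    have h3 : ∃ k < m, v (aeval γ (C (c k) * P k)) = v τ ^ i := by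
      by_contra! h4
      have h5 : v (aeval γ ((b ^ i) %ₘ e)) < v τ ^ i := by
        conv_lhs => rw [hc, map_sum]
        refine v.map_sum_lt (pow_ne_zero _ hv0) fun k hk => ?_
        have hk' := Finset.mem_range.1 hk
        refine lt_of_le_of_ne ?_ (h4 k hk')
        rw [← hvh]
        conv_rhs => rw [hc]
        exact hP2 c k hk'
      exact h5.ne hvh
    obtain ⟨k, hk, h4⟩ := h3
    rw [map_mul, aeval_C, map_mul] at h4
    have h5 : v τ ^ i ≠ 0 := pow_ne_zero _ hv0
    have hck : c k ≠ 0 := by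
      rintro h0; rw [h0, map_zero, map_zero, zero_mul] at h4; exact h5 h4.symm
    have hPk : aeval γ (P k) ≠ 0 := by
      rintro h0; rw [h0, map_zero, mul_zero] at h4; exact h5 h4.symm
    obtain ⟨c', t, hc', h6⟩ := hvR _ hck
    obtain ⟨d, j, hd, h7⟩ := hvP k hPk
    rw [h6, h7] at h4
    have h8 : i = m * t + j := by
      refine hb.v_eq_imp (one_ne_zero (α := K)) (mul_ne_zero hc' hd) ?_
      rw [map_one, map_one, one_mul, ← h4, map_mul, map_mul, pow_add]
      ac_rfl
    have ht : t = 0 := by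
      rcases Nat.eq_zero_or_pos t with h0 | h0
      · exact h0
      · have := Nat.le_mul_of_pos_right m h0
        omega
    subst ht
    exact ⟨k, hk, d, hd, by rw [h7, h8, mul_zero, zero_add]⟩
  choose! k hkm ck hck0 hck using key
  have hkinj : Set.InjOn k (Finset.range m) := by
    intro i hi j hj hij
    have hi' := hck i (by simpa using hi)
    have hj' := hck j (by simpa using hj)
    rw [hij] at hi'
    exact hb.v_eq_imp (hck0 i (by simpa using hi)) (hck0 j (by simpa using hj)) (hi'.symm.trans hj')
  have hm1 : 1 < m := by
    rcases Nat.lt_or_ge 1 m with h1 | h1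
    · exact h1
    · exact absurd (by rw [show m = 1 by omega]; exact one_dvd _) hdvd
  obtain ⟨i, hi, hki⟩ := Finset.surjOn_of_injOn_of_card_le k
    (fun i hi => by simpa using hkm i (by simpa using hi)) hkinj le_rfl
    (show 1 ∈ (Finset.range m : Set ℕ) by simpa using hm1)
  have hi' : i < m := by simpa using hi
  have hvP1 := hck i hi'
  rw [hki] at hvP1
  have hP0 : P 0 = 1 := eq_one_of_monic_natDegree_zero (hP1 0 (by omega)).1 (hP1 0 (by omega)).2
  have hP1' : X = P 1 - C ((P 1).coeff 0) := by
    have h1 := (hP1 1 hm1).1.coeff_natDegree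
    rw [(hP1 1 hm1).2] at h1
    have h2 := eq_X_add_C_of_natDegree_le_one (hP1 1 hm1).2.le
    rw [h1, C_1, one_mul] at h2
    conv_rhs => rw [h2]
    simp
  set c0 := (P 1).coeff 0 with hc0
  have hsum : ∑ k ∈ Finset.range m, C ((fun k => if k = 0 then -c0 else if k = 1 then 1 else 0) k) *
      P k = X := by
    obtain ⟨m', hm'⟩ : ∃ m', m = m' + 2 := ⟨m - 2, by omega⟩
    rw [hm', Finset.sum_range_succ', Finset.sum_range_succ']
    simp only [hP0]
    rw [Finset.sum_eq_zero (fun k _ => by simp)]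
    conv_rhs => rw [hP1']
    simp
    ring
  have h10 := hP2 (fun k => if k = 0 then -c0 else if k = 1 then 1 else 0) 0 (by omega)
  have h11 := hP2 (fun k => if k = 0 then -c0 else if k = 1 then 1 else 0) 1 hm1
  rw [hsum, aeval_X] at h10 h11
  simp only [if_true, one_ne_zero, if_false, hP0, map_one, mul_one, one_mul, aeval_C, map_neg,
    Valuation.map_neg] at h10 h11
  have hvγ : v γ = v τ ^ n := hb.v_aeval hg
  have hne : v (algebraMap (Polynomial K) L c0) ≠ v γ := by
    intro h0
    have hc0' : c0 ≠ 0 := by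
      rintro h1
      rw [h1, map_zero, map_zero, hvγ] at h0
      exact pow_ne_zero _ hv0 h0.symm
    obtain ⟨c, t, hc, h1⟩ := hvR _ hc0'
    refine hdvd ⟨t, ?_⟩
    refine hb.v_eq_imp (one_ne_zero (α := K)) hc ?_
    rw [map_one, map_one, one_mul, ← hvγ, ← h0, h1]
  have hlt := lt_of_le_of_ne h10 hne
  have hfin : v (aeval γ (P 1)) = v γ := by
    have : aeval γ (P 1) = γ + algebraMap (Polynomial K) L c0 := by
      have := congrArg (aeval γ) hP1'
      rw [aeval_X, map_sub, aeval_C] at this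
      rw [eq_sub_iff_add_eq] at this
      exact this.symm
    rw [this]
    exact v.map_add_eq_of_lt_left hlt
  rw [hfin, hvγ] at hvP1
  have : n = i := by
    refine hb.v_eq_imp (one_ne_zero (α := K)) (hck0 i hi') ?_
    rw [map_one, map_one, one_mul, hvP1]
  omega

end

/-- A relative form of the Abhyankar–Moh theorem over a discrete valuation ring: if the reduction
of an element of `K[S, g]` is the variable, then the degree of `S` divides that of the reduction of
`g`, or exceeds it. -/
theorem natDegree_lt_of_not_dvd {O K : Type*} [CommRing O] [IsDomain O]
    [IsDiscreteValuationRing O] [Algebra ℚ O] [Field K] [Algebra O K] [IsFractionRing O K]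
    {S g h : Polynomial O} (hS : IsUnit S.leadingCoeff) (hm : S.natDegree ≠ 0)
    (hg : g.map (IsLocalRing.residue O) ≠ 0) (hh : h.map (IsLocalRing.residue O) = X)
    (hadj : h.map (algebraMap O K) ∈
      Algebra.adjoin K {S.map (algebraMap O K), g.map (algebraMap O K)})
    (hdvd : ¬ S.natDegree ∣ (g.map (IsLocalRing.residue O)).natDegree) :
    (g.map (IsLocalRing.residue O)).natDegree < S.natDegree := by
  have aux : ∀ (F L : Type _) [Field F] [Field L] [Algebra K F] [Algebra F L] [IsAlgClosed L]
      (τ : F), Transcendental K τ → (g.map (IsLocalRing.residue O)).natDegree < S.natDegree := by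
    intro F L _ _ _ _ _ τ hτF
    let i1 : Algebra K L := ((algebraMap F L).comp (algebraMap K F)).toAlgebra
    let i2 : Algebra O L := ((algebraMap K L).comp (algebraMap O K)).toAlgebra
    have : IsScalarTower O K L := IsScalarTower.of_algebraMap_eq fun _ => rfl
    have : IsScalarTower K F L := IsScalarTower.of_algebraMap_eq fun _ => rfl
    have hτ : Transcendental K (algebraMap F L τ) :=
      (transcendental_algebraMap_iff (algebraMap F L).injective).2 hτF
    obtain ⟨V, hV⟩ := exists_big O hτ
    exact natDegree_lt_of_big hV hτ hS hm hg hh hadj hdvd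
  exact aux (RatFunc K) (AlgebraicClosure (RatFunc K)) RatFunc.X RatFunc.transcendental_X

end Polynomial.AMVal

namespace TriAction

theorem mem_kerDer {R B : Type*} [CommRing R] [CommRing B] [Algebra R B]
    {D : Derivation R B B} {b : B} : b ∈ kerDer D ↔ D b = 0 := Iff.rfl

section Integ
variable {R : Type*} [CommRing R] [Algebra ℚ R]

/-- The antiderivative with zero constant term. -/
noncomputable def integ (f : Polynomial R) : Polynomial R :=
  f.sum fun n c => Polynomial.monomial (n + 1) (((n : ℚ) + 1)⁻¹ • c)

theorem coeff_integ_zero (f : Polynomial R) : (integ f).coeff 0 = 0 := by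
  simp [integ, Polynomial.sum_def, Polynomial.finsetSum_coeff, Polynomial.coeff_monomial]

theorem derivative_integ (f : Polynomial R) : Polynomial.derivative (integ f) = f := by
  conv_rhs => rw [← Polynomial.sum_monomial_eq f]
  simp only [integ, Polynomial.sum_def, map_sum]
  refine Finset.sum_congr rfl fun n _ => ?_
  rw [Polynomial.derivative_monomial]
  congr 1
  have h : ((n : ℚ) + 1)⁻¹ • f.coeff n * ((n + 1 : ℕ) : R)
      = (((n : ℚ) + 1)⁻¹ * ((n : ℚ) + 1)) • f.coeff n := by
    rw [mul_comm ((n : ℚ) + 1)⁻¹, mul_smul, Algebra.smul_def ((n : ℚ) + 1)]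
    simp [mul_comm]
  rw [h, inv_mul_cancel₀ (by positivity), one_smul]

end Integ

section Exp
variable {A B : Type*} [CommRing A] [CommRing B] [Algebra A B]

/-- `E` is the exponential `b ↦ Σ t^j/j! D^j b`. -/
structure IsExp (D : Derivation A B B) (E : B →ₐ[A] Polynomial B) : Prop where
  deriv : ∀ b, Polynomial.derivative (E b) = E (D b)
  coeff_zero : ∀ b, (E b).coeff 0 = b

variable {D : Derivation A B B} {E : B →ₐ[A] Polynomial B}

theorem IsExp.iterate (h : IsExp D E) (n : ℕ) (b : B) :
    Polynomial.derivative^[n] (E b) = E (D^[n] b) := by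
  induction n generalizing b with
  | zero => rfl
  | succ n ih => rw [Function.iterate_succ_apply, h.deriv, ih, Function.iterate_succ_apply]

theorem IsExp.factorial_mul_coeff (h : IsExp D E) (n : ℕ) (b : B) :
    (n.factorial : B) * (E b).coeff n = D^[n] b := by
  have := congrArg (fun f => Polynomial.coeff f 0) (h.iterate n b)
  simpa [Polynomial.coeff_iterate_derivative, h.coeff_zero, Nat.descFactorial_self] using this

theorem IsExp.exists_iterate_eq_zero (h : IsExp D E) (b : B) : ∃ N, D^[N] b = 0 :=
  ⟨(E b).natDegree + 1, by
    rw [← h.factorial_mul_coeff, Polynomial.coeff_eq_zero_of_natDegree_lt (Nat.lt_succ_self _),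
      mul_zero]⟩

variable [Algebra ℚ B]

theorem IsExp.coeff (h : IsExp D E) (n : ℕ) (b : B) :
    (E b).coeff n = (n.factorial : ℚ)⁻¹ • D^[n] b := by
  rw [← h.factorial_mul_coeff, ← smul_eq_mul, Nat.cast_smul_eq_nsmul, ← Nat.cast_smul_eq_nsmul ℚ, smul_smul,
    inv_mul_cancel₀ (by positivity), one_smul]

theorem IsExp.apply_of_mem (h : IsExp D E) {b : B} (hb : D b = 0) : E b = Polynomial.C b := by
  ext n
  rcases n with _ | n
  · simp [h.coeff_zero]
  · rw [h.coeff, Function.iterate_succ_apply, hb, Polynomial.coeff_C_succ]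
    simp

theorem IsExp.expPoly_eq (h : IsExp D E) {N : ℕ} {b : B} (hb : D^[N] b = 0) :
    expPoly D N b = E b := by
  ext n
  rw [expPoly, Polynomial.finsetSum_coeff, h.coeff]
  simp only [Polynomial.coeff_C_mul_X_pow, Finset.sum_ite_eq, Finset.mem_range]
  split_ifs with hn
  · rfl
  · obtain ⟨m, rfl⟩ := Nat.exists_eq_add_of_le (not_lt.mp hn)
    rw [add_comm, Function.iterate_add_apply, hb, ← Derivation.coeFn_coe, iterate_map_zero, smul_zero]

theorem IsExp.exists_of_isProper (h : IsExp D E) (hp : IsProperGaAction D) :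
    ∃ (m : ℕ) (f g : Fin m → B), Polynomial.X = ∑ i, Polynomial.C (f i) * E (g i) := by
  obtain ⟨m, f, g, N, hN, he⟩ := hp Polynomial.X
  refine ⟨m, f, g, he.trans (Finset.sum_congr rfl fun i _ => ?_)⟩
  rw [h.expPoly_eq (hN i)]

variable (E) in
/-- The projection onto the kernel along a slice. -/
noncomputable def dixmier (s : B) : B →ₐ[A] B :=
  ((Polynomial.aeval (R := B) (-s)).restrictScalars A).comp E

theorem dixmier_apply (s b : B) : dixmier E s b = (E b).eval (-s) := by
  simp [dixmier, Polynomial.coe_aeval_eq_eval]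

theorem IsExp.dixmier_of_mem (h : IsExp D E) (s : B) {b : B} (hb : D b = 0) :
    dixmier E s b = b := by
  rw [dixmier_apply, h.apply_of_mem hb, Polynomial.eval_C]

theorem IsExp.dixmier_mem (h : IsExp D E) {s : B} (hs : D s = 1) (b : B) :
    D (dixmier E s b) = 0 := by
  have key : ∀ f : Polynomial B, D (f.eval (-s)) =
      (f.sum fun n c => D c * (-s) ^ n) - f.derivative.eval (-s) := by
    intro f
    induction f using Polynomial.induction_on' with
    | add p q hp hq =>
      rw [Polynomial.eval_add, map_add, hp, hq, Polynomial.sum_add_index]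
      · simp; ring
      · simp
      · intros; simp [add_mul]
    | monomial n c =>
      rw [Polynomial.sum_monomial_index _ _ (by simp)]
      simp [Polynomial.derivative_monomial, D.leibniz_pow, hs]
      ring
  rw [dixmier_apply, key, h.deriv, Polynomial.eval_eq_sum, sub_eq_zero]
  rw [Polynomial.sum_over_range' _ _ ((E b).natDegree + (E (D b)).natDegree + 1) (by omega),
    Polynomial.sum_over_range' _ _ ((E b).natDegree + (E (D b)).natDegree + 1) (by omega)]
  · refine Finset.sum_congr rfl fun n _ => ?_
    rw [h.coeff, h.coeff, ← Function.iterate_succ_apply, Function.iterate_succ_apply',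
      map_rat_smul]
  · simp
  · simp

theorem IsExp.range_dixmier (h : IsExp D E) {s : B} (hs : D s = 1) :
    (dixmier E s).range = kerDer D := by
  apply le_antisymm
  · rintro _ ⟨b, rfl⟩
    exact h.dixmier_mem hs b
  · intro b hb
    exact ⟨b, h.dixmier_of_mem s hb⟩

theorem eval_slice_deriv {s : B} (hs : D s = 1) (F : Polynomial (kerDer D)) :
    D (Polynomial.aeval s F) = Polynomial.aeval s (Polynomial.derivative F) := by
  induction F using Polynomial.induction_on' with
  | add p q hp hq => simp [hp, hq]
  | monomial n c =>
    have hc : D (c : B) = 0 := c.2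
    simp [Polynomial.derivative_monomial, Polynomial.aeval_monomial, D.leibniz_pow, hs, D.leibniz, hc]
    ring

theorem IsExp.slice_bijective [Algebra ℚ A] [IsScalarTower ℚ A B] (h : IsExp D E) {s : B}
    (hs : D s = 1) : Function.Bijective (Polynomial.aeval (R := kerDer D) s) := by
  have : IsAddTorsionFree (kerDer D) := .of_module_rat _
  constructor
  · rw [injective_iff_map_eq_zero]
    intro F hF
    induction hn : F.natDegree generalizing F with
    | zero =>
      obtain ⟨c, rfl⟩ := Polynomial.natDegree_eq_zero.mp hn
      rw [Polynomial.aeval_C] at hF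
      rw [show c = 0 from Subtype.ext hF, map_zero]
    | succ n ih =>
      have h1 : Polynomial.derivative F = 0 := by
        refine ih _ ?_ ?_
        · rw [← eval_slice_deriv hs, hF, map_zero]
        · rw [Polynomial.natDegree_derivative, hn]; rfl
      have h2 := Polynomial.derivative_eq_zero.mp h1
      omega
  · intro b
    obtain ⟨N, hN⟩ := h.exists_iterate_eq_zero b
    induction N generalizing b with
    | zero => exact ⟨0, by simpa using hN.symm⟩
    | succ N ih =>
      obtain ⟨F, hF⟩ := ih (D b) hN
      have h1 : D (b - Polynomial.aeval s (integ F)) = 0 := by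
        rw [map_sub, eval_slice_deriv hs, derivative_integ, hF, sub_self]
      refine ⟨integ F + Polynomial.C ⟨_, h1⟩, ?_⟩
      rw [map_add, Polynomial.aeval_C]
      simp

end Exp

section Noeth

theorem injective_of_surjective_endo {R : Type*} [CommRing R] [IsNoetherianRing R] (f : R →+* R)
    (hf : Function.Surjective f) : Function.Injective f := by
  have hmono : Monotone fun n : ℕ => RingHom.ker (f ^ n) := by
    refine monotone_nat_of_le_succ fun n x hx => ?_
    rw [RingHom.mem_ker] at hx ⊢
    rw [pow_succ', RingHom.mul_def, RingHom.comp_apply, hx, map_zero]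
  obtain ⟨n, hn⟩ := monotone_stabilizes_iff_noetherian.mpr ‹IsNoetherianRing R› ⟨_, hmono⟩
  have hn1 : RingHom.ker (f ^ n) = RingHom.ker (f ^ (n + 1)) := hn (n + 1) n.le_succ
  rw [injective_iff_map_eq_zero]
  intro x hx
  have hs : Function.Surjective (f ^ n) := by
    rw [RingHom.coe_pow]; exact hf.iterate n
  obtain ⟨y, rfl⟩ := hs x
  have : y ∈ RingHom.ker (f ^ (n + 1)) := by
    rw [RingHom.mem_ker, pow_succ', RingHom.mul_def, RingHom.comp_apply, hx]
  rwa [← hn1] at this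

end Noeth

section Der
variable {A : Type*} [CommRing A]

/-- The triangular derivation `y ↦ a`, `z ↦ q(y)`, `u ↦ p(y, z)` of `A[y, z, u]`. -/
noncomputable def der (a : A) (q : Polynomial A) (p : Polynomial (Polynomial A)) :
    Derivation A (MvPolynomial (Fin 3) A) (MvPolynomial (Fin 3) A) :=
  mkDerivation A ![C a, Polynomial.aeval (X 0) q, Polynomial.aevalAeval (X 0) (X 1) p]

variable (a : A) (q : Polynomial A) (p : Polynomial (Polynomial A))

@[simp] theorem der_X0 : der a q p (X 0) = C a := by simp [der]
@[simp] theorem der_X1 : der a q p (X 1) = Polynomial.aeval (X 0) q := by simp [der]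
@[simp] theorem der_X2 : der a q p (X 2) = Polynomial.aevalAeval (X 0) (X 1) p := by simp [der]

theorem algHom_aevalAeval {S T : Type*} [CommRing S] [CommRing T] [Algebra A S] [Algebra A T]
    (f : S →ₐ[A] T) (x y : S) (p : Polynomial (Polynomial A)) :
    f (Polynomial.aevalAeval x y p) = Polynomial.aevalAeval (f x) (f y) p := by
  have : f.comp (Polynomial.aevalAeval x y) = Polynomial.aevalAeval (f x) (f y) :=
    Polynomial.algHom_ext' (by ext; simp) (by simp)
  exact DFunLike.congr_fun this p

theorem derivation_eq_on_X {B : Type*} [CommRing B] {σ : Type*}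
    (D : Derivation A (MvPolynomial σ A) (MvPolynomial σ A)) (D' : B → B)
    (φ : MvPolynomial σ A →+* B) (hadd : ∀ x y, D' (x + y) = D' x + D' y)
    (hmul : ∀ x y, D' (x * y) = x * D' y + y * D' x) (hC : ∀ c, D' (φ (C c)) = 0)
    (hX : ∀ i, φ (D (X i)) = D' (φ (X i))) (b : MvPolynomial σ A) : φ (D b) = D' (φ b) := by
  induction b using MvPolynomial.induction_on with
  | C c => simp [hC]
  | add p q hp hq => simp [hp, hq, hadd]
  | mul_X p i hp => rw [D.leibniz, map_mul, hmul, ← hX, ← hp]; simp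

theorem map_der {A' : Type*} [CommRing A'] (f : A →+* A') (b : MvPolynomial (Fin 3) A) :
    map f (der a q p b) =
      der (f a) (q.map f) (p.map (Polynomial.mapRingHom f)) (map f b) := by
  refine derivation_eq_on_X _ _ (map f) (map_add _) (fun x y => ?_) ?_ ?_ b
  · rw [Derivation.leibniz]; simp
  · simp
  · intro i
    fin_cases i
    · simp
    · have : (map f).comp (Polynomial.aeval (X 0 : MvPolynomial (Fin 3) A) : _ →ₐ[A] _).toRingHom
        = (Polynomial.aeval (X 0 : MvPolynomial (Fin 3) A') : _ →ₐ[A'] _).toRingHom.comp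
          (Polynomial.mapRingHom f) := by
        ext <;> simp [algebraMap_eq]
      simpa using DFunLike.congr_fun this q
    · have : (map f).comp (Polynomial.aevalAeval (X 0 : MvPolynomial (Fin 3) A) (X 1)).toRingHom
        = (Polynomial.aevalAeval (X 0 : MvPolynomial (Fin 3) A') (X 1)).toRingHom.comp
          (Polynomial.mapRingHom (Polynomial.mapRingHom f)) := by
        ext <;> simp [algebraMap_eq]
      simpa using DFunLike.congr_fun this p

theorem der_mem (b : MvPolynomial (Fin 3) A) : der a q p b ∈ Ideal.span
    {C a, Polynomial.aeval (X 0) q, Polynomial.aevalAeval (X 0) (X 1) p} := by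
  induction b using MvPolynomial.induction_on with
  | C c => simp
  | add p q hp hq => rw [map_add]; exact add_mem hp hq
  | mul_X p i hp =>
    rw [Derivation.leibniz, smul_eq_mul, smul_eq_mul]
    refine add_mem (Ideal.mul_mem_left _ _ ?_) (Ideal.mul_mem_left _ _ hp)
    apply Ideal.subset_span
    fin_cases i <;> simp

variable [Algebra ℚ A]

/-- The exponential of `der a q p`. -/
noncomputable def expHom : MvPolynomial (Fin 3) A →ₐ[A] Polynomial (MvPolynomial (Fin 3) A) :=
  let EY : Polynomial (MvPolynomial (Fin 3) A) :=
    Polynomial.C (X 0) + Polynomial.C (C a) * Polynomial.X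
  let EZ : Polynomial (MvPolynomial (Fin 3) A) :=
    Polynomial.C (X 1) + integ (Polynomial.aeval EY q)
  aeval ![EY, EZ, Polynomial.C (X 2) + integ (Polynomial.aevalAeval EY EZ p)]

@[simp] theorem expHom_X0 : expHom a q p (X 0) =
    Polynomial.C (X 0) + Polynomial.C (C a) * Polynomial.X := by simp [expHom]
theorem expHom_X1 : expHom a q p (X 1) =
    Polynomial.C (X 1) + integ (Polynomial.aeval (expHom a q p (X 0)) q) := by simp [expHom]
theorem expHom_X2 : expHom a q p (X 2) = Polynomial.C (X 2) +
    integ (Polynomial.aevalAeval (expHom a q p (X 0)) (expHom a q p (X 1)) p) := by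
  simp [expHom]

theorem isExp_expHom : IsExp (der a q p) (expHom a q p) where
  deriv b := by
    refine (derivation_eq_on_X _ _ (expHom a q p :
      MvPolynomial (Fin 3) A →+* Polynomial (MvPolynomial (Fin 3) A)) (map_add _) (fun x y => ?_)
      ?_ ?_ b).symm
    · rw [Polynomial.derivative_mul]; ring
    · intro c
      have : (expHom a q p) (C c) = Polynomial.C (C c) := (expHom a q p).commutes c
      simp [this]
    · intro i
      fin_cases i
      · have : (expHom a q p) (C a) = Polynomial.C (C a) := (expHom a q p).commutes a
        simp [this]
      · simp only [Fin.mk_one, Fin.isValue, RingHom.coe_coe, der_X1, ← Polynomial.aeval_algHom_apply]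
        rw [expHom_X1, Polynomial.derivative_add, Polynomial.derivative_C, derivative_integ, zero_add]
      · simp only [Fin.reduceFinMk, RingHom.coe_coe, der_X2, algHom_aevalAeval]
        rw [expHom_X2, Polynomial.derivative_add, Polynomial.derivative_C, derivative_integ, zero_add]
  coeff_zero b := by
    have h1 : (Polynomial.constantCoeff.comp (expHom a q p :
      MvPolynomial (Fin 3) A →+* Polynomial (MvPolynomial (Fin 3) A))) = RingHom.id _ := by
      refine MvPolynomial.ringHom_ext (fun c => ?_) fun i => ?_
      · have : (expHom a q p) (C c) = Polynomial.C (C c) := (expHom a q p).commutes c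
        simp [this]
      · fin_cases i
        · simp
        · simp [expHom_X1, coeff_integ_zero]
        · simp [expHom_X2, coeff_integ_zero]
    exact DFunLike.congr_fun h1 b

end Der

section BaseChange
variable {A B A' B' : Type*} [CommRing A] [CommRing B] [Algebra A B] [CommRing A'] [CommRing B']
  [Algebra A' B'] [Algebra ℚ B] [Algebra ℚ B']
  {D : Derivation A B B} {E : B →ₐ[A] Polynomial B}
  {D' : Derivation A' B' B'} {E' : B' →ₐ[A'] Polynomial B'}

/-- The consequence of properness used below: `t` lies in the image of `Φ*`. -/
def HitsVar {B : Type*} [CommRing B] (E : B → Polynomial B) : Prop :=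
  ∃ (m : ℕ) (f g : Fin m → B), Polynomial.X = ∑ i, Polynomial.C (f i) * E (g i)

theorem IsExp.map (h : IsExp D E) (h' : IsExp D' E') (φ : B →+* B') (hφ : ∀ b, φ (D b) = D' (φ b))
    (b : B) : (E b).map φ = E' (φ b) := by
  ext n
  rw [Polynomial.coeff_map, h.coeff, h'.coeff, map_rat_smul,
    (show Function.Semiconj φ D D' from hφ).iterate_right n b]

theorem HitsVar.map (h : IsExp D E) (h' : IsExp D' E') (φ : B →+* B')
    (hφ : ∀ b, φ (D b) = D' (φ b)) (hE : HitsVar E) : HitsVar E' := by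
  obtain ⟨m, f, g, hX⟩ := hE
  refine ⟨m, fun i => φ (f i), fun i => φ (g i), ?_⟩
  have := congrArg (Polynomial.map φ) hX
  simpa [Polynomial.map_sum, h.map h' φ hφ] using this

theorem HitsVar.exists_sum_eq_one (h : IsExp D E) (hE : HitsVar E) :
    ∃ (m : ℕ) (f g : Fin m → B), 1 = ∑ i, f i * D (g i) := by
  obtain ⟨m, f, g, hX⟩ := hE
  refine ⟨m, f, g, ?_⟩
  have := congrArg (fun F => Polynomial.coeff F 1) hX
  simpa [Polynomial.finsetSum_coeff, h.coeff] using this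

theorem HitsVar.span_eq_top [Algebra ℚ A] (a : A) (q : Polynomial A) (p : Polynomial (Polynomial A))
    (hE : HitsVar (expHom a q p)) : (Ideal.span
    {C a, Polynomial.aeval (X 0) q, Polynomial.aevalAeval (X 0) (X 1) p} :
      Ideal (MvPolynomial (Fin 3) A)) = ⊤ := by
  obtain ⟨m, f, g, h⟩ := HitsVar.exists_sum_eq_one (isExp_expHom a q p) hE
  rw [Ideal.eq_top_iff_one, h]
  exact sum_mem fun i _ => Ideal.mul_mem_left _ _ (der_mem a q p _)

end BaseChange

section Criterion
variable {A : Type*} [CommRing A] [IsNoetherianRing A] [Algebra ℚ A]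
  {D : Derivation A (MvPolynomial (Fin 3) A) (MvPolynomial (Fin 3) A)}
  {E : MvPolynomial (Fin 3) A →ₐ[A] Polynomial (MvPolynomial (Fin 3) A)}

theorem aeval_bijective_of_kerDer_eq (h : IsExp D E)
    {s v w : MvPolynomial (Fin 3) A} (hs : D s = 1) (hvw : kerDer D = Algebra.adjoin A {v, w}) :
    Function.Bijective (aeval (R := A) ![v, w, s]) := by
  have hsurj : Function.Surjective (aeval (R := A) ![v, w, s]) := by
    intro b
    obtain ⟨F, rfl⟩ := (h.slice_bijective hs).2 b
    have hle : kerDer D ≤ (aeval (R := A) ![v, w, s]).range := by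
      rw [hvw, Algebra.adjoin_le_iff]
      rintro x (rfl | rfl)
      · exact ⟨X 0, by simp⟩
      · exact ⟨X 1, by simp⟩
    rw [← AlgHom.mem_range, Polynomial.aeval_eq_sum_range]
    refine sum_mem fun i _ => ?_
    rw [Algebra.smul_def]
    exact mul_mem (hle (F.coeff i).2) (pow_mem (AlgHom.mem_range _ |>.mpr ⟨X 2, by simp⟩) _)
  exact ⟨injective_of_surjective_endo (aeval (R := A) ![v, w, s]).toRingHom hsurj, hsurj⟩

theorem translation_of_kerDer_eq (h : IsExp D E)
    {s v w : MvPolynomial (Fin 3) A} (hs : D s = 1) (hvw : kerDer D = Algebra.adjoin A {v, w}) :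
    ∃ s : MvPolynomial (Fin 3) A, D s = 1 ∧
      Nonempty (↥(kerDer D) ≃ₐ[A] MvPolynomial (Fin 2) A) ∧
      Function.Bijective (Polynomial.aeval (R := ↥(kerDer D)) s) := by
  refine ⟨s, hs, ?_, h.slice_bijective hs⟩
  have hinj := (aeval_bijective_of_kerDer_eq h hs hvw).1
  let ρ : MvPolynomial (Fin 2) A →ₐ[A] MvPolynomial (Fin 3) A := aeval ![v, w]
  have hρ : ρ = (aeval (R := A) ![v, w, s]).comp (rename (Fin.castSucc : Fin 2 → Fin 3)) := by
    ext i : 1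
    fin_cases i <;> simp [ρ]
  have hρi : Function.Injective ρ := by
    rw [hρ]
    exact hinj.comp (rename_injective _ (Fin.castSucc_injective 2))
  have hr : ρ.range = kerDer D := by
    rw [hvw, ← Algebra.adjoin_range_eq_range_aeval]
    simp [Matrix.range_cons]
    rw [Set.pair_comm]
  exact ⟨((AlgEquiv.ofInjective ρ hρi).trans (Subalgebra.equivOfEq _ _ hr)).symm⟩

end Criterion

section CompInverse
variable {R : Type*} [CommRing R] [Algebra ℚ R]

theorem exists_comp_eq_X {f : Polynomial R} (hf : IsUnit (Polynomial.derivative f)) :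
    ∃ h : Polynomial R, f.comp h = Polynomial.X := by
  obtain ⟨h0, hn⟩ := Polynomial.isUnit_iff_coeff_isUnit_isNilpotent.mp hf
  obtain ⟨c, hc⟩ := h0
  have hc1 : f.coeff 1 = c := by rw [hc, Polynomial.coeff_derivative]; simp
  have hnil : IsNilpotent (f - Polynomial.C (f.coeff 0) - Polynomial.C (c : R) * Polynomial.X) := by
    rw [Polynomial.isNilpotent_iff]
    intro i
    rcases i with _ | _ | i
    · simp
    · simp [hc1]
    · have h1 := hn (i + 1) (by omega)
      rw [Polynomial.coeff_derivative] at h1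
      have h2 : IsUnit (((i + 1 : ℕ) : R) + 1) := by
        have := (IsUnit.mk0 ((i : ℚ) + 1 + 1) (by positivity)).map (algebraMap ℚ R)
        simpa using this
      obtain ⟨u, hu⟩ := h2
      have h3 : IsNilpotent (f.coeff (i + 1 + 1)) := by
        have := (Commute.all _ ((u⁻¹ : Rˣ) : R)).isNilpotent_mul_right h1
        rwa [← hu, mul_assoc, Units.mul_inv, mul_one] at this
      simpa [Polynomial.coeff_X, Polynomial.coeff_C] using h3
  let x : Polynomial R := Polynomial.C ((c⁻¹ : Rˣ) : R) * (Polynomial.X - Polynomial.C (f.coeff 0))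
  let P : Polynomial (Polynomial R) := f.map Polynomial.C - Polynomial.C Polynomial.X
  have hP : ∀ y : Polynomial R, Polynomial.aeval y P = f.comp y - Polynomial.X := by
    intro y
    simp [P, Polynomial.coe_aeval_eq_eval, Polynomial.comp, Polynomial.eval_map]
  have hP' : Polynomial.aeval x (Polynomial.derivative P) = (Polynomial.derivative f).comp x := by
    simp [P, Polynomial.coe_aeval_eq_eval, Polynomial.comp, Polynomial.eval_map,
      Polynomial.derivative_map]
  obtain ⟨r, ⟨-, hr⟩, -⟩ := Polynomial.existsUnique_nilpotent_sub_and_aeval_eq_zero (x := x) (P := P)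
    (by
      have := hnil.map (Polynomial.compRingHom x)
      rw [hP]
      convert this using 1
      simp only [Polynomial.coe_compRingHom_apply, Polynomial.sub_comp, Polynomial.mul_comp,
        Polynomial.C_comp, Polynomial.X_comp]
      have : Polynomial.C (c : R) * x = Polynomial.X - Polynomial.C (f.coeff 0) := by
        simp only [x]
        rw [← mul_assoc, ← Polynomial.C_mul, Units.mul_inv, Polynomial.C_1, one_mul]
      rw [this]; ring)
    (by rw [hP']; exact hf.map (Polynomial.compRingHom x))
  exact ⟨r, sub_eq_zero.mp ((hP r).symm.trans hr)⟩

theorem exists_comp_inverse {f : Polynomial R} (hf : IsUnit (Polynomial.derivative f)) :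
    ∃ h : Polynomial R, f.comp h = Polynomial.X ∧ h.comp f = Polynomial.X := by
  obtain ⟨h, hh⟩ := exists_comp_eq_X hf
  have hu : IsUnit (Polynomial.derivative h) := by
    have := congrArg Polynomial.derivative hh
    rw [Polynomial.derivative_comp, Polynomial.derivative_X] at this
    exact IsUnit.of_mul_eq_one _ this
  obtain ⟨g, hg⟩ := exists_comp_eq_X hu
  have : f = g := by
    have := congrArg f.comp hg
    rwa [Polynomial.comp_X, ← Polynomial.comp_assoc, hh, Polynomial.X_comp, eq_comm] at this
  exact ⟨h, hh, this ▸ hg⟩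

theorem exists_comp_inverse_mod (q : R) {f : Polynomial R}
    (hf : Ideal.span {Polynomial.C q, Polynomial.derivative f} = ⊤) :
    ∃ h : Polynomial R, Polynomial.C q ∣ f.comp h - Polynomial.X ∧
      Polynomial.C q ∣ h.comp f - Polynomial.X := by
  let π := Ideal.Quotient.mk (Ideal.span {q})
  have hdvd : ∀ g : Polynomial R, g.map π = 0 → Polynomial.C q ∣ g := by
    intro g hg
    rw [Polynomial.C_dvd_iff_dvd_coeff]
    intro i
    have := congrArg (fun f => Polynomial.coeff f i) hg
    simp only [Polynomial.coeff_map, Polynomial.coeff_zero] at this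
    rwa [Ideal.Quotient.eq_zero_iff_mem, Ideal.mem_span_singleton] at this
  have hu : IsUnit (Polynomial.derivative (f.map π)) := by
    rw [Ideal.eq_top_iff_one, Ideal.mem_span_pair] at hf
    obtain ⟨a, b, hab⟩ := hf
    have hq : π q = 0 := Ideal.Quotient.eq_zero_iff_mem.mpr (Ideal.mem_span_singleton_self q)
    have := congrArg (Polynomial.map π) hab
    simp only [Polynomial.map_add, Polynomial.map_mul, Polynomial.map_C, hq, map_zero, mul_zero,
      zero_add, Polynomial.map_one] at this
    rw [Polynomial.derivative_map]
    exact IsUnit.of_mul_eq_one_right _ this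
  obtain ⟨h, h1, h2⟩ := exists_comp_inverse hu
  obtain ⟨h, rfl⟩ := Polynomial.map_surjective π Ideal.Quotient.mk_surjective h
  exact ⟨h, hdvd _ (by rw [Polynomial.map_sub, Polynomial.map_comp, h1, Polynomial.map_X, sub_self]),
    hdvd _ (by rw [Polynomial.map_sub, Polynomial.map_comp, h2, Polynomial.map_X, sub_self])⟩

end CompInverse

section Base
variable {A : Type*} [CommRing A] [IsDomain A] [Algebra ℚ A]

theorem kerDer_eq_adjoin {D : Derivation A (MvPolynomial (Fin 3) A) (MvPolynomial (Fin 3) A)}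
    {E : MvPolynomial (Fin 3) A →ₐ[A] Polynomial (MvPolynomial (Fin 3) A)} (h : IsExp D E)
    {v w s : MvPolynomial (Fin 3) A} (hv : D v = 0) (hw : D w = 0) (hs : D s = 1)
    (htop : Algebra.adjoin A {v, w, s} = ⊤) : kerDer D = Algebra.adjoin A {v, w} := by
  have hss : dixmier E s s = 0 := by
    have := h.coeff 1 s
    rw [dixmier_apply]
    have hE : E s = Polynomial.C s + Polynomial.X := by
      ext n
      rw [h.coeff]
      rcases n with _ | _ | n
      · simp
      · simp [hs]
      · have : D^[n + 1 + 1] s = 0 := by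
          rw [Function.iterate_succ_apply, hs, Function.iterate_succ_apply, Derivation.map_one_eq_zero]
          exact iterate_map_zero D n
        simp [this, Polynomial.coeff_X]
    rw [hE]; simp
  rw [← h.range_dixmier hs, ← Algebra.map_top, ← htop, AlgHom.map_adjoin]
  simp only [Set.image_insert_eq, Set.image_singleton, h.dixmier_of_mem s hv,
    h.dixmier_of_mem s hw, hss]
  refine le_antisymm (Algebra.adjoin_le ?_) (Algebra.adjoin_mono (by intro x; simp; tauto))
  rintro x (rfl | rfl | rfl)
  · exact Algebra.subset_adjoin (by simp)
  · exact Algebra.subset_adjoin (by simp)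
  · exact zero_mem _

theorem eq_top_of_X_mem {S : Subalgebra A (MvPolynomial (Fin 3) A)} (h0 : X 0 ∈ S) (h1 : X 1 ∈ S)
    (h2 : X 2 ∈ S) : S = ⊤ := by
  rw [← top_le_iff, ← MvPolynomial.adjoin_range_X, Algebra.adjoin_le_iff]
  rintro _ ⟨i, rfl⟩
  fin_cases i <;> assumption

theorem aevalAeval_mem {B : Type*} [CommRing B] [Algebra A B] {S : Subalgebra A B} {x y : B}
    (hx : x ∈ S) (hy : y ∈ S) (p : Polynomial (Polynomial A)) : Polynomial.aevalAeval x y p ∈ S := by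
  have := algHom_aevalAeval S.val ⟨x, hx⟩ ⟨y, hy⟩ p
  simp only [Subalgebra.coe_val] at this
  rw [← this]; exact Subtype.property _

theorem aevalAeval_comp {B : Type*} [CommRing B] [Algebra A B] (x y : B)
    (f g : Polynomial (Polynomial A)) : Polynomial.aevalAeval x y (f.comp g) =
      Polynomial.aevalAeval x (Polynomial.aevalAeval x y g) f := by
  induction f using Polynomial.induction_on' with
  | add p q hp hq => rw [Polynomial.add_comp, map_add, map_add, hp, hq]
  | monomial n c => simp [Polynomial.monomial_comp]

theorem sub_dvd_aevalAeval_sub {B : Type*} [CommRing B] [Algebra A B] (x y y' : B)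
    (f : Polynomial (Polynomial A)) :
    y - y' ∣ Polynomial.aevalAeval x y f - Polynomial.aevalAeval x y' f := by
  induction f using Polynomial.induction_on' with
  | add p q hp hq =>
    rw [map_add, map_add, add_sub_add_comm]; exact dvd_add hp hq
  | monomial n c =>
    simpa [← mul_sub] using (sub_dvd_pow_sub_pow y y' n).mul_left (Polynomial.aeval x c)

theorem derivation_aeval {B : Type*} [CommRing B] [Algebra A B] (D : Derivation A B B) (x : B)
    (f : Polynomial A) :
    D (Polynomial.aeval x f) = Polynomial.aeval x (Polynomial.derivative f) * D x := by
  induction f using Polynomial.induction_on' with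
  | add p q hp hq => simp [hp, hq, add_mul]
  | monomial n c =>
    simp [Polynomial.derivative_monomial, Polynomial.aeval_monomial, D.leibniz_pow, D.leibniz]; ring

theorem derivation_aevalAeval {B : Type*} [CommRing B] [Algebra A B] (D : Derivation A B B)
    {x : B} (hx : D x = 0) (y : B) (f : Polynomial (Polynomial A)) :
    D (Polynomial.aevalAeval x y f) =
      Polynomial.aevalAeval x y (Polynomial.derivative f) * D y := by
  induction f using Polynomial.induction_on' with
  | add p q hp hq => simp only [map_add, hp, hq, add_mul]
  | monomial n c =>
    simp [Polynomial.derivative_monomial, D.leibniz_pow, D.leibniz, hx]; ring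

theorem exists_slice_of_zero (q : Polynomial A) (p : Polynomial (Polynomial A))
    (hqp : (Ideal.span {C 0, Polynomial.aeval (X 0) q, Polynomial.aevalAeval (X 0) (X 1) p} :
      Ideal (MvPolynomial (Fin 3) A)) = ⊤) :
    ∃ P s, der 0 q p s = 1 ∧ kerDer (der 0 q p) = Algebra.adjoin A {X 0, P} ∧
      Algebra.adjoin A {X 0, P, s} = ⊤ := by
  suffices H : ∃ P s, der 0 q p P = 0 ∧ der 0 q p s = 1 ∧ Algebra.adjoin A {X 0, P, s} = ⊤ by
    obtain ⟨P, s, h1, h2, h3⟩ := H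
    exact ⟨P, s, h2, kerDer_eq_adjoin (isExp_expHom 0 q p) (by simp) h1 h2 h3, h3⟩
  have hqp' : Ideal.span {Polynomial.C q, p} = ⊤ := by
    let θ : MvPolynomial (Fin 3) A →ₐ[A] Polynomial (Polynomial A) :=
      aeval ![Polynomial.C Polynomial.X, Polynomial.X, 0]
    have h := congrArg (Ideal.map θ) hqp
    rw [Ideal.map_top, Ideal.map_span] at h
    have e1 : θ (Polynomial.aeval (X 0) q) = Polynomial.C q := by
      rw [← Polynomial.aeval_algHom_apply]
      simp only [θ, aeval_X]
      exact DFunLike.congr_fun (show Polynomial.aeval (Polynomial.C Polynomial.X) =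
        (Polynomial.CAlgHom : Polynomial A →ₐ[A] Polynomial (Polynomial A)) by ext; simp) q
    have e2 : θ (Polynomial.aevalAeval (X 0) (X 1) p) = p := by
      rw [algHom_aevalAeval]
      simp only [θ, aeval_X]
      exact DFunLike.congr_fun (show Polynomial.aevalAeval (Polynomial.C Polynomial.X : Polynomial (Polynomial A))
        Polynomial.X = AlgHom.id A (Polynomial (Polynomial A)) from
        Polynomial.algHom_ext' (by ext; simp) (by simp)) p
    rw [Set.image_insert_eq, Set.image_insert_eq, Set.image_singleton, e1, e2] at h
    simpa [Ideal.span_insert_zero] using h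
  set S := fun P s => (Algebra.adjoin A {X 0, P, s} : Subalgebra A (MvPolynomial (Fin 3) A))
  have m0 : ∀ P s, X 0 ∈ S P s := fun P s => Algebra.subset_adjoin (by simp)
  have m1 : ∀ P s, P ∈ S P s := fun P s => Algebra.subset_adjoin (by simp)
  have m2 : ∀ P s, s ∈ S P s := fun P s => Algebra.subset_adjoin (by simp)
  by_cases hq : q = 0
  · subst hq
    have hp : IsUnit p := by simpa [Ideal.span_insert_zero] using hqp'
    obtain ⟨p', hp', rfl⟩ := Polynomial.isUnit_iff.mp hp
    obtain ⟨c, hc, rfl⟩ := Polynomial.isUnit_iff.mp hp'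
    obtain ⟨c, rfl⟩ := hc
    refine ⟨X 1, C ((c⁻¹ : Aˣ) : A) * X 2, by simp, ?_, eq_top_of_X_mem (m0 _ _) (m1 _ _) ?_⟩
    · rw [Derivation.leibniz]
      simp [algebraMap_eq, ← C_mul]
    · have h2 : (X 2 : MvPolynomial (Fin 3) A) = (c : A) • (C ((c⁻¹ : Aˣ) : A) * X 2) := by
        rw [smul_eq_C_mul, ← mul_assoc, ← C_mul, Units.mul_inv, C_1, one_mul]
      have := Subalgebra.smul_mem _ (m2 (X 1) (C ((c⁻¹ : Aˣ) : A) * X 2)) (c : A)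
      rwa [← h2] at this
  · set y : MvPolynomial (Fin 3) A := X 0 with hy
    set qy := Polynomial.aeval y q with hqy
    have hqy0 : qy ≠ 0 := by
      intro h0
      apply hq
      have hinj := transcendental_iff_injective.mp (transcendental_X (R := A) (0 : Fin 3))
      exact hinj (by simpa using h0)
    set z : MvPolynomial (Fin 3) A := X 1 with hz
    obtain ⟨h, ⟨e, he⟩, ⟨e', he'⟩⟩ := exists_comp_inverse_mod q (f := integ p)
      (by rwa [derivative_integ])
    rw [sub_eq_iff_eq_add] at he he'
    have hevC : ∀ x, Polynomial.aevalAeval y x (Polynomial.C q) = qy := fun x =>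
      Polynomial.aevalAeval_C _ _ _
    set P := Polynomial.aevalAeval y z (integ p) - qy * X 2 with hP
    have hDP : der 0 q p P = 0 := by
      rw [hP, map_sub, derivation_aevalAeval _ (by simp [hy]), derivative_integ, Derivation.leibniz,
        hqy, derivation_aeval, hz, hy, der_X1, der_X0, der_X2]
      simp [mul_comm]
    obtain ⟨d1, hd1⟩ := sub_dvd_aevalAeval_sub y P (Polynomial.aevalAeval y z (integ p)) h
    rw [← aevalAeval_comp, he', map_add, map_mul, hevC, Polynomial.aevalAeval_Y] at hd1
    obtain ⟨s, hs⟩ : ∃ s, z = Polynomial.aevalAeval y P h + qy * s :=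
      ⟨X 2 * d1 - Polynomial.aevalAeval y z e', by linear_combination (-1 : MvPolynomial (Fin 3) A) * hd1 + d1 * hP⟩
    have hPh : Polynomial.aevalAeval y P h ∈ S P s := aevalAeval_mem (m0 _ _) (m1 _ _) h
    have hqS : qy ∈ S P s := by simpa [hevC] using aevalAeval_mem (m0 P s) (m1 P s) (Polynomial.C q)
    have hzS : z ∈ S P s := by
      rw [hs]; exact add_mem hPh (mul_mem hqS (m2 _ _))
    refine ⟨P, s, hDP, ?_, eq_top_of_X_mem (m0 _ _) hzS ?_⟩
    · have := congrArg (der 0 q p) hs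
      rw [map_add, derivation_aevalAeval _ (by simp [hy]), hDP, Derivation.leibniz, hqy,
        derivation_aeval, hz, hy, der_X1, der_X0, C_0] at this
      simp only [mul_zero, zero_add, smul_eq_mul, add_zero] at this
      exact mul_left_cancel₀ hqy0 (by rw [← this, hqy, mul_one])
    · obtain ⟨d2, hd2⟩ := sub_dvd_aevalAeval_sub (B := S P s) ⟨y, m0 _ _⟩ ⟨z, hzS⟩ ⟨_, hPh⟩ (integ p)
      have hd3 := congrArg (S P s).val hd2
      simp only [map_sub, map_mul, algHom_aevalAeval, Subalgebra.coe_val] at hd3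
      rw [← aevalAeval_comp, he, map_add, map_mul, hevC, Polynomial.aevalAeval_Y] at hd3
      have : X 2 = Polynomial.aevalAeval y P e + s * (d2 : MvPolynomial (Fin 3) A) :=
        mul_left_cancel₀ hqy0 (by linear_combination hd3 + hP + (d2 : MvPolynomial (Fin 3) A) * hs)
      rw [this]
      exact add_mem (aevalAeval_mem (m0 _ _) (m1 _ _) _) (mul_mem (m2 _ _) d2.2)

end Base

section Run
variable {K : Type*} [Field K] {R : Type*} [CommRing R] [Algebra K R]

/-- Elementary transformation of a pair, with parameter scaled by `ω`. -/
noncomputable def elemStep (ω : R) (b : R × R) (e : Bool × Polynomial K) : R × R :=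
  if e.1 then (b.1 + ω * Polynomial.aeval b.2 e.2, b.2)
  else (b.1, b.2 + ω * Polynomial.aeval b.1 e.2)

/-- Composition of elementary transformations. -/
noncomputable def run (ω : R) (l : List (Bool × Polynomial K)) (b : R × R) : R × R :=
  l.foldl (elemStep ω) b

theorem run_nil (ω : R) (b : R × R) : run (K := K) ω [] b = b := rfl

theorem run_cons (ω : R) (e : Bool × Polynomial K) (l : List (Bool × Polynomial K)) (b : R × R) :
    run ω (e :: l) b = run ω l (elemStep ω b e) := rfl

theorem run_append (ω : R) (l l' : List (Bool × Polynomial K)) (b : R × R) :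
    run ω (l ++ l') b = run ω l' (run ω l b) := List.foldl_append ..

theorem run_map {R' : Type*} [CommRing R'] [Algebra K R'] (f : R →ₐ[K] R') (ω : R)
    (l : List (Bool × Polynomial K)) (b : R × R) :
    run (f ω) l (Prod.map f f b) = Prod.map f f (run ω l b) := by
  induction l generalizing b with
  | nil => rfl
  | cons e l ih =>
    rw [run_cons, run_cons, ← ih]
    congr 1
    unfold elemStep
    split_ifs <;> simp [← Polynomial.aeval_algHom_apply]

/-- Inverse list of elementary transformations. -/
noncomputable def invList (l : List (Bool × Polynomial K)) : List (Bool × Polynomial K) :=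
  (l.map fun e => (e.1, -e.2)).reverse

theorem run_invList (l : List (Bool × Polynomial K)) (b : R × R) :
    run 1 (invList l) (run 1 l b) = b := by
  induction l generalizing b with
  | nil => rfl
  | cons e l ih =>
    have : invList (e :: l) = invList l ++ [(e.1, -e.2)] := by simp [invList]
    rw [this, run_append]
    change elemStep 1 (run 1 (invList l) (run 1 l (elemStep 1 b e))) (e.1, -e.2) = b
    rw [ih]
    unfold elemStep
    split_ifs <;> simp

theorem adjoin_run (l : List (Bool × Polynomial K)) (b : R × R) :
    Algebra.adjoin K {(run 1 l b).1, (run 1 l b).2} = Algebra.adjoin K {b.1, b.2} := by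
  suffices H : ∀ (l : List (Bool × Polynomial K)) (b : R × R),
      Algebra.adjoin K {(run 1 l b).1, (run 1 l b).2} ≤ Algebra.adjoin K {b.1, b.2} by
    refine le_antisymm (H l b) ?_
    have := H (invList l) (run 1 l b)
    rwa [run_invList] at this
  intro l
  induction l with
  | nil => intro b; exact le_rfl
  | cons e l ih =>
    intro b
    rw [run_cons]
    refine (ih _).trans (Algebra.adjoin_le ?_)
    have m1 : b.1 ∈ Algebra.adjoin K {b.1, b.2} := Algebra.subset_adjoin (by simp)
    have m2 : b.2 ∈ Algebra.adjoin K {b.1, b.2} := Algebra.subset_adjoin (by simp)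
    have ma : ∀ x ∈ Algebra.adjoin K {b.1, b.2}, ∀ f : Polynomial K,
        Polynomial.aeval x f ∈ Algebra.adjoin K {b.1, b.2} := fun x hx f => by
      have := Polynomial.aeval_algHom_apply (Algebra.adjoin K {b.1, b.2}).val ⟨x, hx⟩ f
      simp only [Subalgebra.coe_val] at this
      rw [this]; exact Subtype.property _
    rintro x hx
    unfold elemStep at hx
    split_ifs at hx
    all_goals
      rcases hx with rfl | rfl
      all_goals simp only [one_mul]
      all_goals first | exact m1 | exact m2 | exact add_mem m1 (ma _ m2 _) | exact add_mem m2 (ma _ m1 _)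

/-- `p` is obtained from `b` by elementary transformations. -/
def Tame (K : Type*) [Field K] {R : Type*} [CommRing R] [Algebra K R] (b p : R × R) : Prop :=
  ∃ l : List (Bool × Polynomial K), run 1 l b = p

theorem Tame.refl (b : R × R) : Tame K b b := ⟨[], rfl⟩

theorem Tame.left {b p : R × R} (h : Tame K b p) (f : Polynomial K) :
    Tame K b (p.1 + Polynomial.aeval p.2 f, p.2) := by
  obtain ⟨l, rfl⟩ := h
  exact ⟨l ++ [(true, f)], by simp [run_append, run_cons, run_nil, elemStep]⟩

theorem Tame.right {b p : R × R} (h : Tame K b p) (f : Polynomial K) :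
    Tame K b (p.1, p.2 + Polynomial.aeval p.1 f) := by
  obtain ⟨l, rfl⟩ := h
  exact ⟨l ++ [(false, f)], by simp [run_append, run_cons, run_nil, elemStep]⟩

theorem Tame.whitehead {b p : R × R} (h : Tame K b p) {t : K} (ht : t ≠ 0) :
    Tame K b (t • p.2, -(t⁻¹ • p.1)) := by
  have h1 := ((h.left (Polynomial.C t * Polynomial.X)).right
    (Polynomial.C (-t⁻¹) * Polynomial.X)).left (Polynomial.C t * Polynomial.X)
  have hc : algebraMap K R t * algebraMap K R t⁻¹ = 1 := by rw [← map_mul]; simp [ht]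
  convert h1 using 2
  · simp only [Algebra.smul_def, map_mul, map_neg, Polynomial.aeval_C, Polynomial.aeval_X]
    linear_combination (p.1 + algebraMap K R t * p.2) * hc
  · simp only [Algebra.smul_def, map_mul, map_neg, Polynomial.aeval_C, Polynomial.aeval_X]
    linear_combination (p.2) * hc

theorem Tame.swap {b p : R × R} (h : Tame K b p) : Tame K b (p.2, -p.1) := by
  simpa using h.whitehead (one_ne_zero (α := K))

theorem Tame.diag {b p : R × R} (h : Tame K b p) {t : K} (ht : t ≠ 0) :
    Tame K b (t • p.1, t⁻¹ • p.2) := by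
  have := (h.whitehead (inv_ne_zero ht)).whitehead (t := -1) (by simp)
  convert this using 2
  · simp
  · simp [inv_neg]

theorem Tame.adjoin_eq {b p : R × R} (h : Tame K b p) :
    Algebra.adjoin K {p.1, p.2} = Algebra.adjoin K {b.1, b.2} := by
  obtain ⟨l, rfl⟩ := h
  exact adjoin_run l b

end Run

section AlgInd
variable {k : Type*} [CommRing k] {R : Type*} [CommRing R] [Algebra k R]

theorem algInd_comp {v w : R} (h : AlgebraicIndependent k ![v, w]) {V W : MvPolynomial (Fin 2) k}
    (hVW : AlgebraicIndependent k ![V, W]) :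
    AlgebraicIndependent k ![aeval ![v, w] V, aeval ![v, w] W] := by
  rw [algebraicIndependent_iff_injective_aeval] at *
  have : aeval ![aeval ![v, w] V, aeval ![v, w] W] = (aeval (R := k) ![v, w]).comp (aeval ![V, W]) := by
    ext i : 1
    fin_cases i <;> simp
  rw [this]
  exact h.comp hVW

theorem algInd_of_comp {v w : R} {V W : MvPolynomial (Fin 2) k} {f : R →ₐ[k] MvPolynomial (Fin 2) k}
    (hv : f v = V) (hw : f w = W) (h : AlgebraicIndependent k ![V, W]) :
    AlgebraicIndependent k ![v, w] := by
  rw [algebraicIndependent_iff_injective_aeval] at *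
  have : aeval ![V, W] = f.comp (aeval (R := k) ![v, w]) := by
    ext i : 1
    fin_cases i <;> simp [hv, hw]
  rw [this] at h
  exact Function.Injective.of_comp h

theorem algInd_X : AlgebraicIndependent k ![(X 0 : MvPolynomial (Fin 2) k), X 1] := by
  convert algebraicIndependent_X (Fin 2) k using 1
  funext i; fin_cases i <;> rfl

theorem algInd_left {v w : R} (h : AlgebraicIndependent k ![v, w]) (f : Polynomial k) :
    AlgebraicIndependent k ![v + Polynomial.aeval w f, w] := by
  have := algInd_comp h (V := X 0 + Polynomial.aeval (X 1) f) (W := X 1)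
    (algInd_of_comp (f := aeval ![X 0 - Polynomial.aeval (X 1) f, X 1])
      (by rw [map_add, ← Polynomial.aeval_algHom_apply]; simp) (by simp) algInd_X)
  rw [map_add, ← Polynomial.aeval_algHom_apply] at this
  simpa using this

theorem algInd_swap {v w : R} (h : AlgebraicIndependent k ![v, w]) :
    AlgebraicIndependent k ![w, v] := by
  have := algInd_comp h (V := X 1) (W := X 0)
    (algInd_of_comp (f := aeval ![X 1, X 0]) (by simp) (by simp) algInd_X)
  simpa using this

theorem algInd_smul {v w : R} (h : AlgebraicIndependent k ![v, w]) (c : kˣ) :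
    AlgebraicIndependent k ![v, (c : k) • w] := by
  have := algInd_comp h (V := X 0) (W := (c : k) • X 1)
    (algInd_of_comp (f := aeval ![X 0, ((c⁻¹ : kˣ) : k) • X 1]) (by simp)
      (by simp [smul_smul]) algInd_X)
  simpa using this

theorem mem_adjoin_pair_iff {v w r : R} :
    r ∈ Algebra.adjoin k {v, w} ↔ ∃ H : MvPolynomial (Fin 2) k, aeval ![v, w] H = r := by
  have : ({v, w} : Set R) = Set.range ![v, w] := by
    ext x; simp [Matrix.range_cons, or_comm, eq_comm]
  rw [this, Algebra.adjoin_range_eq_range_aeval, AlgHom.mem_range]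

end AlgInd

section MapAeval
variable {O : Type*} [CommRing O]

theorem map_aeval_map {O' : Type*} [CommRing O'] (f : O →+* O') {σ τ : Type*}
    (v : τ → MvPolynomial σ O) (H : MvPolynomial τ O) :
    MvPolynomial.map f (aeval v H) = aeval (fun i => MvPolynomial.map f (v i)) (MvPolynomial.map f H) := by
  exact MvPolynomial.map_eval₂ f v H

theorem map_aeval_pair {O' : Type*} [CommRing O'] (f : O →+* O') {σ : Type*}
    (v w : MvPolynomial σ O) (H : MvPolynomial (Fin 2) O) :
    MvPolynomial.map f (aeval ![v, w] H) =
      aeval ![MvPolynomial.map f v, MvPolynomial.map f w] (MvPolynomial.map f H) := by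
  rw [map_aeval_map]
  congr 2
  funext i; fin_cases i <;> rfl

theorem map_polynomial_aeval {O' : Type*} [CommRing O'] (f : O →+* O') {σ : Type*}
    (v : MvPolynomial σ O) (F : Polynomial O) :
    MvPolynomial.map f (Polynomial.aeval v F) =
      Polynomial.aeval (MvPolynomial.map f v) (F.map f) := by
  rw [Polynomial.aeval_def, Polynomial.aeval_def, Polynomial.hom_eval₂, Polynomial.eval₂_map]
  congr 1
  ext r
  simp [algebraMap_eq]

end MapAeval

section Localization
variable {A : Type*} [CommRing A] (M : Submonoid A) {S : Type*} [CommRing S] [Algebra A S]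
  [IsLocalization M S]

theorem exists_map_eq_C_mul {σ : Type*} (H : MvPolynomial σ S) :
    ∃ c ∈ M, ∃ H' : MvPolynomial σ A, H'.map (algebraMap A S) = C (algebraMap A S c) * H := by
  let := algebraMvPolynomial (R := A) (S := S) (σ := σ)
  obtain ⟨⟨H', c⟩, h⟩ := IsLocalization.surj (M.map (C (σ := σ))) H
  obtain ⟨c', hc', hcc⟩ := c.2
  refine ⟨c', hc', H', ?_⟩
  rw [MvPolynomial.algebraMap_def] at h
  simp only at h
  rw [← h, ← hcc, MvPolynomial.map_C, mul_comm]

theorem exists_polynomial_map_eq_C_mul (H : Polynomial S) :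
    ∃ c ∈ M, ∃ H' : Polynomial A, H'.map (algebraMap A S) =
      Polynomial.C (algebraMap A S c) * H := by
  obtain ⟨c, hc, h⟩ := IsLocalization.integerNormalization_spec M H
  exact ⟨c, hc, _, by rw [h, ← Polynomial.smul_eq_C_mul, algebraMap_smul]⟩

end Localization

section DVR
variable {O : Type*} [CommRing O] [IsDomain O] [IsDiscreteValuationRing O]
  {K : Type*} [Field K] [Algebra O K] [IsFractionRing O K]

open IsLocalRing

theorem residue_eq_zero_iff_dvd {x : O} (hx : Irreducible x) (r : O) :
    residue O r = 0 ↔ x ∣ r := by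
  rw [residue_eq_zero_iff, hx.maximalIdeal_eq, Ideal.mem_span_singleton]

theorem C_dvd_of_map_residue_eq_zero {σ : Type*} {x : O} (hx : Irreducible x) {f : MvPolynomial σ O}
    (hf : f.map (residue O) = 0) : C x ∣ f :=
  (C_dvd_iff_map_hom_eq_zero (residue O) x (residue_eq_zero_iff_dvd hx) f).2 hf

theorem map_algebraMap_injective {σ : Type*} :
    Function.Injective (MvPolynomial.map (σ := σ) (algebraMap O K)) :=
  MvPolynomial.map_injective _ (IsFractionRing.injective O K)

/-- Elements integral over `O` in an algebra generated by elements with independent reductions. -/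
theorem mem_adjoin_of_map_mem {σ : Type*} {v w r : MvPolynomial σ O}
    (h : AlgebraicIndependent (ResidueField O) ![v.map (residue O), w.map (residue O)])
    (hr : r.map (algebraMap O K) ∈
      Algebra.adjoin K {v.map (algebraMap O K), w.map (algebraMap O K)}) :
    r ∈ Algebra.adjoin O {v, w} := by
  rw [mem_adjoin_pair_iff] at hr ⊢
  obtain ⟨H, hH⟩ := hr
  obtain ⟨c, hc, H', hH'⟩ := exists_map_eq_C_mul (nonZeroDivisors O) H
  obtain ⟨x, hx⟩ := IsDiscreteValuationRing.exists_irreducible O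
  have e : C c * r = aeval ![v, w] H' := by
    apply map_algebraMap_injective (K := K)
    rw [map_aeval_pair, hH', map_mul, map_C, ← hH, map_mul, aeval_C, algebraMap_eq]
  clear hH hH' H
  obtain ⟨n, u, rfl⟩ := IsDiscreteValuationRing.eq_unit_mul_pow_irreducible
    (nonZeroDivisors.ne_zero hc) hx
  clear hc
  have e' : C (x ^ n) * r = aeval ![v, w] (C (↑u⁻¹ : O) * H') := by
    rw [map_mul, aeval_C, ← e, algebraMap_eq, ← mul_assoc, ← C_mul, ← mul_assoc]
    simp
  clear e
  generalize C (↑u⁻¹ : O) * H' = H at e'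
  induction n generalizing H with
  | zero => exact ⟨H, by simpa using e'.symm⟩
  | succ n ih =>
    have h0 : H.map (residue O) = 0 := by
      rw [algebraicIndependent_iff] at h
      apply h
      rw [← map_aeval_pair, ← e', map_mul, map_C, map_pow,
        (residue_eq_zero_iff_dvd hx x).2 dvd_rfl]
      simp
    obtain ⟨H1, rfl⟩ := C_dvd_of_map_residue_eq_zero hx h0
    refine ih H1 ?_
    rw [map_mul, aeval_C, algebraMap_eq, pow_succ', C_mul, mul_assoc] at e'
    exact mul_left_cancel₀ (by simpa using hx.ne_zero) e'

variable (O) in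
/-- The pair has coefficients in `O`, with algebraically independent reductions. -/
def Good (b : MvPolynomial (Fin 3) K × MvPolynomial (Fin 3) K) : Prop :=
  ∃ v w : MvPolynomial (Fin 3) O, v.map (algebraMap O K) = b.1 ∧ w.map (algebraMap O K) = b.2 ∧
    AlgebraicIndependent (ResidueField O) ![v.map (residue O), w.map (residue O)]

theorem Good.elemStep {b : MvPolynomial (Fin 3) K × MvPolynomial (Fin 3) K} (h : Good O b)
    (i : Bool) (F : Polynomial O) : Good O (elemStep 1 b (i, F.map (algebraMap O K))) := by
  obtain ⟨v, w, hv, hw, hvw⟩ := h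
  unfold TriAction.elemStep
  split_ifs
  · refine ⟨v + Polynomial.aeval w F, w, ?_, hw, ?_⟩
    · rw [map_add, hv, map_polynomial_aeval, hw, one_mul]
    · rw [map_add, map_polynomial_aeval]
      exact algInd_left hvw _
  · refine ⟨v, w + Polynomial.aeval v F, hv, ?_, ?_⟩
    · rw [map_add, hw, map_polynomial_aeval, hv, one_mul]
    · rw [map_add, map_polynomial_aeval]
      exact algInd_swap (algInd_left (algInd_swap hvw) _)

theorem Good.run {b : MvPolynomial (Fin 3) K × MvPolynomial (Fin 3) K} (h : Good O b)
    (l : List (Bool × Polynomial K))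
    (hl : ∀ e ∈ l, ∃ F : Polynomial O, F.map (algebraMap O K) = e.2) : Good O (run 1 l b) := by
  induction l generalizing b with
  | nil => exact h
  | cons e l ih =>
    obtain ⟨F, hF⟩ := hl e (by simp)
    exact ih (by simpa [hF] using h.elemStep e.1 F) fun e' he' => hl e' (by simp [he'])

theorem Good.perturb {b b' : MvPolynomial (Fin 3) K × MvPolynomial (Fin 3) K} (h : Good O b)
    {x : O} (hx : Irreducible x) {r₁ r₂ : MvPolynomial (Fin 3) O}
    (h₁ : b'.1 = b.1 + (C x * r₁).map (algebraMap O K))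
    (h₂ : b'.2 = b.2 + (C x * r₂).map (algebraMap O K)) : Good O b' := by
  obtain ⟨v, w, hv, hw, hvw⟩ := h
  refine ⟨v + C x * r₁, w + C x * r₂, by rw [h₁, map_add, hv], by rw [h₂, map_add, hw], ?_⟩
  simpa [(residue_eq_zero_iff_dvd hx x).2 dvd_rfl] using hvw

/-- Scale all parameters of a list of elementary transformations. -/
noncomputable def scaleList (c : K) (l : List (Bool × Polynomial K)) : List (Bool × Polynomial K) :=
  l.map fun e => (e.1, Polynomial.C c * e.2)

theorem run_scaleList {R : Type*} [CommRing R] [Algebra K R] (c : K)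
    (l : List (Bool × Polynomial K)) (b : R × R) :
    TriAction.run 1 (scaleList c l) b = TriAction.run (algebraMap K R c) l b := by
  induction l generalizing b with
  | nil => rfl
  | cons e l ih =>
    change TriAction.run 1 (scaleList c l) (TriAction.elemStep 1 b (e.1, Polynomial.C c * e.2)) = _
    rw [ih, run_cons]
    congr 1
    simp [TriAction.elemStep]

theorem exists_integral_eval (G : Polynomial (MvPolynomial (Fin 3) K)) :
    ∃ d : O, d ≠ 0 ∧ ∀ c : O, ∃ r : MvPolynomial (Fin 3) O,
      r.map (algebraMap O K) = C (algebraMap O K d) * G.eval (C (algebraMap O K c)) := by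
  induction G using Polynomial.induction_on' with
  | add p q hp hq =>
    obtain ⟨d, hd, h⟩ := hp
    obtain ⟨e, he, h'⟩ := hq
    refine ⟨d * e, mul_ne_zero hd he, fun c => ?_⟩
    obtain ⟨r, hr⟩ := h c
    obtain ⟨r', hr'⟩ := h' c
    refine ⟨C e * r + C d * r', ?_⟩
    rw [map_add, map_mul, map_mul, hr, hr', Polynomial.eval_add, map_C, map_C, map_mul, C_mul]
    ring
  | monomial n g =>
    obtain ⟨d, hd, g', hg'⟩ := exists_map_eq_C_mul (nonZeroDivisors O) g
    refine ⟨d, nonZeroDivisors.ne_zero hd, fun c => ⟨g' * C c ^ n, ?_⟩⟩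
    rw [map_mul, hg', Polynomial.eval_monomial, map_pow, map_C]
    ring

theorem exists_run_sub (l : List (Bool × Polynomial K))
    (b : MvPolynomial (Fin 3) K × MvPolynomial (Fin 3) K) :
    ∃ G₁ G₂ : Polynomial (MvPolynomial (Fin 3) K), ∀ c : K,
      (TriAction.run 1 (scaleList c l) b).1 =
        (TriAction.run 1 l b).1 + (C c - 1) * G₁.eval (C c) ∧
      (TriAction.run 1 (scaleList c l) b).2 =
        (TriAction.run 1 l b).2 + (C c - 1) * G₂.eval (C c) := by
  let F := TriAction.run (K := K) (Polynomial.X : Polynomial (MvPolynomial (Fin 3) K)) l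
    (Polynomial.C b.1, Polynomial.C b.2)
  have hF : ∀ c : K, TriAction.run 1 (scaleList c l) b = (F.1.eval (C c), F.2.eval (C c)) := by
    intro c
    rw [run_scaleList]
    have := run_map (K := K) ((Polynomial.aeval (R := MvPolynomial (Fin 3) K)
      (C c : MvPolynomial (Fin 3) K)).restrictScalars K) Polynomial.X l
      (Polynomial.C b.1, Polynomial.C b.2)
    simpa [Prod.map, Polynomial.coe_aeval_eq_eval, algebraMap_eq] using this
  have hF1 : TriAction.run 1 l b = (F.1.eval 1, F.2.eval 1) := by
    simpa [run_scaleList] using hF 1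
  have key : ∀ f : Polynomial (MvPolynomial (Fin 3) K), ∃ G : Polynomial (MvPolynomial (Fin 3) K),
      ∀ c, f.eval c = f.eval 1 + (c - 1) * G.eval c := by
    intro f
    obtain ⟨G, hG⟩ := Polynomial.X_sub_C_dvd_sub_C_eval (a := 1) (p := f)
    refine ⟨G, fun c => ?_⟩
    have := congrArg (Polynomial.eval c) hG
    simp only [Polynomial.eval_sub, Polynomial.eval_C, Polynomial.eval_mul, Polynomial.eval_X] at this
    linear_combination this
  obtain ⟨G₁, h₁⟩ := key F.1
  obtain ⟨G₂, h₂⟩ := key F.2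
  exact ⟨G₁, G₂, fun c => by rw [hF, hF1]; exact ⟨h₁ _, h₂ _⟩⟩

theorem Good.exists_scaleList {l : List (Bool × Polynomial K)}
    {b : MvPolynomial (Fin 3) K × MvPolynomial (Fin 3) K} (h : Good O (TriAction.run 1 l b)) :
    ∃ d : O, d ≠ 0 ∧ ∀ c : O, d ∣ c - 1 → Good O (TriAction.run 1 (scaleList (algebraMap O K c) l) b) := by
  obtain ⟨x, hx⟩ := IsDiscreteValuationRing.exists_irreducible O
  obtain ⟨G₁, G₂, hG⟩ := exists_run_sub l b
  obtain ⟨d₁, hd₁, h₁⟩ := exists_integral_eval (O := O) G₁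
  obtain ⟨d₂, hd₂, h₂⟩ := exists_integral_eval (O := O) G₂
  refine ⟨x * d₁ * d₂, mul_ne_zero (mul_ne_zero hx.ne_zero hd₁) hd₂, ?_⟩
  rintro c ⟨e, he⟩
  obtain ⟨r₁, hr₁⟩ := h₁ c
  obtain ⟨r₂, hr₂⟩ := h₂ c
  have e1 : (C (algebraMap O K c) - 1 : MvPolynomial (Fin 3) K) =
      C (algebraMap O K x) * C (algebraMap O K d₁) * C (algebraMap O K d₂) * C (algebraMap O K e) := by
    rw [← C_1, ← C_sub, ← map_one (algebraMap O K), ← map_sub, he]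
    simp only [map_mul]
  refine h.perturb hx (r₁ := C d₂ * C e * r₁) (r₂ := C d₁ * C e * r₂) ?_ ?_
  · rw [(hG _).1, e1]
    simp only [map_mul, map_C, hr₁]
    ring
  · rw [(hG _).2, e1]
    simp only [map_mul, map_C, hr₂]
    ring

end DVR

section Base
variable {A : Type*} [CommRing A] [IsDomain A] [Algebra ℚ A]

/-- The polynomial `∫ p(s, Z + Q(s)) ds`. -/
noncomputable def baseInt (Q : Polynomial A) (p : Polynomial (Polynomial A)) :
    Polynomial (Polynomial A) :=
  integ (Polynomial.aevalAeval (Polynomial.X : Polynomial (Polynomial A))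
    (Polynomial.C Polynomial.X + Polynomial.aeval Polynomial.X Q) p)

/-- A pair of invariants, generating the kernel when `a` is invertible and `a * Q' = q`. -/
noncomputable def basePair (a : A) (Q : Polynomial A) (p : Polynomial (Polynomial A)) :
    MvPolynomial (Fin 3) A × MvPolynomial (Fin 3) A :=
  (X 1 - Polynomial.aeval (X 0) Q, C a * X 2 -
    Polynomial.aevalAeval (X 1 - Polynomial.aeval (X 0) Q) (X 0) (baseInt Q p))

theorem aevalAeval_map {A' : Type*} [CommRing A'] [IsDomain A'] [Algebra ℚ A'] (f : A →+* A') {σ : Type*}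
    (x y : MvPolynomial σ A) (p : Polynomial (Polynomial A)) :
    map f (Polynomial.aevalAeval x y p) = Polynomial.aevalAeval (map f x) (map f y)
      (p.map (Polynomial.mapRingHom f)) := by
  have : (map f).comp (Polynomial.aevalAeval x y).toRingHom =
      (Polynomial.aevalAeval (map f x) (map f y)).toRingHom.comp
        (Polynomial.mapRingHom (Polynomial.mapRingHom f)) := by
    ext <;> simp [algebraMap_eq]
  exact DFunLike.congr_fun this p

theorem eq_integ {R : Type*} [CommRing R] [IsDomain R] [Algebra ℚ R] {F f : Polynomial R}
    (h : Polynomial.derivative F = f) (h0 : F.coeff 0 = 0) : F = integ f := by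
  have : IsAddTorsionFree R := .of_module_rat _
  have e : Polynomial.derivative (F - integ f) = 0 := by rw [map_sub, h, derivative_integ, sub_self]
  obtain ⟨c, hc⟩ : ∃ c, Polynomial.C c = F - integ f :=
    ⟨_, (Polynomial.eq_C_of_natDegree_eq_zero
      (Polynomial.derivative_eq_zero.1 e)).symm⟩
  have h1 : (F - integ f).coeff 0 = 0 := by rw [Polynomial.coeff_sub, h0, coeff_integ_zero, sub_zero]
  rw [← hc, Polynomial.coeff_C_zero] at h1
  rw [← sub_eq_zero, ← hc, h1, Polynomial.C_0]

theorem integ_map {R R' : Type*} [CommRing R] [Algebra ℚ R] [CommRing R'] [IsDomain R']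
    [Algebra ℚ R'] (f : R →+* R') (p : Polynomial R) : (integ p).map f = integ (p.map f) :=
  eq_integ (by rw [Polynomial.derivative_map, derivative_integ])
    (by rw [Polynomial.coeff_map, coeff_integ_zero, map_zero])

theorem baseInt_map {A' : Type*} [CommRing A'] [IsDomain A'] [Algebra ℚ A'] (f : A →+* A')
    (Q : Polynomial A) (p : Polynomial (Polynomial A)) :
    (baseInt Q p).map (Polynomial.mapRingHom f) =
      baseInt (Q.map f) (p.map (Polynomial.mapRingHom f)) := by
  rw [baseInt, integ_map, baseInt]
  congr 1
  have h1 : ∀ Q : Polynomial A, (Polynomial.aeval (Polynomial.X : Polynomial (Polynomial A)) Q).map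
      (Polynomial.mapRingHom f) = Polynomial.aeval Polynomial.X (Q.map f) := by
    have : (Polynomial.mapRingHom (Polynomial.mapRingHom f)).comp
        (Polynomial.aeval (R := A) (Polynomial.X : Polynomial (Polynomial A))).toRingHom =
      (Polynomial.aeval (R := A') (Polynomial.X : Polynomial (Polynomial A'))).toRingHom.comp
        (Polynomial.mapRingHom f) := by
      ext <;> simp
    exact fun Q => DFunLike.congr_fun this Q
  rw [← h1]
  generalize Polynomial.aeval (Polynomial.X : Polynomial (Polynomial A)) Q = Q'
  have : (Polynomial.mapRingHom (Polynomial.mapRingHom f)).comp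
      (Polynomial.aevalAeval (R := A) Polynomial.X (Polynomial.C Polynomial.X + Q')).toRingHom =
    (Polynomial.aevalAeval (R := A') Polynomial.X (Polynomial.C Polynomial.X +
      Q'.map (Polynomial.mapRingHom f))).toRingHom.comp
      (Polynomial.mapRingHom (Polynomial.mapRingHom f)) := by
    ext <;> simp
  exact DFunLike.congr_fun this p

theorem basePair_map {A' : Type*} [CommRing A'] [IsDomain A'] [Algebra ℚ A'] (f : A →+* A') (a : A)
    (Q : Polynomial A) (p : Polynomial (Polynomial A)) :
    Prod.map (map f) (map f) (basePair a Q p) =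
      basePair (f a) (Q.map f) (p.map (Polynomial.mapRingHom f)) := by
  simp only [basePair, Prod.map, map_sub, map_mul, aevalAeval_map, map_polynomial_aeval, map_X,
    map_C, baseInt_map]

variable (a : A) (q Q : Polynomial A) (p : Polynomial (Polynomial A))

theorem aeval_baseInt_derivative {S : Type*} [CommRing S] [Algebra A S] (v y : S) :
    Polynomial.aevalAeval v y (Polynomial.derivative (baseInt Q p)) =
      Polynomial.aevalAeval y (v + Polynomial.aeval y Q) p := by
  rw [baseInt, derivative_integ, algHom_aevalAeval, map_add, ← Polynomial.aeval_algHom_apply,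
    Polynomial.aevalAeval_Y, Polynomial.aevalAeval_X]

theorem der_basePair_fst (hQ : Polynomial.C a * Polynomial.derivative Q = q) :
    der a q p (basePair a Q p).1 = 0 := by
  simp only [basePair]
  rw [map_sub, derivation_aeval, der_X0, der_X1, ← hQ]
  simp [mul_comm]

theorem der_basePair_snd (hQ : Polynomial.C a * Polynomial.derivative Q = q) :
    der a q p (basePair a Q p).2 = 0 := by
  have h := der_basePair_fst a q Q p hQ
  simp only [basePair] at h ⊢
  rw [map_sub, derivation_aevalAeval _ h, aeval_baseInt_derivative, sub_add_cancel,
    Derivation.leibniz, der_X2, der_X0]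
  simp [mul_comm]

end Base

section Kernel
variable {K : Type*} [Field K] [Algebra ℚ K]

theorem kerDer_eq_adjoin_basePair {a : K} (ha : a ≠ 0) {q Q : Polynomial K}
    (p : Polynomial (Polynomial K)) (hQ : Polynomial.C a * Polynomial.derivative Q = q) :
    kerDer (der a q p) = Algebra.adjoin K {(basePair a Q p).1, (basePair a Q p).2} := by
  refine kerDer_eq_adjoin (isExp_expHom a q p) (s := C a⁻¹ * X 0) (der_basePair_fst a q Q p hQ)
    (der_basePair_snd a q Q p hQ) ?_ ?_
  · rw [← smul_eq_C_mul, Derivation.map_smul, der_X0, smul_eq_C_mul, ← C_mul]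
    simp [ha]
  · set S := Algebra.adjoin K {(basePair a Q p).1, (basePair a Q p).2, C a⁻¹ * X 0}
    have hC : ∀ c : K, (C c : MvPolynomial (Fin 3) K) ∈ S := fun c => S.algebraMap_mem c
    have m1 : (basePair a Q p).1 ∈ S := Algebra.subset_adjoin (by simp)
    have m2 : (basePair a Q p).2 ∈ S := Algebra.subset_adjoin (by simp)
    have m3 : C a⁻¹ * X 0 ∈ S := Algebra.subset_adjoin (by simp)
    have h0 : X 0 ∈ S := by
      have := S.mul_mem (hC a) m3
      rwa [← mul_assoc, ← C_mul, mul_inv_cancel₀ ha, C_1, one_mul] at this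
    have hQm : Polynomial.aeval (X 0 : MvPolynomial (Fin 3) K) Q ∈ S := by
      have := Polynomial.aeval_algHom_apply S.val ⟨_, h0⟩ Q
      simp only [Subalgebra.coe_val] at this
      rw [this]; exact Subtype.property _
    refine eq_top_of_X_mem h0 ?_ ?_
    · have := S.add_mem m1 hQm
      simpa [basePair] using this
    · have := S.mul_mem (hC a⁻¹) (S.add_mem m2 (aevalAeval_mem m1 h0 (baseInt Q p)))
      simp only [basePair, sub_add_cancel] at this
      rwa [← mul_assoc, ← C_mul, inv_mul_cancel₀ ha, C_1, one_mul] at this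

theorem exists_baseInt_eq (Q : Polynomial K) {p : Polynomial (Polynomial K)}
    (hspan : (Ideal.span {C 0, Polynomial.aeval (X 0) (0 : Polynomial K),
      Polynomial.aevalAeval (X 0) (X 1) p} : Ideal (MvPolynomial (Fin 3) K)) = ⊤) :
    ∃ c, IsUnit c ∧ p = Polynomial.C (Polynomial.C c) ∧
      baseInt Q p = Polynomial.C (Polynomial.C c) * Polynomial.X := by
  have hu : IsUnit (Polynomial.aevalAeval (X 0 : MvPolynomial (Fin 3) K) (X 1) p) := by
    rw [← Ideal.span_singleton_eq_top, ← hspan]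
    simp [Ideal.span_insert]
  rw [MvPolynomial.isUnit_iff_eq_C_of_isReduced] at hu
  obtain ⟨c, hc, hp⟩ := hu
  have hp' : p = Polynomial.C (Polynomial.C c) := by
    have := congrArg
      (aeval ![(Polynomial.C Polynomial.X : Polynomial (Polynomial K)), Polynomial.X, 0]) hp
    rw [algHom_aevalAeval] at this
    have e : Polynomial.aevalAeval (Polynomial.C Polynomial.X : Polynomial (Polynomial K))
        Polynomial.X = AlgHom.id K _ := by
      apply Polynomial.algHom_ext'
      · ext; simp
      · simp
    simpa [e] using this
  refine ⟨c, hc, hp', ?_⟩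
  rw [baseInt, hp', Polynomial.aevalAeval_C, Polynomial.aeval_C]
  exact (eq_integ (by simp) (by simp)).symm

theorem algebraicIndependent_basePair (a : K) (q Q : Polynomial K)
    (p : Polynomial (Polynomial K)) (hQ : Polynomial.C a * Polynomial.derivative Q = q)
    (hspan : (Ideal.span {C a, Polynomial.aeval (X 0) q, Polynomial.aevalAeval (X 0) (X 1) p} :
      Ideal (MvPolynomial (Fin 3) K)) = ⊤) :
    AlgebraicIndependent K ![(basePair a Q p).1, (basePair a Q p).2] := by
  by_cases ha : a = 0
  · subst ha
    obtain rfl : q = 0 := by rw [← hQ]; simp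
    obtain ⟨c, hc, -, hG⟩ := exists_baseInt_eq Q hspan
    refine algInd_of_comp (V := X 0) (W := - (c • X 1))
      (f := aeval ![X 1, X 0 + Polynomial.aeval (X 1) Q, 0]) ?_ ?_ ?_
    · simp [basePair, ← Polynomial.aeval_algHom_apply]
    · simp [basePair, hG, smul_eq_C_mul]
    · have := algInd_smul (algInd_X (k := K)) (-hc.unit)
      simpa using this
  · refine algInd_of_comp (V := X 0) (W := X 1) (f := aeval ![0, X 0 + Polynomial.aeval 0 Q,
      C a⁻¹ * (X 1 + Polynomial.aevalAeval (X 0) 0 (baseInt Q p))]) ?_ ?_ algInd_X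
    · simp [basePair, ← Polynomial.aeval_algHom_apply]
    · simp only [basePair, map_sub, algHom_aevalAeval, map_mul]
      simp [← Polynomial.aeval_algHom_apply, algebraMap_eq, ← mul_assoc, ← C_mul, ha]

end Kernel

section DVR
variable {O : Type*} [CommRing O] [IsDomain O] [IsDiscreteValuationRing O] [Algebra ℚ O]
  {K : Type*} [Field K] [Algebra O K] [IsFractionRing O K] [Algebra ℚ K]

/-- The base pair is good as soon as it has integral coefficients. -/
theorem good_basePair (a : O) (q Q : Polynomial O) (p : Polynomial (Polynomial O))
    (hQ : Polynomial.C a * Polynomial.derivative Q = q) (hE : HitsVar (expHom a q p)) :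
    Good O (basePair (algebraMap O K a) (Q.map (algebraMap O K))
      (p.map (Polynomial.mapRingHom (algebraMap O K)))) := by
  let : Algebra ℚ (IsLocalRing.ResidueField O) :=
    ((IsLocalRing.residue O).comp (algebraMap ℚ O)).toAlgebra
  refine ⟨(basePair a Q p).1, (basePair a Q p).2, ?_, ?_, ?_⟩
  · rw [← basePair_map]; rfl
  · rw [← basePair_map]; rfl
  · have h := algebraicIndependent_basePair (IsLocalRing.residue O a)
      (q.map (IsLocalRing.residue O)) (Q.map (IsLocalRing.residue O))
      (p.map (Polynomial.mapRingHom (IsLocalRing.residue O)))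
      (by rw [← hQ, Polynomial.map_mul, Polynomial.map_C, Polynomial.derivative_map])
      (HitsVar.span_eq_top _ _ _ (hE.map (isExp_expHom _ _ _) (isExp_expHom _ _ _)
        (map (IsLocalRing.residue O)) (map_der _ _ _ _)))
    rwa [← basePair_map] at h

end DVR

section Iteration
variable {O : Type*} [CommRing O] [IsDomain O] [IsDiscreteValuationRing O] [Algebra ℚ O]

open IsLocalRing

theorem polynomial_C_dvd_iff {x : O} (hx : Irreducible x) (f : Polynomial O) :
    Polynomial.C x ∣ f ↔ f.map (residue O) = 0 := by
  rw [Polynomial.C_dvd_iff_dvd_coeff, Polynomial.ext_iff]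
  simp [residue_eq_zero_iff_dvd hx]

theorem exists_map_residue (f : Polynomial (ResidueField O)) :
    ∃ g : Polynomial O, g.map (residue O) = f ∧ g.natDegree = f.natDegree := by
  have hl : f ∈ Polynomial.lifts (residue O) := by
    rw [Polynomial.mem_lifts]
    exact Polynomial.map_surjective _ residue_surjective f
  obtain ⟨g, hg, hd⟩ := Polynomial.exists_degree_eq_of_mem_lifts hl
  exact ⟨g, hg, Polynomial.natDegree_eq_natDegree hd⟩

/-- A polynomial can be brought to its expected degree, up to high powers of the uniformizer, by a
substitution congruent to the identity. -/
theorem exists_comp_sub_sub_dvd {x : O} (hx : Irreducible x) {f c : Polynomial O}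
    (hf : (f.map (residue O)).natDegree ≠ 0) (hc : c.map (residue O) = 0) (N : ℕ) :
    ∃ y S : Polynomial O, y.map (residue O) = Polynomial.X ∧
      S.natDegree ≤ (f.map (residue O)).natDegree ∧ S.map (residue O) = f.map (residue O) ∧
      Polynomial.C x ^ (N + 1) ∣ f.comp y - c - S := by
  induction N with
  | zero =>
    obtain ⟨S, hS, hd⟩ := exists_map_residue (f.map (residue O))
    refine ⟨Polynomial.X, S, by simp, hd.le, hS, ?_⟩
    rw [zero_add, pow_one, polynomial_C_dvd_iff hx]
    simp [hS, hc]
  | succ N ih =>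
    obtain ⟨y, S, hy, hd, hS, e, he⟩ := ih
    set f' := (Polynomial.derivative f).map (residue O) with hf'
    have hf0 : f' ≠ 0 := by
      let : Algebra ℚ (ResidueField O) := ((residue O).comp (algebraMap ℚ O)).toAlgebra
      have : IsAddTorsionFree (ResidueField O) := .of_module_rat _
      rwa [hf', ← Polynomial.derivative_map, Ne, Polynomial.derivative_eq_zero]
    obtain ⟨η, hη, -⟩ := exists_map_residue (e.map (residue O) / f')
    obtain ⟨ρ, hρ, hρd⟩ := exists_map_residue (e.map (residue O) % f')
    refine ⟨y - Polynomial.C x ^ (N + 1) * η, S + Polynomial.C x ^ (N + 1) * ρ, ?_, ?_, ?_, ?_⟩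
    · simp [hy, (residue_eq_zero_iff_dvd hx x).2 dvd_rfl]
    · refine Polynomial.natDegree_add_le_of_degree_le hd ?_
      rw [← map_pow]
      refine (Polynomial.natDegree_C_mul_le _ _).trans (hρd.trans_le ?_)
      refine (Polynomial.natDegree_le_natDegree (Polynomial.degree_mod_lt _ hf0).le).trans ?_
      rw [hf', ← Polynomial.derivative_map]
      exact (Polynomial.natDegree_derivative_le _).trans (Nat.sub_le _ _)
    · simp [hS, (residue_eq_zero_iff_dvd hx x).2 dvd_rfl]
    · obtain ⟨g, hg⟩ := Polynomial.binomExpansion (f.map Polynomial.C) y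
        (- (Polynomial.C x ^ (N + 1) * η))
      rw [← sub_eq_add_neg] at hg
      simp only [Polynomial.eval_map, Polynomial.derivative_map] at hg
      change f.comp _ = f.comp y + (Polynomial.derivative f).comp y * _ + _ at hg
      have h1 : Polynomial.C x ∣ e - η * (Polynomial.derivative f).comp y - ρ := by
        rw [polynomial_C_dvd_iff hx]
        simp only [Polynomial.map_sub, Polynomial.map_mul, Polynomial.map_comp, hη, hρ, hy,
          Polynomial.comp_X]
        linear_combination - EuclideanDomain.div_add_mod (e.map (residue O)) f'
      obtain ⟨e', he'⟩ := h1
      rw [hg]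
      refine ⟨e' + Polynomial.C x ^ N * (g * η ^ 2), ?_⟩
      linear_combination he + Polynomial.C x ^ (N + 1) * he'

end Iteration

section Nakayama
variable {B E : Type*} [CommRing B] [CommRing E] [Algebra B E] [Module.Finite B E]

theorem exists_smul_mem_range {x : B} (h : ∀ e : E, ∃ b e', e = algebraMap B E b + x • e') :
    ∃ r : B, ∀ e : E, ∃ b, (1 + x * r) • e = algebraMap B E b := by
  let L : Submodule B E := LinearMap.range (Algebra.linearMap B E)
  obtain ⟨r, hr, hr'⟩ := Submodule.exists_sub_one_mem_and_smul_eq_zero_of_fg_of_le_smul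
    (Ideal.span {x}) (⊤ : Submodule B (E ⧸ L)) Module.Finite.fg_top (by
      rintro e -
      obtain ⟨e, rfl⟩ := Submodule.Quotient.mk_surjective _ e
      obtain ⟨b, e', rfl⟩ := h e
      have : (Submodule.Quotient.mk (algebraMap B E b + x • e') : E ⧸ L) =
          x • Submodule.Quotient.mk e' := by
        rw [Submodule.Quotient.mk_add, Submodule.Quotient.mk_smul, add_eq_right,
          Submodule.Quotient.mk_eq_zero]
        exact ⟨b, rfl⟩
      rw [this]
      exact Submodule.smul_mem_smul (Ideal.mem_span_singleton_self x) trivial)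
  obtain ⟨r', hr1⟩ := Ideal.mem_span_singleton'.1 hr
  refine ⟨r', fun e => ?_⟩
  have h1 := hr' (Submodule.Quotient.mk e) trivial
  rw [← Submodule.Quotient.mk_smul, Submodule.Quotient.mk_eq_zero] at h1
  obtain ⟨b, hb⟩ := h1
  exact ⟨b, by rw [mul_comm, hr1, add_sub_cancel, ← hb]; rfl⟩

/-- An element of a finite algebra killed modulo `x` lifts to an element of the kernel. -/
theorem exists_add_mul_map_eq_zero {x : B} (h : ∀ e : E, ∃ b e', e = algebraMap B E b + x • e')
    {g : B} {e : E} (hg : algebraMap B E g = x • e) : ∃ g' : B, algebraMap B E (g + x * g') = 0 := by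
  obtain ⟨r, hr⟩ := exists_smul_mem_range h
  obtain ⟨b, hb⟩ := hr e
  refine ⟨r * g - b, ?_⟩
  rw [map_add, map_mul, map_sub, map_mul, ← hb, hg]
  simp only [Algebra.smul_def, map_add, map_mul, map_one]
  ring

end Nakayama

section Finite
variable {O B E : Type*} [CommRing O] [Nontrivial O] [CommRing B] [CommRing E] [Algebra O B]
  [Algebra O E] [Algebra B E] [IsScalarTower O B E]

theorem finite_of_hits {S : Polynomial O} {F : B} {τ t : E}
    (hS : IsUnit S.leadingCoeff) (hS0 : S.natDegree ≠ 0)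
    (hF : algebraMap B E F = Polynomial.aeval τ S) {m : ℕ} {f : Fin m → Polynomial O} {g : Fin m → B}
    (ht : t = ∑ i, Polynomial.aeval τ (f i) * algebraMap B E (g i))
    (htop : Algebra.adjoin O {τ, t} = ⊤) : Module.Finite B E := by
  nontriviality B
  have hint : IsIntegral B τ := by
    let p : Polynomial B := S.map (algebraMap O B) - Polynomial.C F
    have hp : Polynomial.aeval τ p = 0 := by
      simp [p, hF]
    have hdeg : (S.map (algebraMap O B)).natDegree = S.natDegree :=
      Polynomial.natDegree_map_of_leadingCoeff_ne_zero _ (hS.map _).ne_zero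
    have hlc : p.leadingCoeff = algebraMap O B S.leadingCoeff := by
      rw [Polynomial.leadingCoeff, Polynomial.natDegree_sub_C, hdeg, Polynomial.coeff_sub,
        Polynomial.coeff_C_of_ne_zero hS0, sub_zero, Polynomial.coeff_map]
      rfl
    have h := isIntegral_leadingCoeff_smul p τ hp
    rw [hlc] at h
    have h2 := h.smul (algebraMap O B ↑hS.unit⁻¹)
    rwa [smul_smul, ← map_mul, IsUnit.val_inv_mul, map_one, one_smul] at h2
  have htop' : Algebra.adjoin B {τ} = ⊤ := by
    have hτ : τ ∈ Algebra.adjoin B {τ} := Algebra.subset_adjoin rfl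
    have hle : Algebra.adjoin O {τ, t} ≤ (Algebra.adjoin B {τ}).restrictScalars O := by
      rw [Algebra.adjoin_le_iff]
      rintro e (rfl | rfl)
      · exact hτ
      · rw [ht]
        refine sum_mem fun i _ => mul_mem ?_ (Subalgebra.algebraMap_mem (Algebra.adjoin B {τ}) _)
        have := Polynomial.aeval_algHom_apply
          ((Algebra.adjoin B {τ}).restrictScalars O).val ⟨τ, hτ⟩ (f i)
        simp only [Subalgebra.coe_val] at this
        rw [this]; exact Subtype.property _
    rw [htop] at hle
    exact eq_top_iff.2 fun e _ => hle (Algebra.mem_top : e ∈ (⊤ : Subalgebra O E))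
  have := hint.fg_adjoin_singleton
  rw [htop'] at this
  exact ⟨this⟩

end Finite
section Kernel

theorem exists_eval₂_eq_zero_iff_dvd {R Ω : Type*} [CommRing R] [IsDomain R]
    [UniqueFactorizationMonoid R] [Field Ω] {φ : R →+* Ω} (hφ : Function.Injective φ) (ω : Ω) :
    ∃ W : Polynomial R, ∀ h : Polynomial R, h.eval₂ φ ω = 0 ↔ W ∣ h := by
  classical
  let := Classical.choice (inferInstance : Nonempty (NormalizedGCDMonoid R))
  let L := FractionRing R
  let ψ : L →+* Ω := IsFractionRing.lift (K := L) hφ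
  let := ψ.toAlgebra
  let μ := minpoly L ω
  have key : ∀ h : Polynomial R, h.eval₂ φ ω = 0 ↔ μ ∣ h.map (algebraMap R L) := by
    intro h
    have hφ' : φ = ψ.comp (algebraMap R L) := by ext r; simp [ψ]
    have h1 : h.eval₂ φ ω = Polynomial.aeval ω (h.map (algebraMap R L)) := by
      rw [hφ', ← Polynomial.eval₂_map]; rfl
    rw [h1]
    exact (minpoly.dvd_iff (A := L) (x := ω)).symm
  by_cases hμ : μ = 0
  · refine ⟨0, fun h => ?_⟩
    rw [key, hμ, zero_dvd_iff, zero_dvd_iff,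
      Polynomial.map_eq_zero_iff (IsFractionRing.injective R L)]
  · obtain ⟨b, hb, hN⟩ := IsLocalization.integerNormalization_spec (nonZeroDivisors R) μ
    set N := IsLocalization.integerNormalization (nonZeroDivisors R) μ
    have hb0 : algebraMap R L b ≠ 0 := by
      simpa using nonZeroDivisors.ne_zero hb
    have hN0 : N ≠ 0 := by
      intro h
      rw [h, Polynomial.map_zero, ← algebraMap_smul L b, eq_comm, smul_eq_zero] at hN
      exact hN.elim hb0 hμ
    refine ⟨N.primPart, fun h => ?_⟩
    rw [key, N.isPrimitive_primPart.dvd_iff_fraction_map_dvd_fraction_map L]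
    have hc0 : algebraMap R L N.content ≠ 0 := by
      simpa [Polynomial.content_eq_zero_iff] using hN0
    have hdecomp : Polynomial.C (algebraMap R L N.content) *
        N.primPart.map (algebraMap R L) = Polynomial.C (algebraMap R L b) * μ := by
      rw [← Polynomial.map_C, ← Polynomial.map_mul, ← N.eq_C_content_mul_primPart, hN,
        ← algebraMap_smul L b, Polynomial.smul_eq_C_mul]
    have h1 := (Polynomial.isUnit_C.2 hc0.isUnit).mul_left_dvd
      (a := N.primPart.map (algebraMap R L)) (b := h.map (algebraMap R L))
    have h2 := (Polynomial.isUnit_C.2 hb0.isUnit).mul_left_dvd (a := μ)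
      (b := h.map (algebraMap R L))
    rw [← h2, ← hdecomp, h1]

theorem exists_aevalAeval_eq_zero_iff_dvd {K : Type*} [Field K] {α : Polynomial K}
    (hα : α.natDegree ≠ 0) (ω : Polynomial K) :
    ∃ W : Polynomial (Polynomial K), ∀ h, Polynomial.aevalAeval α ω h = 0 ↔ W ∣ h := by
  let Ω := FractionRing (Polynomial K)
  have hinj : Function.Injective (Polynomial.aeval (R := K) α) :=
    transcendental_iff_injective.mp (Polynomial.transcendental α hα (by
      rw [mem_nonZeroDivisors_iff_ne_zero, Ne, Polynomial.leadingCoeff_eq_zero]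
      rintro rfl
      simp at hα))
  obtain ⟨W, hW⟩ := exists_eval₂_eq_zero_iff_dvd
    (φ := (algebraMap (Polynomial K) Ω).comp ((Polynomial.aeval α : Polynomial K →ₐ[K] Polynomial K) : Polynomial K →+* Polynomial K))
    ((IsFractionRing.injective _ _).comp hinj) (algebraMap _ Ω ω)
  refine ⟨W, fun h => ?_⟩
  rw [← hW, ← Polynomial.hom_eval₂, map_eq_zero_iff _ (IsFractionRing.injective (Polynomial K) Ω)]
  have : (Polynomial.aevalAeval α ω).toRingHom =
      Polynomial.eval₂RingHom ((Polynomial.aeval α : Polynomial K →ₐ[K] Polynomial K) : Polynomial K →+* Polynomial K) ω := by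
    ext <;> simp
  exact iff_of_eq (congrArg (· = 0) (DFunLike.congr_fun this h))

theorem mem_adjoin_iff_aevalAeval {k R : Type*} [CommRing k] [IsDomain k] [Algebra ℚ k] [CommRing R]
    [Algebra k R]
    {v w r : R} :
    r ∈ Algebra.adjoin k {v, w} ↔ ∃ H : Polynomial (Polynomial k),
    Polynomial.aevalAeval (R := k) v w H = r := by
  constructor
  · intro hr
    rw [← AlgHom.mem_range]
    revert r
    change Algebra.adjoin k {v, w} ≤ _
    rw [Algebra.adjoin_le_iff]
    rintro r (rfl | rfl)
    · exact ⟨Polynomial.C Polynomial.X, by simp⟩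
    · exact ⟨Polynomial.X, by simp⟩
  · rintro ⟨H, rfl⟩
    exact aevalAeval_mem (Algebra.subset_adjoin (by simp)) (Algebra.subset_adjoin (by simp)) _

end Kernel

section ZeroSlice
variable {k : Type*} [Field k] [Algebra ℚ k]

theorem IsExp.apply_slice {A B : Type*} [CommRing A] [CommRing B] [Algebra A B] [Algebra ℚ B]
    {D : Derivation A B B} {E : B →ₐ[A] Polynomial B} (h : IsExp D E) {s : B} (hs : D s = 1) :
    E s = Polynomial.C s + Polynomial.X := by
  have : IsAddTorsionFree B := IsAddTorsionFree.of_module_rat B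
  have h1 : Polynomial.derivative (E s - Polynomial.X) = 0 := by
    rw [Polynomial.derivative_sub, h.deriv, hs, map_one, Polynomial.derivative_X, sub_self]
  have h2 := Polynomial.eq_C_of_derivative_eq_zero h1
  rw [Polynomial.coeff_sub, h.coeff_zero, Polynomial.coeff_X_zero, sub_zero] at h2
  rw [← h2, sub_add_cancel]

theorem aevalAeval_C_X_X {R : Type*} [CommRing R] (e : Polynomial (Polynomial R)) :
    Polynomial.aevalAeval (R := R) (Polynomial.C Polynomial.X : Polynomial (Polynomial R))
      Polynomial.X e = e := by
  have : (Polynomial.aevalAeval (R := R) (Polynomial.C Polynomial.X : Polynomial (Polynomial R))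
      Polynomial.X).toRingHom = RingHom.id _ := by
    ext <;> simp
  exact DFunLike.congr_fun this e

theorem bijective_of_adjoin_eq_top {f g s : MvPolynomial (Fin 3) k}
    (htop : Algebra.adjoin k {f, g, s} = ⊤) :
    Function.Bijective (aeval (R := k) ![f, g, s]) := by
  have hsurj : Function.Surjective (aeval (R := k) ![f, g, s]) := by
    rw [← AlgHom.range_eq_top, eq_top_iff, ← htop, Algebra.adjoin_le_iff]
    rintro b (rfl | rfl | rfl)
    · exact ⟨X 0, by simp⟩
    · exact ⟨X 1, by simp⟩
    · exact ⟨X 2, by simp⟩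
  exact ⟨injective_of_surjective_endo (aeval (R := k) ![f, g, s]).toRingHom hsurj, hsurj⟩

/-- A parametrised curve in the section `s = 0`, `P = T(y)`; flowing along it parametrises the
surface `P = T(y)`. -/
theorem exists_curve {D : Derivation k (MvPolynomial (Fin 3) k) (MvPolynomial (Fin 3) k)}
    {E : MvPolynomial (Fin 3) k →ₐ[k] Polynomial (MvPolynomial (Fin 3) k)} (h : IsExp D E)
    {P s : MvPolynomial (Fin 3) k} (h0 : D (X 0) = 0) (hP : D P = 0) (hs : D s = 1)
    (htop : Algebra.adjoin k {X 0, P, s} = ⊤) (T : Polynomial k) :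
    ∃ σ : MvPolynomial (Fin 3) k →ₐ[k] Polynomial k, σ (X 0) = Polynomial.X ∧
      (∀ e : Polynomial (Polynomial k), ∃ g, (E g).map (σ : MvPolynomial (Fin 3) k →+* Polynomial k) = e) ∧
      ∀ g, (E g).map (σ : MvPolynomial (Fin 3) k →+* Polynomial k) = 0 ↔
        P - Polynomial.aeval (X 0) T ∣ g := by
  let β : MvPolynomial (Fin 3) k ≃ₐ[k] MvPolynomial (Fin 3) k :=
    AlgEquiv.ofBijective _ (bijective_of_adjoin_eq_top htop)
  let σ : MvPolynomial (Fin 3) k →ₐ[k] Polynomial k :=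
    (aeval ![Polynomial.X, T, 0]).comp β.symm.toAlgHom
  have hβ (i) : β.symm (![X 0, P, s] i) = X i := by
    rw [AlgEquiv.symm_apply_eq]; simp [β]
  have hσ0 : σ (X 0) = Polynomial.X := by
    have := hβ 0
    simp only [Matrix.cons_val_zero] at this
    simp [σ, this]
  have hσP : σ P = T := by
    have := hβ 1
    simp only [Matrix.cons_val_one, Matrix.cons_val_zero] at this
    simp [σ, this]
  have hσs : σ s = 0 := by
    have := hβ 2
    simp only [Matrix.cons_val] at this
    simp [σ, this]
  let ψ : MvPolynomial (Fin 3) k →ₐ[k] Polynomial (Polynomial k) := (Polynomial.mapAlgHom σ).comp E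
  have hψ (g) : ψ g = (E g).map (σ : MvPolynomial (Fin 3) k →+* Polynomial k) := rfl
  have hψ0 : ψ (X 0) = Polynomial.C Polynomial.X := by
    rw [hψ, h.apply_of_mem h0, Polynomial.map_C]; exact congrArg _ hσ0
  have hψP : ψ P = Polynomial.C T := by
    rw [hψ, h.apply_of_mem hP, Polynomial.map_C]; exact congrArg _ hσP
  have hψs : ψ s = Polynomial.X := by
    rw [hψ, h.apply_slice hs, Polynomial.map_add, Polynomial.map_C, Polynomial.map_X,
      RingHom.coe_coe, hσs, map_zero, zero_add]
  refine ⟨σ, hσ0, fun e => ⟨Polynomial.aevalAeval (X 0) s e, ?_⟩, fun g => ?_⟩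
  · rw [← hψ, algHom_aevalAeval, hψ0, hψs, aevalAeval_C_X_X]
  · rw [← hψ]
    constructor
    · intro hg
      let I := Ideal.span {P - Polynomial.aeval (X 0) T}
      let θ : MvPolynomial (Fin 3) k →ₐ[k] MvPolynomial (Fin 3) k ⧸ I :=
        (Ideal.Quotient.mkₐ k I).comp ((Polynomial.aevalAeval (X 0) s).comp ψ)
      have hθ : θ = Ideal.Quotient.mkₐ k I := by
        refine AlgHom.ext_of_adjoin_eq_top htop ?_
        rintro b (rfl | rfl | rfl)
        · simp only [θ, AlgHom.comp_apply, hψ0]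
          rw [Polynomial.aevalAeval_C, Polynomial.aeval_X]
        · simp only [θ, AlgHom.comp_apply, hψP]
          rw [Polynomial.aevalAeval_C, Ideal.Quotient.mkₐ_eq_mk, eq_comm, Ideal.Quotient.eq]
          exact Ideal.mem_span_singleton_self _
        · simp only [θ, AlgHom.comp_apply, hψs]
          rw [Polynomial.aevalAeval_Y]
      have := DFunLike.congr_fun hθ g
      simp only [θ, AlgHom.comp_apply, hg, map_zero] at this
      rw [eq_comm, Ideal.Quotient.mkₐ_eq_mk, Ideal.Quotient.eq_zero_iff_mem] at this
      exact Ideal.mem_span_singleton.1 this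
    · rintro ⟨g, rfl⟩
      rw [map_mul, map_sub, hψP, ← Polynomial.aeval_algHom_apply, hψ0]
      have : Polynomial.aeval (Polynomial.C Polynomial.X : Polynomial (Polynomial k)) T =
          Polynomial.C T := by
        rw [← aevalAeval_C_X_X (Polynomial.C T), Polynomial.aevalAeval_C]
      rw [this, sub_self, zero_mul]

end ZeroSlice

section Primitive
variable {O K : Type*} [CommRing O] [IsDomain O] [IsDiscreteValuationRing O] [Field K]
  [Algebra O K] [IsFractionRing O K] {σ : Type*} [Finite σ]
open IsLocalRing

theorem map_residue_eq_zero_iff {x : O} (hx : Irreducible x) (f : MvPolynomial σ O) :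
    f.map (residue O) = 0 ↔ C x ∣ f := by
  refine ⟨C_dvd_of_map_residue_eq_zero hx, ?_⟩
  rintro ⟨g, rfl⟩
  rw [map_mul, map_C, (residue_eq_zero_iff_dvd hx x).2 dvd_rfl, C_0, zero_mul]

theorem exists_primitive {f : MvPolynomial σ K} (hf : f ≠ 0) :
    ∃ c : K, c ≠ 0 ∧ ∃ W : MvPolynomial σ O, W.map (algebraMap O K) = C c * f ∧
      W.map (residue O) ≠ 0 := by
  obtain ⟨x, hx⟩ := IsDiscreteValuationRing.exists_irreducible O
  obtain ⟨d, hd, H, hH⟩ := exists_map_eq_C_mul (nonZeroDivisors O) f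
  have hd0 : algebraMap O K d ≠ 0 := by
    simpa using nonZeroDivisors.ne_zero hd
  have hH0 : H ≠ 0 := by
    rintro rfl
    rw [map_zero, eq_comm, mul_eq_zero, MvPolynomial.C_eq_zero] at hH
    exact hH.elim hd0 hf
  have hfin : FiniteMultiplicity (C x : MvPolynomial σ O) H :=
    FiniteMultiplicity.of_not_isUnit (fun h => hx.not_isUnit (by
      have := h.map (MvPolynomial.constantCoeff (σ := σ) (R := O)); simpa using this)) hH0
  obtain ⟨W, hW, hxW⟩ := hfin.exists_eq_pow_mul_and_not_dvd
  set n := multiplicity (C x : MvPolynomial σ O) H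
  have hx0 : (algebraMap O K x) ≠ 0 := by simpa using hx.ne_zero
  refine ⟨(algebraMap O K x ^ n)⁻¹ * algebraMap O K d, by positivity, W, ?_, ?_⟩
  · rw [C_mul, mul_assoc, ← hH, hW, map_mul, map_pow, map_C, ← mul_assoc, ← C_pow, ← C_mul,
      inv_mul_cancel₀ (pow_ne_zero _ hx0), C_1, one_mul]
  · rwa [Ne, map_residue_eq_zero_iff hx]

theorem dvd_of_map_dvd {W b : MvPolynomial σ O} (hW : W.map (residue O) ≠ 0)
    (h : W.map (algebraMap O K) ∣ b.map (algebraMap O K)) : W ∣ b := by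
  obtain ⟨x, hx⟩ := IsDiscreteValuationRing.exists_irreducible O
  obtain ⟨e, he⟩ := h
  obtain ⟨d, hd, e', he'⟩ := exists_map_eq_C_mul (nonZeroDivisors O) e
  obtain ⟨n, u, rfl⟩ := IsDiscreteValuationRing.eq_unit_mul_pow_irreducible
    (nonZeroDivisors.ne_zero hd) hx
  have hmul : C (u * x ^ n : O) * b = W * e' := by
    apply map_algebraMap_injective (K := K)
    rw [map_mul (map (algebraMap O K)), map_mul (map (algebraMap O K)), he, he', map_C]; ring
  have hp : Prime (C x : MvPolynomial σ O) := by
    rw [MvPolynomial.prime_C_iff]; exact hx.prime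
  have hdvd : (C x : MvPolynomial σ O) ^ n ∣ e' := by
    refine hp.pow_dvd_of_dvd_mul_left n (mt (map_residue_eq_zero_iff hx W).2 hW) ?_
    rw [← hmul, C_mul, C_pow]
    exact Dvd.intro_left _ rfl |>.mul_right _
  obtain ⟨e'', rfl⟩ := hdvd
  have h1 : C (u : O) * b = W * e'' := by
    have hx0 : (C x : MvPolynomial σ O) ^ n ≠ 0 := pow_ne_zero _ hp.ne_zero
    refine mul_left_cancel₀ hx0 ?_
    rw [C_mul, C_pow] at hmul
    linear_combination hmul
  refine ⟨C ((u⁻¹ : Oˣ) : O) * e'', ?_⟩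
  rw [mul_left_comm, ← h1, ← mul_assoc, ← C_mul, Units.inv_mul, C_1, one_mul]

end Primitive

open IsLocalRing

section Reduction
variable {O : Type*} [CommRing O] [IsDomain O] [IsDiscreteValuationRing O] [Algebra ℚ O]

theorem C_C_dvd_of_map_eq_zero {x : O} (hx : Irreducible x) {f : Polynomial (Polynomial O)}
    (hf : f.map (Polynomial.mapRingHom (residue O)) = 0) :
    Polynomial.C (Polynomial.C x) ∣ f := by
  rw [Polynomial.C_dvd_iff_dvd_coeff]
  intro i
  rw [polynomial_C_dvd_iff hx]
  have := congrArg (Polynomial.coeff · i) hf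
  simpa using this

/-- If the flow of a curve `Σ` maps the algebra onto the coordinate ring of a surface modulo `x`,
then the equations of this surface lift. -/
theorem exists_flow_eq_zero {x : O} (hx : Irreducible x) {B : Type*} [CommRing B] [Algebra O B]
    {E : B →ₐ[O] Polynomial B} (hE : HitsVar E) (Sg : B →ₐ[O] Polynomial O) {F : B}
    (hF : E F = Polynomial.C F) {S : Polynomial O} (hSF : Sg F = S) (hS : IsUnit S.leadingCoeff)
    (hS0 : S.natDegree ≠ 0)
    (hsurj : ∀ e : Polynomial (Polynomial (ResidueField O)), ∃ b : B,
      ((E b).map (Sg : B →+* Polynomial O)).map (Polynomial.mapRingHom (residue O)) = e)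
    {g : B} (hg : ((E g).map (Sg : B →+* Polynomial O)).map
      (Polynomial.mapRingHom (residue O)) = 0) :
    ∃ g' : B, (E (g + algebraMap O B x * g')).map (Sg : B →+* Polynomial O) = 0 := by
  let ψ : B →ₐ[O] Polynomial (Polynomial O) := (Polynomial.mapAlgHom Sg).comp E
  have hψ (b) : ψ b = (E b).map (Sg : B →+* Polynomial O) := rfl
  let : Algebra B (Polynomial (Polynomial O)) := ψ.toRingHom.toAlgebra
  have halg (b) : algebraMap B (Polynomial (Polynomial O)) b = ψ b := rfl
  have : IsScalarTower O B (Polynomial (Polynomial O)) :=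
    IsScalarTower.of_algebraMap_eq fun r => by rw [halg, AlgHom.commutes]
  have hC (f : Polynomial O) :
      Polynomial.aeval (Polynomial.C Polynomial.X : Polynomial (Polynomial O)) f =
        Polynomial.C f := by
    rw [← aevalAeval_C_X_X (Polynomial.C f), Polynomial.aevalAeval_C]
  obtain ⟨m, f, h, hfh⟩ := hE
  have hfin : Module.Finite B (Polynomial (Polynomial O)) := by
    refine finite_of_hits (O := O) (F := F) (τ := Polynomial.C Polynomial.X) (t := Polynomial.X)
      (f := fun i => Sg (f i)) (g := h) hS hS0 ?_ ?_ ?_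
    · rw [halg, hψ, hF, Polynomial.map_C, RingHom.coe_coe, hSF, hC]
    · have := congrArg (Polynomial.map (Sg : B →+* Polynomial O)) hfh
      rw [Polynomial.map_X, Polynomial.map_sum] at this
      rw [this]
      refine Finset.sum_congr rfl fun i _ => ?_
      rw [Polynomial.map_mul, Polynomial.map_C, hC, halg, hψ]; rfl
    · rw [eq_top_iff]
      rintro e -
      rw [mem_adjoin_iff_aevalAeval]
      exact ⟨e, aevalAeval_C_X_X e⟩
  have hx' : ψ (algebraMap O B x) = Polynomial.C (Polynomial.C x) := by
    rw [AlgHom.commutes]; rfl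
  have hdvd : ∀ e : Polynomial (Polynomial O),
      e.map (Polynomial.mapRingHom (residue O)) = 0 → ∃ e', e = algebraMap O B x • e' := by
    intro e he
    obtain ⟨e', rfl⟩ := C_C_dvd_of_map_eq_zero hx he
    exact ⟨e', by rw [Algebra.smul_def, halg, hx']⟩
  obtain ⟨e, he⟩ := hdvd _ hg
  obtain ⟨g', hg'⟩ := exists_add_mul_map_eq_zero (x := algebraMap O B x) (g := g) (fun e : Polynomial (Polynomial O) => by
    obtain ⟨b, hb⟩ := hsurj (e.map (Polynomial.mapRingHom (residue O)))
    obtain ⟨e', he'⟩ := hdvd (e - ψ b) (by rw [Polynomial.map_sub, hψ, hb, sub_self])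
    exact ⟨b, e', by rw [← he', halg, add_sub_cancel]⟩) he
  exact ⟨g', hg'⟩

end Reduction

section Divide
variable {K : Type*} [Field K] [Algebra ℚ K]
variable {D : Derivation K (MvPolynomial (Fin 3) K) (MvPolynomial (Fin 3) K)}
  {E : MvPolynomial (Fin 3) K →ₐ[K] Polynomial (MvPolynomial (Fin 3) K)}

/-- The elements vanishing on the flow of a curve are the multiples of an invariant. -/
theorem exists_dvd_of_flow_eq_zero (h : IsExp D E) {s v w : MvPolynomial (Fin 3) K} (hs : D s = 1)
    (hvw : kerDer D = Algebra.adjoin K {v, w}) (Sg : MvPolynomial (Fin 3) K →ₐ[K] Polynomial K)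
    (hv : (Sg v).natDegree ≠ 0) :
    ∃ W, D W = 0 ∧ Sg W = 0 ∧ ∀ b,
      (E b).map (Sg : MvPolynomial (Fin 3) K →+* Polynomial K) = 0 → W ∣ b := by
  obtain ⟨W₀, hW₀⟩ := exists_aevalAeval_eq_zero_iff_dvd hv (Sg w)
  have hmem : ∀ r, D r = 0 ↔ ∃ H : Polynomial (Polynomial K),
      Polynomial.aevalAeval (R := K) v w H = r := fun r => by
    rw [← mem_kerDer, hvw, mem_adjoin_iff_aevalAeval]
  refine ⟨Polynomial.aevalAeval v w W₀, (hmem _).2 ⟨_, rfl⟩, ?_, fun b hb => ?_⟩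
  · rw [algHom_aevalAeval, hW₀]
  obtain ⟨F, rfl⟩ := (h.slice_bijective hs).2 b
  let ι : kerDer D →+* Polynomial K := (Sg : MvPolynomial (Fin 3) K →+* Polynomial K).comp
    (kerDer D).val
  have hE (F : Polynomial (kerDer D)) :
      (E (Polynomial.aeval s F)).map (Sg : MvPolynomial (Fin 3) K →+* Polynomial K) =
      (F.map ι).comp (Polynomial.X + Polynomial.C (Sg s)) := by
    induction F using Polynomial.induction_on' with
    | add f g hf hg =>
      rw [map_add, map_add, Polynomial.map_add, hf, hg, Polynomial.map_add, Polynomial.add_comp]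
    | monomial n r =>
      rw [Polynomial.aeval_monomial, map_mul, map_pow, h.apply_slice hs]
      have : E (algebraMap (kerDer D) (MvPolynomial (Fin 3) K) r) = Polynomial.C (r : MvPolynomial (Fin 3) K) :=
        h.apply_of_mem r.2
      rw [this]
      simp [ι, add_comm]
  rw [hE] at hb
  have hF : F.map ι = 0 := by
    have := congrArg (fun f => Polynomial.comp f (Polynomial.X - Polynomial.C (Sg s))) hb
    simpa [Polynomial.comp_assoc] using this
  rw [Polynomial.aeval_eq_sum_range]
  refine Finset.dvd_sum fun i _ => ?_
  rw [Algebra.smul_def]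
  refine Dvd.dvd.mul_right ?_ _
  obtain ⟨H, hH⟩ := (hmem (F.coeff i)).1 (F.coeff i).2
  have h1 : Sg (F.coeff i) = 0 := by
    have := congrArg (Polynomial.coeff · i) hF
    simpa [ι] using this
  rw [← hH, algHom_aevalAeval, hW₀] at h1
  change _ ∣ (F.coeff i : MvPolynomial (Fin 3) K)
  rw [← hH]
  exact map_dvd _ h1

end Divide

open IsLocalRing

section Compat
variable {A A' : Type*} [CommRing A] [CommRing A'] (f : A →+* A')
  {Sg : MvPolynomial (Fin 3) A →ₐ[A] Polynomial A}
  {Sg' : MvPolynomial (Fin 3) A' →ₐ[A'] Polynomial A'}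

theorem map_curve (h : ∀ i, (Sg (X i)).map f = Sg' (X i)) (b : MvPolynomial (Fin 3) A) :
    (Sg b).map f = Sg' (b.map f) := by
  have : (Polynomial.mapRingHom f).comp (Sg : MvPolynomial (Fin 3) A →+* Polynomial A) =
      (Sg' : MvPolynomial (Fin 3) A' →+* Polynomial A').comp (map f) := by
    refine MvPolynomial.ringHom_ext (fun c => ?_) fun i => ?_
    · have h1 : Sg (C c) = Polynomial.C c := AlgHom.commutes Sg c
      have h2 : Sg' (C (f c)) = Polynomial.C (f c) := AlgHom.commutes Sg' (f c)
      simp [h1, h2]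
    · simp [h]
  exact DFunLike.congr_fun this b

theorem map_flow [Algebra ℚ A] [Algebra ℚ A'] (h : ∀ i, (Sg (X i)).map f = Sg' (X i)) (a : A)
    (q : Polynomial A) (p : Polynomial (Polynomial A)) (b : MvPolynomial (Fin 3) A) :
    ((expHom a q p b).map (Sg : MvPolynomial (Fin 3) A →+* Polynomial A)).map
      (Polynomial.mapRingHom f) =
    (expHom (f a) (q.map f) (p.map (Polynomial.mapRingHom f)) (b.map f)).map
      (Sg' : MvPolynomial (Fin 3) A' →+* Polynomial A') := by
  rw [← (isExp_expHom a q p).map (isExp_expHom (f a) (q.map f) (p.map (Polynomial.mapRingHom f)))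
    (map f) (map_der a q p f), Polynomial.map_map, Polynomial.map_map]
  congr 1
  exact RingHom.ext (map_curve f h)

end Compat

section Lift
variable {O K : Type*} [CommRing O] [IsDomain O] [IsDiscreteValuationRing O] [Algebra ℚ O]
  [Field K] [Algebra ℚ K] [Algebra O K] [IsFractionRing O K] [Algebra ℚ (ResidueField O)]

theorem exists_lift_sub {x : O} (hx : Irreducible x) {a b : O} {q Q : Polynomial O}
    {p : Polynomial (Polynomial O)} (hQ : Polynomial.C a * Polynomial.derivative Q =
      Polynomial.C b * q) (ha : a ≠ 0) (hb : b ≠ 0) (hxb : x ∣ b)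
    (hQ0 : (Q.map (residue O)).natDegree ≠ 0) (hE : HitsVar (expHom a q p))
    (hxa : residue O a = 0)
    {P s : MvPolynomial (Fin 3) (ResidueField O)}
    (hP : der 0 (q.map (residue O)) (p.map (Polynomial.mapRingHom (residue O))) P = 0)
    (hs : der 0 (q.map (residue O)) (p.map (Polynomial.mapRingHom (residue O))) s = 1)
    (htop : Algebra.adjoin (ResidueField O) {X 0, P, s} = ⊤) (T : Polynomial (ResidueField O)) :
    ∃ W, der a q p W = 0 ∧ W.map (residue O) = P - Polynomial.aeval (X 0) T := by
  by_cases hPT : P - Polynomial.aeval (X 0) T = 0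
  · exact ⟨0, map_zero _, by rw [hPT, map_zero]⟩
  let K := FractionRing O
  have hQK : Algebra ℚ K := ((algebraMap O K).comp (algebraMap ℚ O)).toAlgebra
  obtain ⟨σ, hσ0, hσsurj, hσker⟩ := exists_curve
    (isExp_expHom 0 (q.map (residue O)) (p.map (Polynomial.mapRingHom (residue O))))
    (by simp) hP hs htop T
  obtain ⟨Z₀, hZ₀, -⟩ := exists_map_residue (σ (X 1))
  obtain ⟨U, hU, -⟩ := exists_map_residue (σ (X 2))
  have hbres : residue O b = 0 := (residue_eq_zero_iff_dvd hx b).2 hxb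
  obtain ⟨n, u, hu⟩ := IsDiscreteValuationRing.eq_unit_mul_pow_irreducible hb hx
  obtain ⟨Y, S, hY, hSdeg, hSred, e, he⟩ := exists_comp_sub_sub_dvd hx (c := Polynomial.C b * Z₀)
    hQ0 (by simp [hbres]) n
  let Z : Polynomial O := Z₀ + Polynomial.C (x * ((u⁻¹ : Oˣ) : O)) * e
  have hZ : Q.comp Y - Polynomial.C b * Z = S := by
    have hu' : Polynomial.C b * Polynomial.C (x * ((u⁻¹ : Oˣ) : O)) =
        Polynomial.C x ^ (n + 1) := by
      rw [← Polynomial.C_mul, ← Polynomial.C_pow, hu]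
      congr 1
      rw [pow_succ]
      linear_combination (x ^ n * x) * u.mul_inv
    simp only [Z, mul_add, ← mul_assoc, hu']
    linear_combination he
  let Sg : MvPolynomial (Fin 3) O →ₐ[O] Polynomial O := aeval ![Y, Z, U]
  let SgK : MvPolynomial (Fin 3) K →ₐ[K] Polynomial K :=
    aeval fun i => (![Y, Z, U] i).map (algebraMap O K)
  have hσ (i) : (Sg (X i)).map (residue O) = σ (X i) := by
    fin_cases i
    · simp [Sg, hY, hσ0]
    · simp [Sg, Z, hZ₀, (residue_eq_zero_iff_dvd hx x).2 dvd_rfl]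
    · simp [Sg, hU]
  have hSgK (i) : (Sg (X i)).map (algebraMap O K) = SgK (X i) := by
    simp [Sg, SgK]
  have hflow := map_flow (residue O) hσ a q p
  have hflowK := map_flow (algebraMap O K) hSgK a q p
  rw [hxa] at hflow
  have hSdeg' : S.natDegree = (Q.map (residue O)).natDegree :=
    le_antisymm hSdeg (by rw [← hSred]; exact Polynomial.natDegree_map_le)
  have hS0 : S.natDegree ≠ 0 := hSdeg' ▸ hQ0
  have hSlc : IsUnit S.leadingCoeff := by
    by_contra hcon
    have h1 : residue O S.leadingCoeff = 0 :=
      (residue_eq_zero_iff _).2 ((mem_maximalIdeal _).2 hcon)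
    have h2 : (S.map (residue O)).leadingCoeff = residue O S.leadingCoeff := by
      rw [Polynomial.leadingCoeff, hSred, ← hSdeg', ← hSred, Polynomial.coeff_map]; rfl
    rw [h1, Polynomial.leadingCoeff_eq_zero, hSred] at h2
    simp [h2] at hQ0
  let F : MvPolynomial (Fin 3) O := Polynomial.aeval (X 0) Q - C b * X 1
  have hF : der a q p F = 0 := by
    simp only [F, map_sub, derivation_aeval, Derivation.leibniz, der_X0, der_X1]
    have h1 := congrArg (Polynomial.aeval (X 0 : MvPolynomial (Fin 3) O)) hQ
    simp only [map_mul, Polynomial.aeval_C, MvPolynomial.algebraMap_eq] at h1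
    have h2 : der a q p (C b) = 0 := Derivation.map_algebraMap _ b
    rw [h2, smul_zero, smul_eq_mul, ← h1]
    ring
  have hSF : Sg F = S := by
    simp only [F, map_sub, map_mul, ← Polynomial.aeval_algHom_apply]
    have h1 : Sg (C b) = Polynomial.C b := AlgHom.commutes Sg b
    simp only [h1, Sg, aeval_X]
    simp only [Matrix.cons_val_zero, Matrix.cons_val_one]
    rw [← hZ]; rfl
  obtain ⟨g, hg⟩ := MvPolynomial.map_surjective (residue O) residue_surjective
    (P - Polynomial.aeval (X 0) T)
  obtain ⟨g', hg'⟩ := exists_flow_eq_zero hx hE Sg ((isExp_expHom a q p).apply_of_mem hF) hSF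
    hSlc hS0 (fun e => by
      obtain ⟨b, hb⟩ := hσsurj e
      obtain ⟨b, rfl⟩ := MvPolynomial.map_surjective (residue O) residue_surjective b
      exact ⟨b, by rw [hflow, hb]⟩)
    (g := g) (by rw [hflow, hg, hσker])
  set B₀ := g + algebraMap O (MvPolynomial (Fin 3) O) x * g' with hB₀
  have hB₀red : B₀.map (residue O) = P - Polynomial.aeval (X 0) T := by
    rw [hB₀, map_add, map_mul, hg, MvPolynomial.algebraMap_eq, map_C,
      (residue_eq_zero_iff_dvd hx x).2 dvd_rfl, C_0, zero_mul, add_zero]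
  have haK : algebraMap O K a ≠ 0 := by simpa using ha
  have hbK : algebraMap O K b ≠ 0 := by simpa using hb
  let QK : Polynomial K := Polynomial.C (algebraMap O K b)⁻¹ * Q.map (algebraMap O K)
  have hQK' : Polynomial.C (algebraMap O K a) * Polynomial.derivative QK =
      q.map (algebraMap O K) := by
    have h1 := congrArg (Polynomial.map (algebraMap O K)) hQ
    simp only [Polynomial.map_mul, Polynomial.map_C, ← Polynomial.derivative_map] at h1
    simp only [QK, Polynomial.derivative_C_mul]
    rw [mul_left_comm, h1, ← mul_assoc, ← Polynomial.C_mul, inv_mul_cancel₀ hbK, Polynomial.C_1,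
      one_mul]
  let DK := der (algebraMap O K a) (q.map (algebraMap O K))
    (p.map (Polynomial.mapRingHom (algebraMap O K)))
  have hsK : DK (C (algebraMap O K a)⁻¹ * X 0) = 1 := by
    have h2 : DK (C (algebraMap O K a)⁻¹) = 0 := Derivation.map_algebraMap _ _
    rw [Derivation.leibniz, h2, smul_zero, add_zero, smul_eq_mul, der_X0, ← C_mul,
      inv_mul_cancel₀ haK, C_1]
  have hv : (SgK (basePair (algebraMap O K a) QK
      (p.map (Polynomial.mapRingHom (algebraMap O K)))).1).natDegree ≠ 0 := by
    have h1 : SgK (basePair (algebraMap O K a) QK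
        (p.map (Polynomial.mapRingHom (algebraMap O K)))).1 =
        - (Polynomial.C (algebraMap O K b)⁻¹ * S.map (algebraMap O K)) := by
      rw [← hZ]
      simp only [basePair, map_sub, ← Polynomial.aeval_algHom_apply, SgK, aeval_X, QK]
      simp only [Matrix.cons_val_zero, Matrix.cons_val_one, map_mul, Polynomial.aeval_C,
        Polynomial.map_sub, Polynomial.map_mul, Polynomial.map_C, Polynomial.map_comp]
      rw [← Polynomial.comp_eq_aeval, mul_sub, ← mul_assoc, ← Polynomial.C_mul,
        inv_mul_cancel₀ hbK, Polynomial.algebraMap_eq]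
      simp
    rw [h1, Polynomial.natDegree_neg, Polynomial.natDegree_C_mul (inv_ne_zero hbK),
      Polynomial.natDegree_map_eq_of_injective (IsFractionRing.injective O K)]
    exact hS0
  obtain ⟨W₁, hDW₁, hSW₁, hW₁⟩ := exists_dvd_of_flow_eq_zero
    (isExp_expHom (algebraMap O K a) (q.map (algebraMap O K))
      (p.map (Polynomial.mapRingHom (algebraMap O K)))) hsK
    (kerDer_eq_adjoin_basePair haK _ hQK') SgK hv
  have hdvd : W₁ ∣ B₀.map (algebraMap O K) := hW₁ _ (by rw [← hflowK, hg', Polynomial.map_zero])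
  have hW₁0 : W₁ ≠ 0 := by
    rintro rfl
    rw [zero_dvd_iff, map_eq_zero_iff _ (map_algebraMap_injective (K := K))] at hdvd
    rw [hdvd, map_zero] at hB₀red
    exact hPT hB₀red.symm
  obtain ⟨c, hc, W, hW, hWres⟩ := exists_primitive (O := O) hW₁0
  have hDC : DK (C c) = 0 := Derivation.map_algebraMap _ _
  have hDW : der a q p W = 0 := by
    apply map_algebraMap_injective (K := K)
    rw [map_der, hW, map_zero]
    change DK _ = 0
    rw [Derivation.leibniz, hDC]
    change _ • der _ _ _ W₁ + _ = _
    rw [hDW₁, smul_zero, smul_zero, add_zero]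
  have hWB : W ∣ B₀ := by
    refine dvd_of_map_dvd (K := K) hWres ?_
    rw [hW]
    obtain ⟨e, he⟩ := hdvd
    exact ⟨C c⁻¹ * e, by rw [he, mul_mul_mul_comm, ← C_mul, mul_inv_cancel₀ hc, C_1, one_mul]⟩
  have hSW : Sg W = 0 := by
    apply Polynomial.map_injective _ (IsFractionRing.injective O K)
    rw [map_curve _ hSgK, hW, map_mul, hSW₁, mul_zero, Polynomial.map_zero]
  have hdvd' : P - Polynomial.aeval (X 0) T ∣ W.map (residue O) := by
    rw [← hσker, ← hflow, (isExp_expHom a q p).apply_of_mem hDW, Polynomial.map_C,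
      RingHom.coe_coe, hSW, Polynomial.C_0, Polynomial.map_zero]
  obtain ⟨m, hm⟩ := hdvd'
  obtain ⟨e, he⟩ := hWB
  have hme : (P - Polynomial.aeval (X 0) T) * (m * e.map (residue O)) =
      P - Polynomial.aeval (X 0) T := by
    rw [← mul_assoc, ← hm, ← map_mul, ← he, hB₀red]
  have hunit : e.map (residue O) * m = 1 := by
    rw [mul_comm]; exact mul_left_cancel₀ hPT (by rw [hme, mul_one])
  obtain ⟨r, -, hr⟩ := MvPolynomial.isUnit_iff_eq_C_of_isReduced.1 (IsUnit.of_mul_eq_one _ hunit)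
  obtain ⟨r, rfl⟩ := residue_surjective r
  refine ⟨C r * W, ?_, ?_⟩
  · have h2 : der a q p (C r) = 0 := Derivation.map_algebraMap _ _
    rw [Derivation.leibniz, h2, hDW, smul_zero, smul_zero, add_zero]
  · rw [map_mul, map_C, ← hr, mul_comm, ← map_mul, ← he, hB₀red]

end Lift

open IsLocalRing

section Slice
variable {O : Type*} [CommRing O] [IsDomain O] [IsDiscreteValuationRing O]

theorem lift_of_mem_adjoin {D : Derivation O (MvPolynomial (Fin 3) O) (MvPolynomial (Fin 3) O)}
    {f g : MvPolynomial (Fin 3) (ResidueField O)} {F G : MvPolynomial (Fin 3) O} (hF : D F = 0)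
    (hG : D G = 0) (hFf : F.map (residue O) = f) (hGg : G.map (residue O) = g)
    {h : MvPolynomial (Fin 3) (ResidueField O)}
    (hh : h ∈ Algebra.adjoin (ResidueField O) {f, g}) :
    ∃ H, D H = 0 ∧ H.map (residue O) = h := by
  induction hh using Algebra.adjoin_induction with
  | mem h hh =>
    obtain rfl | rfl := hh
    exacts [⟨F, hF, hFf⟩, ⟨G, hG, hGg⟩]
  | algebraMap r =>
    obtain ⟨r, rfl⟩ := residue_surjective r
    exact ⟨C r, Derivation.map_algebraMap D r, map_C _ _⟩
  | add h₁ h₂ _ _ ih₁ ih₂ =>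
    obtain ⟨H₁, h₁, rfl⟩ := ih₁
    obtain ⟨H₂, h₂, rfl⟩ := ih₂
    exact ⟨H₁ + H₂, by rw [map_add, h₁, h₂, add_zero], map_add _ _ _⟩
  | mul h₁ h₂ _ _ ih₁ ih₂ =>
    obtain ⟨H₁, h₁, rfl⟩ := ih₁
    obtain ⟨H₂, h₂, rfl⟩ := ih₂
    exact ⟨H₁ * H₂, by rw [Derivation.leibniz, h₁, h₂, smul_zero, smul_zero, add_zero],
      map_mul _ _ _⟩

theorem exists_slice_of_lift {x a : O} (hx : Irreducible x) (ha : a ≠ 0) {q : Polynomial O}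
    {p : Polynomial (Polynomial O)}
    (hlift : ∀ h, der (residue O a) (q.map (residue O))
      (p.map (Polynomial.mapRingHom (residue O))) h = 0 →
        ∃ H, der a q p H = 0 ∧ H.map (residue O) = h) :
    ∃ s, der a q p s = 1 := by
  have hC (r : O) : der a q p (C r) = 0 := Derivation.map_algebraMap _ r
  have key : ∀ (n : ℕ) (u : Oˣ) (s : MvPolynomial (Fin 3) O), der a q p s = C (u * x ^ n : O) →
      ∃ s, der a q p s = 1 := by
    intro n u
    induction n with
    | zero =>
      intro s hs
      refine ⟨C ((u⁻¹ : Oˣ) : O) * s, ?_⟩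
      rw [Derivation.leibniz, hC, smul_zero, add_zero, hs, smul_eq_mul, ← C_mul]
      simp
    | succ n ih =>
      intro s hs
      have hx0 : residue O x = 0 := (residue_eq_zero_iff_dvd hx x).2 dvd_rfl
      obtain ⟨H, hH, hHs⟩ := hlift (s.map (residue O)) (by
        rw [← map_der, hs, map_C, map_mul, map_pow, hx0]; simp)
      obtain ⟨s', hs'⟩ := (map_residue_eq_zero_iff hx (s - H)).1 (by rw [map_sub, hHs, sub_self])
      refine ih s' ?_
      have hCx : (C x : MvPolynomial (Fin 3) O) ≠ 0 := by simpa using hx.ne_zero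
      apply mul_left_cancel₀ hCx
      have := congrArg (der a q p) hs'
      rw [map_sub, hH, sub_zero, hs, Derivation.leibniz, hC, smul_zero, add_zero,
        smul_eq_mul] at this
      rw [← this, ← C_mul]
      congr 1; ring
  obtain ⟨n, u, hu⟩ := IsDiscreteValuationRing.eq_unit_mul_pow_irreducible ha hx
  exact key n u (X 0) (by rw [der_X0, hu])

end Slice

section Jacobian
variable {A : Type*} [CommRing A]

/-- The Jacobian derivation `h ↦ ∂(h, f, g) / ∂(X₀, X₁, X₂)`. -/
noncomputable def jac (f g : MvPolynomial (Fin 3) A) :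
    Derivation A (MvPolynomial (Fin 3) A) (MvPolynomial (Fin 3) A) :=
  (pderiv 1 f * pderiv 2 g - pderiv 2 f * pderiv 1 g) • pderiv 0 +
  (pderiv 2 f * pderiv 0 g - pderiv 0 f * pderiv 2 g) • pderiv 1 +
  (pderiv 0 f * pderiv 1 g - pderiv 1 f * pderiv 0 g) • pderiv 2

theorem jac_apply (f g h : MvPolynomial (Fin 3) A) : jac f g h =
    (pderiv 1 f * pderiv 2 g - pderiv 2 f * pderiv 1 g) * pderiv 0 h +
    (pderiv 2 f * pderiv 0 g - pderiv 0 f * pderiv 2 g) * pderiv 1 h +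
    (pderiv 0 f * pderiv 1 g - pderiv 1 f * pderiv 0 g) * pderiv 2 h := by
  simp [jac]

theorem jac_left (f g : MvPolynomial (Fin 3) A) : jac f g f = 0 := by
  rw [jac_apply]; ring

theorem jac_right (f g : MvPolynomial (Fin 3) A) : jac f g g = 0 := by
  rw [jac_apply]; ring

theorem jac_swap (f g : MvPolynomial (Fin 3) A) : jac g (-f) = jac f g := by
  refine Derivation.ext fun h => ?_
  simp only [jac_apply, map_neg]; ring

theorem jac_add_aeval_left (f g : MvPolynomial (Fin 3) A) (F : Polynomial A) :
    jac (f + Polynomial.aeval g F) g = jac f g := by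
  refine Derivation.ext fun h => ?_
  simp only [jac_apply, map_add, Derivation.map_aeval, smul_eq_mul]; ring

theorem jac_add_aeval_right (f g : MvPolynomial (Fin 3) A) (F : Polynomial A) :
    jac f (g + Polynomial.aeval f F) = jac f g := by
  refine Derivation.ext fun h => ?_
  simp only [jac_apply, map_add, Derivation.map_aeval, smul_eq_mul]; ring

theorem jac_C_mul_left (c : A) (f g : MvPolynomial (Fin 3) A) :
    jac (C c * f) g = (C c : MvPolynomial (Fin 3) A) • jac f g := by
  refine Derivation.ext fun h => ?_
  simp only [jac_apply, pderiv_C_mul, Derivation.smul_apply, smul_eq_mul]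
  ring

theorem jac_C_mul_right (c : A) (f g : MvPolynomial (Fin 3) A) :
    jac f (C c * g) = (C c : MvPolynomial (Fin 3) A) • jac f g := by
  refine Derivation.ext fun h => ?_
  simp only [jac_apply, pderiv_C_mul, Derivation.smul_apply, smul_eq_mul]
  ring

theorem map_jac {A' : Type*} [CommRing A'] (φ : A →+* A') (f g h : MvPolynomial (Fin 3) A) :
    map φ (jac f g h) = jac (map φ f) (map φ g) (map φ h) := by
  simp only [jac_apply, map_add, map_mul, map_sub, pderiv_map]

theorem derivation_mvaeval {B : Type*} [CommRing B] [Algebra A B] (D : Derivation A B B)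
    {σ : Type*} [Fintype σ] (f : σ → B) (H : MvPolynomial σ A) :
    D (aeval f H) = ∑ l, aeval f (pderiv l H) * D (f l) := by
  classical
  induction H using MvPolynomial.induction_on with
  | C r => simp
  | add p q hp hq => simp only [map_add, hp, hq, add_mul, Finset.sum_add_distrib]
  | mul_X p i hp =>
    simp only [map_mul, Derivation.leibniz, hp, aeval_X, smul_eq_mul, map_add, add_mul,
      Finset.sum_add_distrib, pderiv_X, Finset.mul_sum]
    congr 1
    · simp [Pi.single_apply, Finset.sum_ite_eq]
    · refine Finset.sum_congr rfl fun l _ => by ring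

theorem isUnit_jac {v w s : MvPolynomial (Fin 3) A} (htop : Algebra.adjoin A {v, w, s} = ⊤) :
    IsUnit (jac v w s) := by
  have hsurj : Function.Surjective (aeval (R := A) ![v, w, s]) := by
    rw [← AlgHom.range_eq_top, eq_top_iff, ← htop, Algebra.adjoin_le_iff]
    rintro b (rfl | rfl | rfl)
    · exact ⟨X 0, by simp⟩
    · exact ⟨X 1, by simp⟩
    · exact ⟨X 2, by simp⟩
  choose H hH using fun i : Fin 3 => hsurj (X i)
  let M : Matrix (Fin 3) (Fin 3) (MvPolynomial (Fin 3) A) :=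
    Matrix.of fun l j => pderiv j (![v, w, s] l)
  let N : Matrix (Fin 3) (Fin 3) (MvPolynomial (Fin 3) A) :=
    Matrix.of fun i l => aeval ![v, w, s] (pderiv l (H i))
  have hNM : N * M = 1 := by
    refine Matrix.ext fun i j => ?_
    rw [Matrix.mul_apply, Matrix.one_apply]
    refine (derivation_mvaeval (pderiv j) ![v, w, s] (H i)).symm.trans ?_
    rw [hH, pderiv_X, Pi.single_apply]
  have hdet : jac v w s = M.det := by
    rw [Matrix.det_fin_three, jac_apply]
    simp [M]
    ring
  rw [hdet]
  exact IsUnit.of_mul_eq_one_right N.det (by rw [← Matrix.det_mul, hNM, Matrix.det_one])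

end Jacobian

open IsLocalRing

section Independence
variable {k R : Type*} [CommRing k] [CommRing R] [Algebra k R]

theorem algebraicIndependent_pair_iff_aevalAeval {v w : R} : AlgebraicIndependent k ![v, w] ↔
    Function.Injective (Polynomial.aevalAeval (R := k) v w) := by
  let φ : MvPolynomial (Fin 2) k →ₐ[k] Polynomial (Polynomial k) :=
    aeval ![Polynomial.C Polynomial.X, Polynomial.X]
  let ψ : Polynomial (Polynomial k) →ₐ[k] MvPolynomial (Fin 2) k :=
    Polynomial.aevalAeval (X 0) (X 1)
  have hφψ : ∀ F, φ (ψ F) = F := by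
    intro F
    rw [algHom_aevalAeval]
    simp only [φ, aeval_X, Matrix.cons_val_zero, Matrix.cons_val_one]
    have : (Polynomial.aevalAeval (Polynomial.C Polynomial.X) Polynomial.X :
      Polynomial (Polynomial k) →ₐ[k] Polynomial (Polynomial k)).toRingHom = RingHom.id _ := by
      ext <;> simp
    exact DFunLike.congr_fun this F
  have hψφ : ψ.comp φ = AlgHom.id k _ := by
    refine MvPolynomial.algHom_ext fun i => ?_
    fin_cases i
    all_goals simp [φ, ψ]
  have h1 : ∀ F, aeval ![v, w] (ψ F) = Polynomial.aevalAeval (R := k) v w F := by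
    intro F
    rw [algHom_aevalAeval]; simp
  rw [algebraicIndependent_iff_injective_aeval]
  constructor
  · intro h F G hFG
    rw [← h1, ← h1] at hFG
    rw [← hφψ F, h hFG, hφψ]
  · intro h F G hFG
    rw [← AlgHom.id_apply (R := k) F, ← AlgHom.id_apply (R := k) G, ← hψφ, AlgHom.comp_apply,
      AlgHom.comp_apply]
    rw [← AlgHom.id_apply (R := k) F, ← AlgHom.id_apply (R := k) G, ← hψφ, AlgHom.comp_apply,
      AlgHom.comp_apply, h1, h1] at hFG
    rw [h hFG]

/-- An element of `k[x, y]` is algebraically independent of a nonconstant polynomial in `x`,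
unless it is itself a polynomial in `x`. -/
theorem algebraicIndependent_or_eq_aeval [IsDomain k] {v w r : R}
    (h : AlgebraicIndependent k ![v, w]) {f : Polynomial k} (hf : f.natDegree ≠ 0)
    {H : Polynomial (Polynomial k)} (hr : Polynomial.aevalAeval v w H = r) :
    AlgebraicIndependent k ![Polynomial.aeval v f, r] ∨ ∃ g : Polynomial k,
      r = Polynomial.aeval v g := by
  rw [algebraicIndependent_pair_iff_aevalAeval] at h ⊢
  by_cases hH : H.natDegree = 0
  · right
    obtain ⟨g, rfl⟩ := Polynomial.natDegree_eq_zero.1 hH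
    exact ⟨g, by rw [← hr, Polynomial.aevalAeval_C]⟩
  left
  have h1 : ∀ F : Polynomial (Polynomial k),
      Polynomial.aevalAeval (Polynomial.aeval v f) r F = Polynomial.aevalAeval v w
        (Polynomial.aeval H (F.map (Polynomial.compRingHom f))) := by
    intro F
    have : (Polynomial.aevalAeval (Polynomial.aeval v f) r).toRingHom =
        ((Polynomial.aevalAeval v w).toRingHom.comp (Polynomial.aeval H).toRingHom).comp
          (Polynomial.mapRingHom (Polynomial.compRingHom f)) := by
      ext
      · simp
      · simp
      · simp [← hr]
    exact DFunLike.congr_fun this F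
  have h2 : Function.Injective (Polynomial.compRingHom f) := by
    rw [injective_iff_map_eq_zero]
    intro g hg
    rw [Polynomial.coe_compRingHom_apply, Polynomial.comp_eq_zero_iff] at hg
    rcases hg with hg | ⟨_, hg⟩
    · exact hg
    · exact (hf (by rw [hg, Polynomial.natDegree_C])).elim
  have h3 := transcendental_iff_injective.1 (Polynomial.transcendental H hH
    (by simpa using fun h0 : H = 0 => hH (by rw [h0, Polynomial.natDegree_zero])))
  intro F G hFG
  rw [h1, h1] at hFG
  exact Polynomial.map_injective _ h2 (h3 (h hFG))

theorem dvd_aeval_sub_aeval {t u u' w : R} (h : t ∣ u - u') (G : MvPolynomial (Fin 2) k) :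
    t ∣ aeval ![u, w] G - aeval ![u', w] G := by
  rw [← Ideal.mem_span_singleton, ← Ideal.Quotient.eq] at *
  let m := Ideal.Quotient.mkₐ k (Ideal.span {t})
  change m _ = m _ at h
  change m _ = m _
  have : m.comp (aeval ![u, w]) = m.comp (aeval ![u', w]) := by
    refine MvPolynomial.algHom_ext fun i => ?_
    fin_cases i
    · simpa using h
    · simp
  exact DFunLike.congr_fun this G

end Independence

section JacobianBase
variable {A : Type*} [CommRing A] [IsDomain A] [Algebra ℚ A]

theorem derivation_eq_sum (D : Derivation A (MvPolynomial (Fin 3) A) (MvPolynomial (Fin 3) A))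
    (f : MvPolynomial (Fin 3) A) :
    D f = pderiv 0 f * D (X 0) + pderiv 1 f * D (X 1) + pderiv 2 f * D (X 2) := by
  simpa [Fin.sum_univ_three] using derivation_mvaeval D X f

theorem jac_basePair {a : A} (ha : a ≠ 0) {q Q : Polynomial A} (p : Polynomial (Polynomial A))
    (hQ : Polynomial.C a * Polynomial.derivative Q = q) :
    jac (basePair a Q p).1 (basePair a Q p).2 = der a q p := by
  have h1 := der_basePair_fst a q Q p hQ
  have h2 := der_basePair_snd a q Q p hQ
  rw [derivation_eq_sum, der_X0, der_X1, der_X2] at h1 h2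
  have e0 : pderiv 0 (basePair a Q p).1 = - Polynomial.aeval (X 0) (Polynomial.derivative Q) := by
    simp [basePair, Derivation.map_aeval, pderiv_X]
  have e1 : pderiv 1 (basePair a Q p).1 = 1 := by
    simp [basePair, Derivation.map_aeval, pderiv_X]
  have e2 : pderiv 2 (basePair a Q p).1 = 0 := by
    simp [basePair, Derivation.map_aeval, pderiv_X]
  have e3 : pderiv 2 (basePair a Q p).2 = C a := by
    have h : pderiv 2 (X 1 - Polynomial.aeval (X 0) Q : MvPolynomial (Fin 3) A) = 0 := e2
    simp only [basePair]
    rw [map_sub, derivation_aevalAeval _ h]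
    simp [pderiv_X]
  have hCa : (C a : MvPolynomial (Fin 3) A) ≠ 0 := by simpa using ha
  have hq : Polynomial.aeval (X 0 : MvPolynomial (Fin 3) A) q =
      C a * Polynomial.aeval (X 0) (Polynomial.derivative Q) := by
    rw [← hQ]; simp [algebraMap_eq]
  refine MvPolynomial.derivation_ext fun i => ?_
  rw [jac_apply, e0, e1, e2, e3]
  rw [e3] at h2
  fin_cases i
  · simp [pderiv_X, der_X0]
  · simp [pderiv_X, der_X1, hq, mul_comm]
  · have d2 := der_X2 a q p
    generalize Polynomial.aevalAeval (X 0 : MvPolynomial (Fin 3) A) (X 1) p = r at h2 d2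
    simp [pderiv_X, d2]
    apply mul_left_cancel₀ hCa
    linear_combination -h2 + pderiv 1 (basePair a Q p).2 * hq
end JacobianBase

section JacobianTame
variable {K : Type*} [Field K]

theorem Tame.jac_eq {b p : MvPolynomial (Fin 3) K × MvPolynomial (Fin 3) K} (h : Tame K b p) :
    jac p.1 p.2 = jac b.1 b.2 := by
  obtain ⟨l, rfl⟩ := h
  induction l generalizing b with
  | nil => rfl
  | cons e l ih =>
    rw [run_cons, ih]
    unfold elemStep
    split_ifs
    · simp only [one_mul, jac_add_aeval_left]
    · simp only [one_mul, jac_add_aeval_right]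

end JacobianTame

section Lift
variable {O : Type*} [CommRing O] [IsDomain O] [IsDiscreteValuationRing O] [Algebra ℚ O]
  [Algebra ℚ (ResidueField O)]

theorem exists_lift {x : O} (hx : Irreducible x) {a b : O} {q Q : Polynomial O}
    {p : Polynomial (Polynomial O)} (hQ : Polynomial.C a * Polynomial.derivative Q =
      Polynomial.C b * q) (ha : a ≠ 0) (hb : b ≠ 0) (hxb : x ∣ b)
    (hQ0 : (Q.map (residue O)).natDegree ≠ 0) (hE : HitsVar (expHom a q p))
    (hxa : residue O a = 0) {P s : MvPolynomial (Fin 3) (ResidueField O)}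
    (hs : der 0 (q.map (residue O)) (p.map (Polynomial.mapRingHom (residue O))) s = 1)
    (hker : kerDer (der 0 (q.map (residue O)) (p.map (Polynomial.mapRingHom (residue O)))) =
      Algebra.adjoin (ResidueField O) {X 0, P})
    (htop : Algebra.adjoin (ResidueField O) {X 0, P, s} = ⊤) {h : MvPolynomial (Fin 3) (ResidueField O)}
    (hh : der 0 (q.map (residue O)) (p.map (Polynomial.mapRingHom (residue O))) h = 0) :
    ∃ H, der a q p H = 0 ∧ H.map (residue O) = h := by
  have hP : der 0 (q.map (residue O)) (p.map (Polynomial.mapRingHom (residue O))) P = 0 := by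
    rw [← mem_kerDer, hker]
    exact Algebra.subset_adjoin (by simp)
  have key := exists_lift_sub hx hQ ha hb hxb hQ0 hE hxa hP hs htop
  obtain ⟨W₀, hW₀, hW₀P⟩ := key 0
  obtain ⟨W₁, hW₁, hW₁P⟩ := key Polynomial.X
  simp only [map_zero, sub_zero, Polynomial.aeval_X] at hW₀P hW₁P
  rw [← mem_kerDer, hker] at hh
  exact lift_of_mem_adjoin (F := W₀ - W₁) (by rw [map_sub, hW₀, hW₁, sub_zero]) hW₀
    (by rw [map_sub, hW₀P, hW₁P]; ring) hW₀P hh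

end Lift

open IsLocalRing

section Degrees
variable {O : Type*} [CommRing O] [IsDomain O] [IsDiscreteValuationRing O] [Algebra ℚ O]

/-- If a lift of the coordinate is a polynomial in `V` and `W` up to denominators, then the degrees
of the reductions of `V` and `W` divide each other. -/
theorem natDegree_lt_of_not_dvd {V W H : Polynomial O} (hV : (V.map (residue O)).natDegree ≠ 0)
    (hW : W.map (residue O) ≠ 0) (hH : H.map (residue O) = Polynomial.X) {d : O} (hd : d ≠ 0)
    {G : MvPolynomial (Fin 2) O} (hG : Polynomial.C d * H = aeval ![V, W] G)
    (hdvd : ¬ (V.map (residue O)).natDegree ∣ (W.map (residue O)).natDegree) :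
    (W.map (residue O)).natDegree < (V.map (residue O)).natDegree := by
  obtain ⟨x, hx⟩ := IsDiscreteValuationRing.exists_irreducible O
  obtain ⟨N, u, rfl⟩ := IsDiscreteValuationRing.eq_unit_mul_pow_irreducible hd hx
  obtain ⟨y, S, hy, hSdeg, hS, hdiv⟩ := exists_comp_sub_sub_dvd hx hV
    (c := 0) (Polynomial.map_zero _) N
  rw [sub_zero] at hdiv
  have hSV : S.natDegree = (V.map (residue O)).natDegree :=
    le_antisymm hSdeg (hS ▸ Polynomial.natDegree_map_le)
  have hSu : IsUnit S.leadingCoeff := by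
    by_contra h
    have h0 : residue O S.leadingCoeff = 0 := by
      rwa [residue_eq_zero_iff, mem_maximalIdeal, mem_nonunits_iff]
    have h1 : (V.map (residue O)).leadingCoeff = 0 := by
      rw [Polynomial.leadingCoeff, ← hSV, ← hS, Polynomial.coeff_map]
      exact h0
    rw [Polynomial.leadingCoeff_eq_zero] at h1
    exact hV (by rw [h1, Polynomial.natDegree_zero])
  have hgW : (W.comp y).map (residue O) = W.map (residue O) := by
    rw [Polynomial.map_comp, hy, Polynomial.comp_X]
  obtain ⟨r, hr⟩ := hdiv.trans (dvd_aeval_sub_aeval (k := O) (w := W.comp y)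
    (show V.comp y - S ∣ V.comp y - S from dvd_rfl) G)
  have hcomp : aeval ![V.comp y, W.comp y] G = Polynomial.C ((u : O) * x ^ N) * H.comp y := by
    have := congrArg (Polynomial.aeval (R := O) y) hG
    rw [map_mul, Polynomial.aeval_C, ← Polynomial.comp_eq_aeval, ← AlgHom.comp_apply] at this
    have h2 : (Polynomial.aeval (R := O) y).comp (aeval ![V, W]) =
        aeval ![V.comp y, W.comp y] := by
      refine MvPolynomial.algHom_ext fun i => ?_
      fin_cases i <;> simp [Polynomial.comp_eq_aeval]
    rw [h2] at this
    exact this.symm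
  have hu : (Polynomial.C ((u : O) * x ^ N) : Polynomial O) *
      (Polynomial.C ((u⁻¹ : Oˣ) : O) * Polynomial.C x) = Polynomial.C x ^ (N + 1) := by
    rw [← Polynomial.C_mul, ← Polynomial.C_mul, ← Polynomial.C_pow]
    congr 1
    calc _ = ((u : O) * ((u⁻¹ : Oˣ) : O)) * x ^ (N + 1) := by ring
      _ = _ := by rw [Units.mul_inv, one_mul]
  let h := H.comp y - Polynomial.C ((u⁻¹ : Oˣ) : O) * Polynomial.C x * r
  have hh : Polynomial.C ((u : O) * x ^ N) * h = aeval ![S, W.comp y] G := by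
    simp only [h]
    rw [mul_sub, ← hcomp, ← mul_assoc, hu]
    linear_combination hr
  have hx0 : residue O x = 0 := (residue_eq_zero_iff_dvd hx x).2 dvd_rfl
  rw [← hgW, ← hSV]
  let K := FractionRing O
  refine Polynomial.AMVal.natDegree_lt_of_not_dvd (K := K) (h := h) hSu (by rwa [hSV])
    (by rwa [hgW]) ?_ ?_ (by rwa [hgW, hSV])
  · simp [h, Polynomial.map_comp, hy, hH, hx0]
  · have := congrArg (Polynomial.map (algebraMap O K)) hh
    rw [Polynomial.map_mul, Polynomial.map_C] at this
    have h2 : (aeval ![S, W.comp y] G).map (algebraMap O K) =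
        aeval ![S.map (algebraMap O K), (W.comp y).map (algebraMap O K)]
          (G.map (algebraMap O K)) := by
      have : (Polynomial.mapRingHom (algebraMap O K)).comp
          (aeval (R := O) ![S, W.comp y] : MvPolynomial (Fin 2) O →+* Polynomial O) =
          (aeval (R := K) ![S.map (algebraMap O K), (W.comp y).map (algebraMap O K)] :
            MvPolynomial (Fin 2) K →+* Polynomial K).comp (map (algebraMap O K)) := by
        refine MvPolynomial.ringHom_ext (fun c => by simp) fun i => ?_
        fin_cases i <;> simp
      exact DFunLike.congr_fun this G
    have hd' : algebraMap O K ((u : O) * x ^ N) ≠ 0 := by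
      rwa [Ne, FaithfulSMul.algebraMap_eq_zero_iff]
    rw [h2] at this
    rw [mem_adjoin_pair_iff]
    refine ⟨C (algebraMap O K ((u : O) * x ^ N))⁻¹ * G.map (algebraMap O K), ?_⟩
    rw [map_mul, ← this, aeval_C, ← mul_assoc, Polynomial.algebraMap_eq, ← Polynomial.C_mul,
      inv_mul_cancel₀ hd', Polynomial.C_1, one_mul]

end Degrees

section Scaled
variable {O : Type*} [CommRing O] [IsDomain O] {K : Type*} [Field K] [Algebra O K]
  [IsFractionRing O K]

/-- The pair is obtained from `b` by elementary transformations, up to constant factors. -/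
def Scaled (b : MvPolynomial (Fin 3) K × MvPolynomial (Fin 3) K) (v w : MvPolynomial (Fin 3) O) :
    Prop :=
  ∃ v₁ w₁ c d, c ≠ 0 ∧ d ≠ 0 ∧ Tame K b (v₁, w₁) ∧ v.map (algebraMap O K) = C c * v₁ ∧
    w.map (algebraMap O K) = C d * w₁

variable {b : MvPolynomial (Fin 3) K × MvPolynomial (Fin 3) K} {v w : MvPolynomial (Fin 3) O}

theorem Scaled.swap (h : Scaled b v w) : Scaled b w (-v) := by
  obtain ⟨v₁, w₁, c, d, hc, hd, ht, hv, hw⟩ := h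
  exact ⟨w₁, -v₁, d, c, hd, hc, ht.swap, hw, by rw [map_neg, hv]; ring⟩

theorem Scaled.sub (h : Scaled b v w) (F : Polynomial O) :
    Scaled b v (w - Polynomial.aeval v F) := by
  obtain ⟨v₁, w₁, c, d, hc, hd, ht, hv, hw⟩ := h
  refine ⟨v₁, w₁ + Polynomial.aeval v₁ (Polynomial.C (-d⁻¹) *
    (F.map (algebraMap O K)).comp (Polynomial.C c * Polynomial.X)), c, d, hc, hd, ht.right _, hv, ?_⟩
  have h1 : (C d * C (-d⁻¹) : MvPolynomial (Fin 3) K) = -1 := by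
    rw [← C_mul, mul_neg, mul_inv_cancel₀ hd, C_neg, C_1]
  rw [map_sub, map_polynomial_aeval, hv, hw, map_mul, Polynomial.aeval_comp, Polynomial.aeval_C,
    map_mul, Polynomial.aeval_C, Polynomial.aeval_X, algebraMap_eq, mul_add, ← mul_assoc, h1]
  ring

theorem Scaled.of_C_mul {x : O} (hx : x ≠ 0) (h : Scaled b v (C x * w)) : Scaled b v w := by
  obtain ⟨v₁, w₁, c, d, hc, hd, ht, hv, hw⟩ := h
  have hx' : algebraMap O K x ≠ 0 := by rwa [Ne, FaithfulSMul.algebraMap_eq_zero_iff]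
  refine ⟨v₁, w₁, c, (algebraMap O K x)⁻¹ * d, hc, mul_ne_zero (inv_ne_zero hx') hd, ht, hv, ?_⟩
  rw [C_mul, mul_assoc, ← hw, map_mul, map_C, ← mul_assoc, ← C_mul, inv_mul_cancel₀ hx', C_1,
    one_mul]

theorem Scaled.map_jac (h : Scaled b v w) : ∃ c : K, c ≠ 0 ∧ ∀ r, (jac v w r).map (algebraMap O K) =
    C c * jac b.1 b.2 (r.map (algebraMap O K)) := by
  obtain ⟨v₁, w₁, c, d, hc, hd, ht, hv, hw⟩ := h
  refine ⟨c * d, mul_ne_zero hc hd, fun r => ?_⟩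
  rw [TriAction.map_jac, hv, hw, jac_C_mul_left, jac_C_mul_right, ← ht.jac_eq, C_mul, mul_assoc]
  rfl

theorem Scaled.adjoin_eq (h : Scaled b v w) : Algebra.adjoin K {v.map (algebraMap O K),
    w.map (algebraMap O K)} = Algebra.adjoin K {b.1, b.2} := by
  obtain ⟨v₁, w₁, c, d, hc, hd, ht, hv, hw⟩ := h
  have key : ∀ (S : Subalgebra K (MvPolynomial (Fin 3) K)) {e : K} (_ : e ≠ 0) (f),
      C e * f ∈ S ↔ f ∈ S := by
    intro S e he f
    rw [← smul_eq_C_mul]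
    exact ⟨fun h => by simpa [smul_smul, he] using S.smul_mem h e⁻¹, fun h => S.smul_mem h e⟩
  rw [← ht.adjoin_eq, hv, hw]
  apply le_antisymm <;> rw [Algebra.adjoin_le_iff] <;> rintro r (rfl | rfl)
  · exact (key _ hc _).2 (Algebra.subset_adjoin (by simp))
  · exact (key _ hd _).2 (Algebra.subset_adjoin (by simp))
  · exact (key _ hc _).1 (Algebra.subset_adjoin (by simp))
  · exact (key _ hd _).1 (Algebra.subset_adjoin (by simp))

end Scaled

open IsLocalRing

section Loop
variable {O : Type*} [CommRing O] [IsDomain O] [IsDiscreteValuationRing O] [Algebra ℚ O]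
  {K : Type*} [Field K] [Algebra O K] [IsFractionRing O K] [Algebra ℚ K]
  {b : MvPolynomial (Fin 3) K × MvPolynomial (Fin 3) K}
  {D : Derivation O (MvPolynomial (Fin 3) O) (MvPolynomial (Fin 3) O)}
  {v w s H : MvPolynomial (Fin 3) O}

theorem Scaled.apply_eq_zero
    (hJ : ∀ r, (D r).map (algebraMap O K) = jac b.1 b.2 (r.map (algebraMap O K)))
    (h : Scaled b v w) : D v = 0 ∧ D w = 0 := by
  obtain ⟨c, hc, hc'⟩ := h.map_jac
  have hC : (C c : MvPolynomial (Fin 3) K) ≠ 0 := by simpa using hc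
  constructor <;> apply map_algebraMap_injective (K := K) <;> apply mul_left_cancel₀ hC <;>
    rw [hJ, ← hc', map_zero, mul_zero]
  · rw [jac_left, map_zero]
  · rw [jac_right, map_zero]

theorem Scaled.exists_jac_eq
    (hJ : ∀ r, (D r).map (algebraMap O K) = jac b.1 b.2 (r.map (algebraMap O K)))
    (hs : D s = 1) (h : Scaled b v w) : ∃ c, c ≠ 0 ∧ jac v w s = C c := by
  obtain ⟨c, hc, hc'⟩ := h.map_jac
  have h1 := hc' s
  rw [← hJ, hs, map_one, mul_one] at h1
  have h2 : algebraMap O K (coeff 0 (jac v w s)) = c := by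
    rw [← coeff_map, h1, coeff_zero_C]
  refine ⟨coeff 0 (jac v w s), fun h0 => hc (by rw [← h2, h0, map_zero]), ?_⟩
  apply map_algebraMap_injective (K := K)
  rw [h1, map_C, h2]

theorem Scaled.natDegree_dvd
    (hJ : ∀ r, (D r).map (algebraMap O K) = jac b.1 b.2 (r.map (algebraMap O K)))
    (hker : ∀ r, jac b.1 b.2 r = 0 → r ∈ Algebra.adjoin K {b.1, b.2})
    (hH : D H = 0) (hHX : H.map (residue O) = X 0) (h : Scaled b v w)
    {f g : Polynomial (ResidueField O)} (hv : v.map (residue O) = Polynomial.aeval (X 0) f)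
    (hw : w.map (residue O) = Polynomial.aeval (X 0) g) (hf : f.natDegree ≠ 0)
    (hfg : f.natDegree ≤ g.natDegree) : f.natDegree ∣ g.natDegree := by
  have hHK := hker (H.map (algebraMap O K)) (by rw [← hJ, hH, map_zero])
  rw [← h.adjoin_eq, mem_adjoin_pair_iff] at hHK
  obtain ⟨H', hH'⟩ := hHK
  obtain ⟨d, hd, G, hG⟩ := exists_map_eq_C_mul (nonZeroDivisors O) H'
  have hd0 := nonZeroDivisors.ne_zero hd
  have h1 : C d * H = aeval ![v, w] G := by
    apply map_algebraMap_injective (K := K)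
    rw [map_aeval_pair, hG, map_mul, map_mul, map_C, ← hH', aeval_C, algebraMap_eq]
  let π : MvPolynomial (Fin 3) O →ₐ[O] Polynomial O := aeval ![Polynomial.X, 0, 0]
  let π' : MvPolynomial (Fin 3) (ResidueField O) →ₐ[ResidueField O] Polynomial (ResidueField O) :=
    aeval ![Polynomial.X, 0, 0]
  have hππ : ∀ r, (π r).map (residue O) = π' (r.map (residue O)) := by
    intro r
    have : (Polynomial.mapRingHom (residue O)).comp (π : MvPolynomial (Fin 3) O →+* Polynomial O) =
        (π' : MvPolynomial (Fin 3) (ResidueField O) →+* Polynomial (ResidueField O)).comp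
          (map (residue O)) := by
      refine MvPolynomial.ringHom_ext (fun c => by simp) fun i => ?_
      fin_cases i <;> simp [π, π']
    exact DFunLike.congr_fun this r
  have hX (f : Polynomial (ResidueField O)) : π' (Polynomial.aeval (X 0) f) = f := by
    rw [← Polynomial.aeval_algHom_apply]
    simp [π']
  have hV : (π v).map (residue O) = f := by rw [hππ, hv, hX]
  have hW : (π w).map (residue O) = g := by rw [hππ, hw, hX]
  by_contra hdvd
  have := natDegree_lt_of_not_dvd (V := π v) (W := π w) (H := π H) (by rwa [hV])
    (fun h0 => hdvd (by rw [← hW, h0, Polynomial.natDegree_zero]; exact dvd_zero _))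
    (by rw [hππ, hHX]; simp [π']) hd0 (G := G) (by
      have h2 := congrArg π h1
      rw [map_mul, ← algebraMap_eq, AlgHom.commutes, ← AlgHom.comp_apply] at h2
      rw [← Polynomial.algebraMap_eq, h2]
      congr 1
      refine MvPolynomial.algHom_ext fun i => ?_
      fin_cases i <;> simp) (by rwa [hV, hW])
  rw [hV, hW] at this
  omega

theorem exists_scaled_algebraicIndependent {x : O} (hx : Irreducible x)
    (hJ : ∀ r, (D r).map (algebraMap O K) = jac b.1 b.2 (r.map (algebraMap O K)))
    (hker : ∀ r, jac b.1 b.2 r = 0 → r ∈ Algebra.adjoin K {b.1, b.2})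
    (hs : D s = 1) (hH : D H = 0) (hHX : H.map (residue O) = X 0)
    {P : MvPolynomial (Fin 3) (ResidueField O)}
    (hind : AlgebraicIndependent (ResidueField O) ![X 0, P])
    (hred : ∀ r, D r = 0 → ∃ F : Polynomial (Polynomial (ResidueField O)),
      Polynomial.aevalAeval (X 0) P F = r.map (residue O))
    (n N : ℕ) : ∀ v w : MvPolynomial (Fin 3) O, Scaled b v w → (∀ c, jac v w s = C c → ¬ x ^ n ∣ c) →
      ∀ f g : Polynomial (ResidueField O), v.map (residue O) = Polynomial.aeval (X 0) f →
        w.map (residue O) = Polynomial.aeval (X 0) g → (f.natDegree ≠ 0 ∨ g.natDegree ≠ 0) →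
        f.natDegree + g.natDegree ≤ N → ∃ v' w', Scaled b v' w' ∧
          AlgebraicIndependent (ResidueField O) ![v'.map (residue O), w'.map (residue O)] := by
  induction n generalizing N with
  | zero =>
    intro v w h hc
    obtain ⟨c, -, hc'⟩ := h.exists_jac_eq hJ hs
    exact (hc c hc' (by simp)).elim
  | succ n ihn =>
  induction N with
  | zero =>
    intro v w _ _ f g _ _ h1 h2
    omega
  | succ N ihN =>
  have main : ∀ v w : MvPolynomial (Fin 3) O, Scaled b v w → (∀ c, jac v w s = C c → ¬ x ^ (n + 1) ∣ c) →
      ∀ f g : Polynomial (ResidueField O), v.map (residue O) = Polynomial.aeval (X 0) f →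
        w.map (residue O) = Polynomial.aeval (X 0) g → (f.natDegree ≠ 0 ∨ g.natDegree ≠ 0) →
        f.natDegree + g.natDegree ≤ N + 1 → f.natDegree ≤ g.natDegree → ∃ v' w', Scaled b v' w' ∧
          AlgebraicIndependent (ResidueField O) ![v'.map (residue O), w'.map (residue O)] := by
    intro v w h hc f g hf hg hfg hN hle
    by_cases hf0 : f.natDegree = 0
    · obtain ⟨γ, rfl⟩ := Polynomial.natDegree_eq_zero.1 hf0
      obtain ⟨γ, rfl⟩ := residue_surjective γ
      have h1 := h.swap.sub (Polynomial.C (-γ))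
      rw [Polynomial.aeval_C] at h1
      obtain ⟨v', hv'⟩ := (map_residue_eq_zero_iff hx (-v - algebraMap O _ (-γ))).1 (by
        rw [map_sub, map_neg, hf]; simp [algebraMap_eq])
      have hjac : jac v w s = C x * jac w v' s := by
        have := jac_add_aeval_right w (-v) (Polynomial.C γ)
        rw [jac_swap, Polynomial.aeval_C] at this
        rw [← this, show -v + algebraMap O (MvPolynomial (Fin 3) O) γ = C x * v' by
          rw [← hv', map_neg]; ring, jac_C_mul_right]
        rfl
      rw [hv'] at h1
      have h2 := h1.of_C_mul hx.ne_zero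
      obtain ⟨F, hF⟩ := hred v' (h2.apply_eq_zero hJ).2
      have hg0 : g.natDegree ≠ 0 := by omega
      rcases algebraicIndependent_or_eq_aeval hind hg0 hF with hi | ⟨f', hf'⟩
      · exact ⟨w, v', h2, by rwa [hg]⟩
      · refine ihn _ w v' h2 (fun c hc' => ?_) g f' hg hf' (Or.inl hg0) le_rfl
        rw [hc', ← C_mul] at hjac
        intro hd
        exact hc _ hjac (by rw [pow_succ']; exact mul_dvd_mul_left x hd)
    · obtain ⟨e, he⟩ := h.natDegree_dvd hJ hker hH hHX hf hg hf0 hle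
      have hlf : f.leadingCoeff ^ e ≠ 0 := pow_ne_zero _ (by
        rw [Ne, Polynomial.leadingCoeff_eq_zero]; rintro rfl; simp at hf0)
      obtain ⟨γ, hγ⟩ := residue_surjective (g.leadingCoeff / f.leadingCoeff ^ e)
      have hg0 : g ≠ 0 := by rintro rfl; simp at hle; omega
      let g' := g - Polynomial.C (residue O γ) * f ^ e
      have hcoef : (Polynomial.C (residue O γ) * f ^ e).leadingCoeff = g.leadingCoeff := by
        rw [Polynomial.leadingCoeff_mul, Polynomial.leadingCoeff_C, Polynomial.leadingCoeff_pow, hγ,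
          div_mul_cancel₀ _ hlf]
      have hγ0 : residue O γ ≠ 0 := by
        rw [hγ]; exact div_ne_zero (by simpa using hg0) hlf
      have hdeg : (Polynomial.C (residue O γ) * f ^ e).natDegree = g.natDegree := by
        rw [Polynomial.natDegree_C_mul hγ0, Polynomial.natDegree_pow, he, mul_comm]
      have hlt : g'.natDegree < g.natDegree := by
        by_cases hg' : g' = 0
        · rw [hg', Polynomial.natDegree_zero]; omega
        · refine Polynomial.natDegree_lt_natDegree hg' (Polynomial.degree_sub_lt_left ?_ hg0 hcoef.symm)
          rw [Polynomial.degree_eq_natDegree hg0, ← hdeg, Polynomial.degree_eq_natDegree]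
          exact mul_ne_zero (by simpa using hγ0) (pow_ne_zero _ (by rintro rfl; simp at hf0))
      have hw' : (w - Polynomial.aeval v (Polynomial.C γ * Polynomial.X ^ e)).map (residue O) =
          Polynomial.aeval (X 0) g' := by
        rw [map_sub, map_polynomial_aeval, hf, hg]
        simp [g']
      have hjac : jac v (w - Polynomial.aeval v (Polynomial.C γ * Polynomial.X ^ e)) = jac v w := by
        have := jac_add_aeval_right v w (-(Polynomial.C γ * Polynomial.X ^ e))
        rwa [map_neg, ← sub_eq_add_neg] at this
      exact ihN _ _ (h.sub _) (by rwa [hjac]) f g' hf hw' (Or.inl hf0) (by omega)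
  intro v w h hc f g hf hg hfg hN
  rcases le_total f.natDegree g.natDegree with hle | hle
  · exact main v w h hc f g hf hg hfg hN hle
  · refine main w (-v) h.swap (by rwa [jac_swap]) g (-f) hg (by rw [map_neg, map_neg, hf])
      (by rw [Polynomial.natDegree_neg]; exact hfg.symm)
      (by rw [Polynomial.natDegree_neg]; omega) (by rwa [Polynomial.natDegree_neg])

/-- A pair of kernel elements with independent reductions, and Jacobian determinant a unit, can be
rescaled to a good pair. -/
theorem Scaled.exists_good
    (hJ : ∀ r, (D r).map (algebraMap O K) = jac b.1 b.2 (r.map (algebraMap O K)))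
    (hker : ∀ r, jac b.1 b.2 r = 0 → r ∈ Algebra.adjoin K {b.1, b.2})
    {E : MvPolynomial (Fin 3) O →ₐ[O] Polynomial (MvPolynomial (Fin 3) O)} (hE : IsExp D E)
    (hs : D s = 1) (h : Scaled b v w)
    (hi : AlgebraicIndependent (ResidueField O) ![v.map (residue O), w.map (residue O)]) :
    ∃ c, Tame K b c ∧ Good O c := by
  have hle : kerDer D ≤ Algebra.adjoin O {v, w} := by
    intro r hr
    refine mem_adjoin_of_map_mem (K := K) hi ?_
    rw [h.adjoin_eq]
    exact hker _ (by rw [← hJ, mem_kerDer.1 hr, map_zero])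
  have htop : Algebra.adjoin O {v, w, s} = ⊤ := by
    rw [eq_top_iff]
    intro r _
    obtain ⟨F, rfl⟩ := (hE.slice_bijective hs).2 r
    rw [Polynomial.aeval_eq_sum_range]
    refine sum_mem fun i _ => ?_
    rw [Algebra.smul_def]
    refine mul_mem ?_ (pow_mem (Algebra.subset_adjoin (by simp)) _)
    exact Algebra.adjoin_mono (by intro y; simp; tauto) (hle (F.coeff i).2)
  have hu := isUnit_jac htop
  obtain ⟨e, he, hje⟩ := h.exists_jac_eq hJ hs
  rw [hje] at hu
  have hu' : IsUnit e := by simpa using hu.map (constantCoeff (σ := Fin 3) (R := O))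
  obtain ⟨v₁, w₁, l, m, hl, hm, ht, hv, hw⟩ := h
  have hlm : algebraMap O K e = l * m := by
    have := congrArg (map (algebraMap O K)) hje
    rw [TriAction.map_jac, hv, hw, jac_C_mul_left, jac_C_mul_right, ht.jac_eq, Derivation.smul_apply,
      Derivation.smul_apply, ← hJ, hs, map_one, map_C, smul_eq_mul, smul_eq_mul, mul_one,
      ← C_mul] at this
    exact (C_injective _ _ this).symm
  refine ⟨_, ht.diag hl, v, ((hu'.unit⁻¹ : Oˣ) : O) • w, ?_, ?_, ?_⟩
  · rw [hv, smul_eq_C_mul]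
  · have h1 : algebraMap O K ((hu'.unit⁻¹ : Oˣ) : O) * (l * m) = 1 := by
      rw [← hlm, ← map_mul, IsUnit.val_inv_mul, map_one]
    rw [smul_eq_C_mul, map_mul, map_C, hw, ← mul_assoc, ← C_mul]
    change _ = l⁻¹ • w₁
    rw [smul_eq_C_mul]
    congr 2
    apply eq_inv_of_mul_eq_one_left
    linear_combination h1
  · rw [smul_eq_C_mul, map_mul, map_C, ← smul_eq_C_mul]
    exact algInd_smul hi (Units.map (residue O : O →* ResidueField O) hu'.unit⁻¹)

end Loop

open IsLocalRing

section Local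
variable {O : Type*} [CommRing O] [IsDomain O] [IsDiscreteValuationRing O] [Algebra ℚ O]
  {K : Type*} [Field K] [Algebra O K] [IsFractionRing O K] [Algebra ℚ K]

theorem exists_integ_eq {x : O} (hx : Irreducible x) {a : O} {q : Polynomial O} (ha : a ≠ 0)
    (haq : ¬ Polynomial.C a ∣ integ q) : ∃ (r : ℕ) (b : O) (Q : Polynomial O), b ≠ 0 ∧ x ∣ b ∧
      a = x ^ r * b ∧ integ q = Polynomial.C (x ^ r) * Q ∧ (Q.map (residue O)).natDegree ≠ 0 ∧
      Polynomial.C a * Polynomial.derivative Q = Polynomial.C b * q := by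
  obtain ⟨n, u, rfl⟩ := IsDiscreteValuationRing.eq_unit_mul_pow_irreducible ha hx
  have hn : ∃ n, ¬ Polynomial.C (x ^ n) ∣ integ q := by
    refine ⟨n, fun h => haq ?_⟩
    rw [Polynomial.C_mul]
    exact (IsUnit.mul_left_dvd (u.isUnit.map Polynomial.C)).2 h
  classical
  have hm := Nat.find_spec hn
  have hmin := fun k => Nat.find_min (m := k) hn
  have hmn : Nat.find hn ≤ n := Nat.find_min' hn fun h => haq (by
    rw [Polynomial.C_mul]
    exact (IsUnit.mul_left_dvd (u.isUnit.map Polynomial.C)).2 h)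
  generalize Nat.find hn = m at hm hmin hmn
  obtain _ | r := m
  · simp at hm
  obtain ⟨Q, hQ⟩ := not_not.1 (hmin r r.lt_succ_self)
  have hxr : (Polynomial.C (x ^ r) : Polynomial O) ≠ 0 := by simpa using fun h => (hx.ne_zero h).elim
  have hb : (u : O) * x ^ n = x ^ r * (u * x ^ (n - r)) := by
    rw [mul_left_comm, ← pow_add, Nat.add_sub_cancel' (by omega)]
  refine ⟨r, u * x ^ (n - r), Q, fun h => ha (by rw [hb, h, mul_zero]),
    Dvd.dvd.mul_left (dvd_pow_self x (by omega)) _, hb, hQ, fun h0 => ?_, ?_⟩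
  · have h1 : Q.coeff 0 = 0 := by
      have := coeff_integ_zero q
      rw [hQ, Polynomial.coeff_C_mul] at this
      exact (mul_eq_zero.1 this).resolve_left fun h => hxr (by rw [h, Polynomial.C_0])
    have h2 : Q.map (residue O) = 0 := by
      rw [Polynomial.eq_C_of_natDegree_eq_zero h0, Polynomial.coeff_map, h1, map_zero,
        Polynomial.C_0]
    rw [← polynomial_C_dvd_iff hx] at h2
    apply hm
    rw [hQ, pow_succ, Polynomial.C_mul]
    exact mul_dvd_mul_left _ h2
  · have := congrArg Polynomial.derivative hQ
    rw [derivative_integ, Polynomial.derivative_C_mul] at this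
    rw [hb, this, mul_comm (x ^ r), Polynomial.C_mul, mul_assoc]

theorem HitsVar.span_residue_eq_top [Algebra ℚ (ResidueField O)] {a : O} {q : Polynomial O}
    {p : Polynomial (Polynomial O)} (hE : HitsVar (expHom a q p)) (hxa : residue O a = 0) :
    (Ideal.span {C 0, Polynomial.aeval (X 0) (q.map (residue O)), Polynomial.aevalAeval (X 0) (X 1)
      (p.map (Polynomial.mapRingHom (residue O)))} :
        Ideal (MvPolynomial (Fin 3) (ResidueField O))) = ⊤ := by
  have := HitsVar.span_eq_top _ _ _ (hE.map (isExp_expHom _ _ _) (isExp_expHom _ _ _)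
    (MvPolynomial.map (residue O)) (map_der _ _ _ _))
  rwa [hxa] at this

theorem exists_slice_of_dvd {a : O} (ha : a ≠ 0) {q Q : Polynomial O}
    {p : Polynomial (Polynomial O)} (hQ : Polynomial.C a * Polynomial.derivative Q = q)
    (hE : HitsVar (expHom a q p)) : ∃ s, der a q p s = 1 := by
  obtain ⟨x, hx⟩ := IsDiscreteValuationRing.exists_irreducible O
  let : Algebra ℚ (ResidueField O) := ((residue O).comp (algebraMap ℚ O)).toAlgebra
  have hC (r : O) : der a q p (C r) = 0 := Derivation.map_algebraMap _ r
  by_cases hxa : residue O a = 0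
  · have hq0 : q.map (residue O) = 0 := by
      rw [← hQ, Polynomial.map_mul, Polynomial.map_C, hxa, Polynomial.C_0, zero_mul]
    have hspan := hE.span_residue_eq_top hxa
    rw [hq0] at hspan
    obtain ⟨c, hc, hp, hG⟩ := exists_baseInt_eq (Q.map (residue O)) hspan
    obtain ⟨γ, hγ⟩ := hc.exists_right_inv
    have hb := basePair_map (residue O) a Q p
    rw [hxa] at hb
    have hb1 : (basePair a Q p).1.map (residue O) =
        X 1 - Polynomial.aeval (X 0) (Q.map (residue O)) := congrArg Prod.fst hb
    have hb2 : (basePair a Q p).2.map (residue O) = C (-c) * X 0 := by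
      refine (congrArg Prod.snd hb).trans ?_
      simp only [basePair]
      rw [hG]
      simp [algebraMap_eq]
    refine exists_slice_of_lift (p := p) hx ha fun h hh => ?_
    refine lift_of_mem_adjoin (der_basePair_fst a q Q p hQ) (der_basePair_snd a q Q p hQ) rfl rfl ?_
    rw [← mem_kerDer, hxa, hq0, kerDer_eq_adjoin (isExp_expHom _ _ _) (v := X 0) (w := X 1)
      (s := C γ * X 2) (by simp) (by simp) ?_ ?_] at hh
    · refine Algebra.adjoin_le ?_ hh
      set S := Algebra.adjoin (ResidueField O) {(basePair a Q p).1.map (residue O),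
        (basePair a Q p).2.map (residue O)}
      have h1 : X 0 ∈ S := by
        have : (-γ) • (basePair a Q p).2.map (residue O) ∈ S :=
          S.smul_mem (Algebra.subset_adjoin (by simp)) _
        rw [hb2, smul_eq_C_mul, ← mul_assoc, ← C_mul, neg_mul_neg, mul_comm γ, hγ] at this
        simpa using this
      rintro r (rfl | rfl)
      · exact h1
      · have h2 := S.add_mem (Algebra.subset_adjoin (by simp) : (basePair a Q p).1.map (residue O) ∈ S)
          (Polynomial.aeval_mem_adjoin_singleton _ _ |> fun h =>
            Algebra.adjoin_le (Set.singleton_subset_iff.2 h1) h :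
            Polynomial.aeval (X 0) (Q.map (residue O)) ∈ S)
        rwa [hb1, sub_add_cancel] at h2
    · rw [hp, Derivation.leibniz, der_X2]
      simp [algebraMap_eq, ← C_mul, mul_comm γ, hγ]
    · refine eq_top_of_X_mem (Algebra.subset_adjoin (by simp)) (Algebra.subset_adjoin (by simp)) ?_
      have := Subalgebra.smul_mem _ (Algebra.subset_adjoin (R := ResidueField O)
        (Set.mem_insert_of_mem (X 0) (Set.mem_insert_of_mem (X 1)
          (Set.mem_singleton (C γ * X 2 : MvPolynomial (Fin 3) (ResidueField O)))))) c
      rwa [smul_eq_C_mul, ← mul_assoc, ← C_mul, hγ, C_1, one_mul] at this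
  · have hu : IsUnit a := by
      rwa [residue_eq_zero_iff, mem_maximalIdeal, mem_nonunits_iff, not_not] at hxa
    obtain ⟨b, hb⟩ := hu.exists_right_inv
    refine ⟨C b * X 0, ?_⟩
    rw [Derivation.leibniz, hC, der_X0, smul_zero, add_zero, smul_eq_mul, ← C_mul, mul_comm, hb, C_1]

/-- Over a discrete valuation ring, a proper triangular action has a slice, and the base pair can be
brought to a good pair by elementary transformations over the fraction field. -/
theorem exists_slice_and_good {a : O} (ha : a ≠ 0) {q : Polynomial O}
    {p : Polynomial (Polynomial O)} (hE : HitsVar (expHom a q p)) :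
    (∃ s, der a q p s = 1) ∧ ∃ c, Tame K (basePair (algebraMap O K a)
      (Polynomial.C (algebraMap O K a)⁻¹ * (integ q).map (algebraMap O K))
      (p.map (Polynomial.mapRingHom (algebraMap O K)))) c ∧ Good O c := by
  obtain ⟨x, hx⟩ := IsDiscreteValuationRing.exists_irreducible O
  have haK : algebraMap O K a ≠ 0 := by rwa [Ne, FaithfulSMul.algebraMap_eq_zero_iff]
  let : Algebra ℚ (ResidueField O) := ((residue O).comp (algebraMap ℚ O)).toAlgebra
  by_cases hdvd : Polynomial.C a ∣ integ q
  · obtain ⟨Q, hQ⟩ := hdvd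
    have hQq : Polynomial.C a * Polynomial.derivative Q = q := by
      rw [← Polynomial.derivative_C_mul, ← hQ, derivative_integ]
    refine ⟨exists_slice_of_dvd ha hQq hE, _, Tame.refl _, ?_⟩
    rw [hQ, Polynomial.map_mul, Polynomial.map_C, ← mul_assoc, ← Polynomial.C_mul,
      inv_mul_cancel₀ haK, Polynomial.C_1, one_mul]
    exact good_basePair a q Q p hQq hE
  obtain ⟨r, b, Q, hb, hxb, hab, hq, hQ0, hQ⟩ := exists_integ_eq hx ha hdvd
  have hbK : algebraMap O K b ≠ 0 := by rwa [Ne, FaithfulSMul.algebraMap_eq_zero_iff]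
  have hx0 (r : O) (h : x ∣ r) : residue O r = 0 := (residue_eq_zero_iff_dvd hx r).2 h
  have hxa : residue O a = 0 := hx0 a (hab ▸ hxb.mul_left _)
  obtain ⟨P, t, ht, hker, htop⟩ := exists_slice_of_zero _ _ (hE.span_residue_eq_top hxa)
  have hlift := fun h => exists_lift (h := h) hx hQ ha hb hxb hQ0 hE hxa ht hker htop
  obtain ⟨s, hs⟩ := exists_slice_of_lift (p := p) hx ha (by rwa [hxa])
  refine ⟨⟨s, hs⟩, ?_⟩
  obtain ⟨H, hH, hHX⟩ := hlift (X 0) (by simp)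
  have hind : AlgebraicIndependent (ResidueField O) ![X 0, P] := by
    have h3 : AlgebraicIndependent (ResidueField O) ![X 0, P, t] := by
      rw [algebraicIndependent_iff_injective_aeval]
      exact (bijective_of_adjoin_eq_top htop).1
    convert h3.comp Fin.castSucc (Fin.castSucc_injective 2) using 1
    funext i
    fin_cases i <;> rfl
  set QK := Polynomial.C (algebraMap O K a)⁻¹ * (integ q).map (algebraMap O K) with hQK
  have hQK' : Polynomial.C (algebraMap O K a) * Polynomial.derivative QK =
      q.map (algebraMap O K) := by
    rw [hQK, Polynomial.derivative_C_mul, Polynomial.derivative_map, derivative_integ, ← mul_assoc,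
      ← Polynomial.C_mul, mul_inv_cancel₀ haK, Polynomial.C_1, one_mul]
  have hQ1 : Q.map (algebraMap O K) = Polynomial.C (algebraMap O K b) * QK := by
    have hxr : algebraMap O K (x ^ r) ≠ 0 := by
      rw [Ne, FaithfulSMul.algebraMap_eq_zero_iff]
      exact pow_ne_zero _ hx.ne_zero
    have h1 : algebraMap O K b * (algebraMap O K a)⁻¹ * algebraMap O K (x ^ r) = 1 := by
      rw [hab, map_mul]
      field_simp
    rw [hQK, hq, Polynomial.map_mul, Polynomial.map_C, ← mul_assoc, ← mul_assoc,
      ← Polynomial.C_mul, ← Polynomial.C_mul, h1, Polynomial.C_1, one_mul]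
  set p' := p.map (Polynomial.mapRingHom (algebraMap O K))
  have hjac := jac_basePair haK p' hQK'
  have hJ : ∀ f, (der a q p f).map (algebraMap O K) =
      jac (basePair (algebraMap O K a) QK p').1 (basePair (algebraMap O K a) QK p').2
        (f.map (algebraMap O K)) := by
    intro f
    rw [map_der, hjac]
  have hkerK : ∀ f, jac (basePair (algebraMap O K a) QK p').1
      (basePair (algebraMap O K a) QK p').2 f = 0 → f ∈ Algebra.adjoin K
        {(basePair (algebraMap O K a) QK p').1, (basePair (algebraMap O K a) QK p').2} := by
    intro f hf
    rw [← kerDer_eq_adjoin_basePair haK p' hQK', mem_kerDer, ← hjac, hf]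
  have hred : ∀ f, der a q p f = 0 → ∃ F : Polynomial (Polynomial (ResidueField O)),
      Polynomial.aevalAeval (X 0) P F = f.map (residue O) := by
    intro f hf
    rw [← mem_adjoin_iff_aevalAeval, ← hker, mem_kerDer]
    have := map_der a q p (residue O) f
    rwa [hf, hxa, map_zero, eq_comm] at this
  obtain ⟨d, hd, w, hw⟩ := exists_map_eq_C_mul (nonZeroDivisors O)
    (basePair (algebraMap O K a) QK p').2
  have hdK : algebraMap O K d ≠ 0 := by
    rw [Ne, FaithfulSMul.algebraMap_eq_zero_iff]
    exact nonZeroDivisors.ne_zero hd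
  have hsc : Scaled (basePair (algebraMap O K a) QK p') (C b * X 1 - Polynomial.aeval (X 0) Q) w :=
    ⟨_, _, _, _, hbK, hdK, Tame.refl _, by
      rw [map_sub, map_polynomial_aeval, hQ1]
      simp [algebraMap_eq, mul_sub], hw⟩
  obtain ⟨F, hF⟩ := hred w (hsc.apply_eq_zero hJ).2
  have hv : (C b * X 1 - Polynomial.aeval (X 0) Q : MvPolynomial (Fin 3) O).map (residue O) =
      Polynomial.aeval (X 0) (-(Q.map (residue O))) := by
    rw [map_sub, map_polynomial_aeval, map_mul, map_C, hx0 b hxb]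
    simp
  have hQ0' : (-(Q.map (residue O))).natDegree ≠ 0 := by rwa [Polynomial.natDegree_neg]
  suffices H : ∃ v w, Scaled (basePair (algebraMap O K a) QK p') v w ∧
      AlgebraicIndependent (ResidueField O) ![v.map (residue O), w.map (residue O)] by
    obtain ⟨v, w, h, hi⟩ := H
    exact h.exists_good hJ hkerK (isExp_expHom a q p) hs hi
  rcases algebraicIndependent_or_eq_aeval hind hQ0' hF with hi | ⟨g, hg⟩
  · exact ⟨_, w, hsc, by rwa [hv]⟩
  obtain ⟨c, hc, hjc⟩ := hsc.exists_jac_eq hJ hs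
  obtain ⟨n, u, rfl⟩ := IsDiscreteValuationRing.eq_unit_mul_pow_irreducible hc hx
  refine exists_scaled_algebraicIndependent hx hJ hkerK hs hH hHX hind hred (n + 1) _ _ w hsc ?_
    _ g hv hg (Or.inl hQ0') le_rfl
  intro c' hc' hdiv
  rw [hjc] at hc'
  rw [← C_injective _ _ hc', IsUnit.dvd_mul_left u.isUnit,
    pow_dvd_pow_iff hx.ne_zero hx.not_isUnit] at hdiv
  omega

end Local

open IsDedekindDomain

section Global
variable {A : Type*} [CommRing A] [IsDedekindDomain A]

theorem exists_cong (v : HeightOneSpectrum A) {x : A} (hx : x ≠ 0) :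
    ∃ ω, (∃ t ∉ v.asIdeal, x ∣ t * (ω - 1)) ∧ ∀ v' ≠ v, ∃ t ∉ v'.asIdeal, x ∣ t * ω := by
  have hfin : FiniteMultiplicity v.asIdeal (Ideal.span {x}) :=
    FiniteMultiplicity.of_prime_left v.prime (by simpa using hx)
  obtain ⟨J, hJ, hJv⟩ := hfin.exists_eq_pow_mul_and_not_dvd
  generalize multiplicity v.asIdeal (Ideal.span {x}) = k at hJ
  have hdvd : ∀ y ∈ v.asIdeal ^ k, ∀ z ∈ J, x ∣ z * y := fun y hy z hz => by
    rw [← Ideal.mem_span_singleton, hJ, mul_comm z]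
    exact Ideal.mul_mem_mul hy hz
  rw [Ideal.dvd_iff_le] at hJv
  have hsup : v.asIdeal ^ k ⊔ J = ⊤ := by
    have : IsCoprime v.asIdeal J := by
      rw [Ideal.isCoprime_iff_sup_eq]
      exact v.isMaximal.out.2 _ (lt_of_le_of_ne le_sup_left fun h => hJv (h ▸ le_sup_right))
    exact Ideal.isCoprime_iff_sup_eq.1 this.pow_left
  obtain ⟨y, hy, ω, hω, hyω⟩ := Submodule.mem_sup.1 (hsup ▸ Submodule.mem_top : (1 : A) ∈ _)
  refine ⟨ω, ?_, fun v' hv' => ?_⟩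
  · obtain ⟨t, htJ, htv⟩ := Set.not_subset.1 hJv
    refine ⟨t, htv, ?_⟩
    rw [← hyω, sub_add_cancel_right, mul_neg, dvd_neg]
    exact hdvd y hy t htJ
  · obtain ⟨t, ht, htv⟩ : ∃ t ∈ v.asIdeal ^ k, t ∉ v'.asIdeal := by
      refine Set.not_subset.1 fun h => hv' ?_
      exact HeightOneSpectrum.ext (v.isMaximal.eq_of_le v'.isPrime.ne_top
        (v'.isPrime.le_of_pow_le h)).symm
    exact ⟨t, htv, mul_comm t ω ▸ hdvd t ht ω hω⟩

theorem eq_top_of_height_one {I : Ideal A} {a : A} (ha : a ≠ 0) (haI : a ∈ I)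
    (h : ∀ v : HeightOneSpectrum A, ∃ t ∈ I, t ∉ v.asIdeal) : I = ⊤ := by
  by_contra hI
  obtain ⟨m, hm, hIm⟩ := I.exists_le_maximal hI
  obtain ⟨t, htI, ht⟩ := h ⟨m, hm.isPrime, fun h => ha (by simpa [h] using hIm haI)⟩
  exact ht (hIm htI)

variable (K : Type*) [Field K] [Algebra A K] [IsFractionRing A K]

/-- The localization at a height one prime, inside the fraction field. -/
noncomputable abbrev LocAt (v : HeightOneSpectrum A) : Subalgebra A K :=
  Localization.subalgebra.ofField K v.asIdeal.primeCompl v.asIdeal.primeCompl_le_nonZeroDivisors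

instance (v : HeightOneSpectrum A) : IsLocalization.AtPrime (LocAt K v) v.asIdeal :=
  Localization.subalgebra.isLocalization_ofField ..

instance (v : HeightOneSpectrum A) : IsDiscreteValuationRing (LocAt K v) :=
  IsLocalization.AtPrime.isDiscreteValuationRing_of_dedekind_domain A v.ne_bot _

variable {K}

theorem mem_locAt {v : HeightOneSpectrum A} {x : K} {t : A} (ht : t ∉ v.asIdeal)
    (h : algebraMap A K t * x ∈ LocAt K v) : x ∈ LocAt K v := by
  have hu : IsUnit (algebraMap A (LocAt K v) t) :=
    IsLocalization.map_units (M := v.asIdeal.primeCompl) _ ⟨t, ht⟩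
  obtain ⟨s, hs⟩ := hu.exists_left_inv
  have hs' : (s : K) * algebraMap A K t = 1 := congrArg Subtype.val hs
  have := (LocAt K v).mul_mem s.2 h
  rwa [← mul_assoc, hs', one_mul] at this

theorem exists_clear (l : List (Bool × Polynomial K)) :
    ∃ d : A, d ≠ 0 ∧ ∀ e ∈ l, ∃ F : Polynomial A,
      F.map (algebraMap A K) = Polynomial.C (algebraMap A K d) * e.2 := by
  induction l with
  | nil => exact ⟨1, one_ne_zero, by simp⟩
  | cons e l ih =>
    obtain ⟨d, hd, h⟩ := ih
    obtain ⟨c, hc, F, hF⟩ := exists_polynomial_map_eq_C_mul (nonZeroDivisors A) e.2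
    refine ⟨d * c, mul_ne_zero hd (nonZeroDivisors.ne_zero hc), ?_⟩
    rintro e' he'
    rcases List.mem_cons.1 he' with rfl | he'
    · exact ⟨Polynomial.C d * F, by
        rw [Polynomial.map_mul, hF, Polynomial.map_C, map_mul, Polynomial.C_mul, mul_assoc]⟩
    · obtain ⟨F', hF'⟩ := h e' he'
      exact ⟨Polynomial.C c * F', by
        rw [Polynomial.map_mul, hF', Polynomial.map_C, map_mul, Polynomial.C_mul]; ring⟩

theorem Good.exists_insert {b : MvPolynomial (Fin 3) K × MvPolynomial (Fin 3) K}
    {c c₀ : MvPolynomial (Fin 3) K × MvPolynomial (Fin 3) K} (hc : Tame K b c) (hc₀ : Tame K b c₀)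
    {v₀ : HeightOneSpectrum A} (h₀ : Good (LocAt K v₀) c₀) :
    ∃ c', Tame K b c' ∧ Good (LocAt K v₀) c' ∧
      ∀ v ≠ v₀, Good (LocAt K v) c → Good (LocAt K v) c' := by
  obtain ⟨l, rfl⟩ := hc
  obtain ⟨l₀, rfl⟩ := hc₀
  set L := invList l ++ l₀
  have hL : TriAction.run 1 L (TriAction.run 1 l b) = TriAction.run 1 l₀ b := by
    rw [run_append, run_invList]
  rw [← hL] at h₀
  obtain ⟨d, hd, hgood⟩ := h₀.exists_scaleList
  obtain ⟨⟨d', s⟩, hds⟩ := IsLocalization.surj v₀.asIdeal.primeCompl d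
  obtain ⟨Δ, hΔ, hclear⟩ := exists_clear (A := A) L
  have hd' : d' ≠ 0 := by
    rintro rfl
    rw [map_zero] at hds
    exact (mul_ne_zero hd (IsLocalization.map_units _ s).ne_zero) hds
  obtain ⟨ω, ⟨t, ht, htω⟩, hω⟩ := exists_cong v₀ (mul_ne_zero hd' hΔ)
  refine ⟨TriAction.run 1 (scaleList (algebraMap A K ω) L) (TriAction.run 1 l b),
    ⟨l ++ scaleList (algebraMap A K ω) L, run_append ..⟩, hgood (algebraMap A _ ω) ?_,
    fun v hv hg => hg.run _ ?_⟩
  · have hu : IsUnit (algebraMap A (LocAt K v₀) t) :=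
      IsLocalization.map_units (M := v₀.asIdeal.primeCompl) _ ⟨t, ht⟩
    rw [← hu.dvd_mul_left]
    refine (Dvd.intro _ hds).trans ?_
    have := map_dvd (algebraMap A (LocAt K v₀)) ((dvd_mul_right d' Δ).trans htω)
    simpa using this
  · intro e he
    obtain ⟨e, heL, rfl⟩ := List.mem_map.1 he
    obtain ⟨F, hF⟩ := hclear e heL
    obtain ⟨t, ht, z, hz⟩ := hω v hv
    change _ ∈ (Polynomial.mapRingHom (algebraMap (LocAt K v) K)).range
    rw [Polynomial.mem_map_range]
    intro n
    suffices H : (Polynomial.C (algebraMap A K ω) * e.2).coeff n ∈ LocAt K v from ⟨⟨_, H⟩, rfl⟩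
    refine mem_locAt ht ?_
    have hFn := congrArg (Polynomial.coeff · n) hF
    simp only [Polynomial.coeff_map, Polynomial.coeff_C_mul] at hFn
    have : algebraMap A K t * (algebraMap A K ω * e.2.coeff n) =
        algebraMap A K (d' * z * F.coeff n) := by
      rw [← mul_assoc, ← map_mul, hz, map_mul _ _ (F.coeff n), hFn]
      simp only [map_mul]
      ring
    rw [Polynomial.coeff_C_mul, this]
    exact Subalgebra.algebraMap_mem _ _

theorem exists_tame_good {b : MvPolynomial (Fin 3) K × MvPolynomial (Fin 3) K}
    {T : Set (HeightOneSpectrum A)} (hT : T.Finite) (hb : ∀ v : HeightOneSpectrum A, v ∉ T → Good (LocAt K v) b)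
    (h : ∀ v : HeightOneSpectrum A, ∃ c, Tame K b c ∧ Good (LocAt K v) c) :
    ∃ c, Tame K b c ∧ ∀ v : HeightOneSpectrum A, Good (LocAt K v) c := by
  suffices H : ∀ S : Set (HeightOneSpectrum A), S.Finite →
      ∃ c, Tame K b c ∧ ∀ v, (v ∈ S ∨ v ∉ T) → Good (LocAt K v) c by
    obtain ⟨c, hc, hg⟩ := H T hT
    exact ⟨c, hc, fun v => hg v (em _)⟩
  intro S hS
  induction S, hS using Set.Finite.induction_on with
  | empty => exact ⟨b, Tame.refl b, fun v hv => hb v (by simpa using hv)⟩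
  | @insert v₀ S _ _ ih =>
    obtain ⟨c, hc, hg⟩ := ih
    obtain ⟨c₀, hc₀, h₀⟩ := h v₀
    obtain ⟨c', hc', h1, h2⟩ := Good.exists_insert hc hc₀ h₀
    refine ⟨c', hc', fun v hv => ?_⟩
    by_cases hvv : v = v₀
    · exact hvv ▸ h1
    · exact h2 v hvv (hg v (by simpa [hvv] using hv))

theorem exists_map_eq_of_good {c : MvPolynomial (Fin 3) K × MvPolynomial (Fin 3) K}
    (h : ∀ v : HeightOneSpectrum A, Good (LocAt K v) c) :
    ∃ f g : MvPolynomial (Fin 3) A, f.map (algebraMap A K) = c.1 ∧ g.map (algebraMap A K) = c.2 := by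
  have key : ∀ f : MvPolynomial (Fin 3) K, (∀ v : HeightOneSpectrum A,
      ∃ g : MvPolynomial (Fin 3) (LocAt K v), g.map (algebraMap _ K) = f) →
      ∃ g : MvPolynomial (Fin 3) A, g.map (algebraMap A K) = f := by
    intro f hf
    change f ∈ Set.range (MvPolynomial.map (algebraMap A K))
    rw [MvPolynomial.mem_range_map_iff_coeffs_subset]
    intro x hx
    obtain ⟨i, -, rfl⟩ := MvPolynomial.mem_coeffs_iff.1 hx
    suffices H : f.coeff i ∈ (⊥ : Subalgebra A K) from H
    rw [← HeightOneSpectrum.iInf_localization_eq_bot A K, Algebra.mem_iInf]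
    intro v
    obtain ⟨g, rfl⟩ := hf v
    rw [coeff_map]
    exact (g.coeff i).2
  obtain ⟨f, hf⟩ := key c.1 fun v => (h v).imp fun _ h => h.choose_spec.1
  obtain ⟨g, hg⟩ := key c.2 fun v => by obtain ⟨_, w, _, hw, _⟩ := h v; exact ⟨w, hw⟩
  exact ⟨f, g, hf, hg⟩

theorem mem_adjoin_of_good {f g r : MvPolynomial (Fin 3) A}
    (h : ∀ v : HeightOneSpectrum A,
      Good (LocAt K v) (f.map (algebraMap A K), g.map (algebraMap A K)))
    (hr : r.map (algebraMap A K) ∈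
      Algebra.adjoin K {f.map (algebraMap A K), g.map (algebraMap A K)}) :
    r ∈ Algebra.adjoin A {f, g} := by
  let I : Ideal A := (Subalgebra.toSubmodule (Algebra.adjoin A {f, g})).comap
    (LinearMap.toSpanSingleton A _ r)
  have hI (c : A) : c ∈ I ↔ c • r ∈ Algebra.adjoin A {f, g} := Iff.rfl
  have clear : ∀ {O : Type _} [CommRing O] [Algebra A O] (M : Submonoid A) [IsLocalization M O],
      M ≤ nonZeroDivisors A →
      r.map (algebraMap A O) ∈ Algebra.adjoin O {f.map (algebraMap A O), g.map (algebraMap A O)} →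
      ∃ c ∈ M, c ∈ I := by
    intro O _ _ M _ hM hr
    rw [mem_adjoin_pair_iff] at hr
    obtain ⟨H, hH⟩ := hr
    obtain ⟨c, hc, H', hH'⟩ := exists_map_eq_C_mul M H
    refine ⟨c, hc, ?_⟩
    rw [hI, mem_adjoin_pair_iff]
    refine ⟨H', MvPolynomial.map_injective _ (IsLocalization.injective O hM) ?_⟩
    rw [map_aeval_pair, hH', map_mul, hH, aeval_C, smul_eq_C_mul, map_mul, map_C, algebraMap_eq]
  obtain ⟨a, ha, haI⟩ := clear (nonZeroDivisors A) le_rfl hr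
  have : I = ⊤ := by
    refine eq_top_of_height_one (nonZeroDivisors.ne_zero ha) haI fun v => ?_
    obtain ⟨f', g', hf, hg, hind⟩ := h v
    have hm (F : MvPolynomial (Fin 3) A) : (F.map (algebraMap A (LocAt K v))).map
        (algebraMap (LocAt K v) K) = F.map (algebraMap A K) := by
      rw [map_map, ← IsScalarTower.algebraMap_eq]
    obtain rfl := map_algebraMap_injective (hf.trans (hm f).symm)
    obtain rfl := map_algebraMap_injective (hg.trans (hm g).symm)
    obtain ⟨t, ht, htI⟩ := clear v.asIdeal.primeCompl v.asIdeal.primeCompl_le_nonZeroDivisors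
      (mem_adjoin_of_map_mem (K := K) hind (by rwa [hm, hm, hm]))
    exact ⟨t, htI, ht⟩
  simpa using (hI 1).1 (this ▸ Submodule.mem_top)

end Global

open IsDedekindDomain

section Dedekind
variable {A : Type*} [CommRing A] [IsDedekindDomain A] [Algebra ℚ A]
  {K : Type*} [Field K] [Algebra A K] [IsFractionRing A K] [Algebra ℚ K]

/-- The base pair over the fraction field. -/
noncomputable abbrev fracPair (K : Type*) [Field K] [Algebra A K] (a : A)
    (q : Polynomial A) (p : Polynomial (Polynomial A)) [Algebra ℚ K] :
    MvPolynomial (Fin 3) K × MvPolynomial (Fin 3) K :=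
  basePair (algebraMap A K a)
    (Polynomial.C (algebraMap A K a)⁻¹ * integ (q.map (algebraMap A K)))
    (p.map (Polynomial.mapRingHom (algebraMap A K)))

theorem fracPair_map (O : Type*) [CommRing O] [Algebra A O] [Algebra O K] [IsScalarTower A O K]
    (a : A) (q : Polynomial A) (p : Polynomial (Polynomial A)) :
    fracPair K (algebraMap A O a) (q.map (algebraMap A O))
      (p.map (Polynomial.mapRingHom (algebraMap A O))) = fracPair K a q p := by
  simp only [fracPair, Polynomial.map_map, Polynomial.mapRingHom_comp,
    ← IsScalarTower.algebraMap_eq, ← IsScalarTower.algebraMap_apply]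

theorem hitsVar_map {A' : Type*} [CommRing A'] [Algebra ℚ A'] (f : A →+* A') {a : A}
    {q : Polynomial A} {p : Polynomial (Polynomial A)} (hE : HitsVar (expHom a q p)) :
    HitsVar (expHom (f a) (q.map f) (p.map (Polynomial.mapRingHom f))) :=
  hE.map (isExp_expHom _ _ _) (isExp_expHom _ _ _) (MvPolynomial.map f) (map_der _ _ _ _)

theorem exists_slice_and_kerDer_eq {a : A} (ha : a ≠ 0) {q : Polynomial A}
    {p : Polynomial (Polynomial A)} (hE : HitsVar (expHom a q p)) :
    ∃ s v w, der a q p s = 1 ∧ kerDer (der a q p) = Algebra.adjoin A {v, w} := by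
  let K := FractionRing A
  let : Algebra ℚ K := ((algebraMap A K).comp (algebraMap ℚ A)).toAlgebra
  have : CharZero K := algebraRat.charZero K
  have hinj := IsFractionRing.injective A K
  have haK : algebraMap A K a ≠ 0 := by rwa [Ne, FaithfulSMul.algebraMap_eq_zero_iff]
  let _ (v : HeightOneSpectrum A) : Algebra ℚ (LocAt K v) :=
    ((algebraMap A (LocAt K v)).comp (algebraMap ℚ A)).toAlgebra
  have ha' (v : HeightOneSpectrum A) : algebraMap A (LocAt K v) a ≠ 0 := fun h =>
    haK (by rw [IsScalarTower.algebraMap_apply A (LocAt K v) K, h, map_zero])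
  have hloc (v : HeightOneSpectrum A) :=
    exists_slice_and_good (K := K) (ha' v) (hitsVar_map (algebraMap A (LocAt K v)) hE)
  have hfrac (v : HeightOneSpectrum A) : ∃ c, Tame K (fracPair K a q p) c ∧ Good (LocAt K v) c := by
    have := (hloc v).2
    rw [integ_map] at this
    rwa [← fracPair_map (LocAt K v)]
  have hgood (v : HeightOneSpectrum A) (hv : a ∉ v.asIdeal) :
      Good (LocAt K v) (fracPair K a q p) := by
    have hu : IsUnit (algebraMap A (LocAt K v) a) :=
      IsLocalization.map_units (M := v.asIdeal.primeCompl) _ ⟨a, hv⟩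
    obtain ⟨b, hb⟩ := hu.exists_right_inv
    have := good_basePair (K := K) (algebraMap A (LocAt K v) a) (q.map (algebraMap A (LocAt K v)))
      (Polynomial.C b * integ (q.map (algebraMap A (LocAt K v)))) _ (by
        rw [Polynomial.derivative_C_mul, derivative_integ, ← mul_assoc, ← Polynomial.C_mul, hb,
          Polynomial.C_1, one_mul]) (hitsVar_map (algebraMap A (LocAt K v)) hE)
    have hbK : algebraMap (LocAt K v) K b =
        (algebraMap (LocAt K v) K (algebraMap A (LocAt K v) a))⁻¹ :=
      eq_inv_of_mul_eq_one_right (by rw [← map_mul, hb, map_one])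
    rw [Polynomial.map_mul, Polynomial.map_C, integ_map, hbK] at this
    rwa [← fracPair_map (LocAt K v)]
  have hfin : {v : HeightOneSpectrum A | a ∈ v.asIdeal}.Finite := by
    have := Ideal.finite_factors (I := Ideal.span {a}) (by simpa using ha)
    simpa [Ideal.dvd_span_singleton] using this
  obtain ⟨c, hc, hg⟩ := exists_tame_good hfin hgood hfrac
  obtain ⟨f, g, hfc, hgc⟩ := exists_map_eq_of_good hg
  have hcoef : Polynomial.C (algebraMap A K a) * Polynomial.derivative
      (Polynomial.C (algebraMap A K a)⁻¹ * integ (q.map (algebraMap A K))) =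
        q.map (algebraMap A K) := by
    rw [Polynomial.derivative_C_mul, derivative_integ, ← mul_assoc, ← Polynomial.C_mul,
      mul_inv_cancel₀ haK, Polynomial.C_1, one_mul]
  have hker := kerDer_eq_adjoin_basePair haK (p.map (Polynomial.mapRingHom (algebraMap A K))) hcoef
  have hadj := hc.adjoin_eq
  rw [← hfc, ← hgc] at hadj
  have hmem (r : MvPolynomial (Fin 3) A) : der a q p r = 0 ↔ r.map (algebraMap A K) ∈
      Algebra.adjoin K {f.map (algebraMap A K), g.map (algebraMap A K)} := by
    rw [hadj, ← hker, mem_kerDer, ← map_der]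
    exact ⟨fun h => by rw [h, map_zero], fun h => MvPolynomial.map_injective _ hinj
      (by rw [h, map_zero])⟩
  have hs : ∃ s, der a q p s = 1 := by
    let I : Ideal A := (LinearMap.range (der a q p).toLinearMap).comap
      (Algebra.linearMap A (MvPolynomial (Fin 3) A))
    have hI (c : A) : c ∈ I ↔ ∃ s, der a q p s = C c := Iff.rfl
    have : I = ⊤ := by
      refine eq_top_of_height_one ha ((hI a).2 ⟨X 0, der_X0 _ _ _⟩) fun v => ?_
      obtain ⟨s, hs⟩ := (hloc v).1
      obtain ⟨t, ht, s', hs'⟩ := exists_map_eq_C_mul v.asIdeal.primeCompl s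
      refine ⟨t, (hI t).2 ⟨s', MvPolynomial.map_injective _ (IsLocalization.injective (LocAt K v)
        v.asIdeal.primeCompl_le_nonZeroDivisors) ?_⟩, ht⟩
      rw [map_der, hs', ← smul_eq_C_mul, Derivation.map_smul, hs, map_C, smul_eq_C_mul, mul_one]
    simpa using (hI 1).1 (this ▸ Submodule.mem_top)
  obtain ⟨s, hs⟩ := hs
  refine ⟨s, f, g, hs, le_antisymm (fun r hr => ?_) (Algebra.adjoin_le ?_)⟩
  · exact mem_adjoin_of_good (K := K) (fun v => by rw [hfc, hgc]; exact hg v) ((hmem r).1 hr)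
  · rintro r (rfl | rfl)
    · exact (hmem _).2 (Algebra.subset_adjoin (by simp))
    · exact (hmem _).2 (Algebra.subset_adjoin (by simp))

end Dedekind

end TriAction

open TriAction

theorem statement1 {A : Type*} [CommRing A] [IsDomain A] [IsDedekindDomain A]
    -- `A` contains a field of characteristic 0
    [Algebra ℚ A]
    (D : Derivation A (MvPolynomial (Fin 3) A) (MvPolynomial (Fin 3) A))
    -- triangularity: ∂y ∈ A, ∂z ∈ A[y], ∂u ∈ A[y,z]   (y = X 0, z = X 1, u = X 2)
    (hy : ∃ a : A, D (X 0) = C a)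
    (hz : ∃ q : Polynomial A, D (X 1) = Polynomial.aeval (X 0 : MvPolynomial (Fin 3) A) q)
    (hu : ∃ p : MvPolynomial (Fin 2) A,
      D (X 2) = MvPolynomial.aeval (fun i : Fin 2 =>
        if i = 0 then (X 0 : MvPolynomial (Fin 3) A) else X 1) p)
    -- properness of the generated G_a-action
    (hproper : IsProperGaAction D) :
    -- the action is a translation:
    ∃ s : MvPolynomial (Fin 3) A, D s = 1 ∧
      Nonempty (↥(kerDer D) ≃ₐ[A] MvPolynomial (Fin 2) A) ∧
      Function.Bijective (Polynomial.aeval (R := ↥(kerDer D)) s) := by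
  obtain ⟨a, ha⟩ := hy
  obtain ⟨q, hq⟩ := hz
  obtain ⟨p, hp⟩ := hu
  obtain ⟨P, hP⟩ : ∃ P : Polynomial (Polynomial A),
      Polynomial.aevalAeval (X 0 : MvPolynomial (Fin 3) A) (X 1) P = D (X 2) := by
    refine ⟨aeval ![Polynomial.C Polynomial.X, Polynomial.X] p, ?_⟩
    rw [hp, ← AlgHom.comp_apply]
    congr 1
    ext i : 1
    fin_cases i
    · simp
    · simp
  obtain rfl : D = der a q P := MvPolynomial.derivation_ext fun i => by
    fin_cases i
    · exact ha.trans (der_X0 a q P).symm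
    · exact hq.trans (der_X1 a q P).symm
    · exact hP.symm.trans (der_X2 a q P).symm
  have hE : HitsVar (expHom a q P) := (isExp_expHom a q P).exists_of_isProper hproper
  by_cases h0 : a = 0
  · subst h0
    obtain ⟨v, s, hs, hker, -⟩ := exists_slice_of_zero q P (HitsVar.span_eq_top _ _ _ hE)
    exact translation_of_kerDer_eq (isExp_expHom _ _ _) hs hker
  · obtain ⟨s, v, w, hs, hker⟩ := exists_slice_and_kerDer_eq h0 hE
    exact translation_of_kerDer_eq (isExp_expHom _ _ _) hs hker
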